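/- As k → ∞, the squared norm (Θ_C^{(k)}, Θ_C^{(k)}) is asymptotic to k^{n−1/2} · (n+1)^{n−1/2} / (π^{(3n−1)/(2n+2)} · (n!)^{(n−1)/(n+1)}) · l(C)/√2, i.e., the ratio of the two sides tends to 1. -/

import Mathlib

open scoped BigOperators
open Complex MeasureTheory Filter Topology Matrix

namespace BallPaper

noncomputable section

variable {n : ℕ}

/-- The unit ball in ℂⁿ. -/
def ball (n : ℕ) : Set (Fin n → ℂ) := {z | ∑ i, ‖z i‖ ^ 2 < 1}

/-- ⟨z,w⟩ = z₁ conj w₁ + ... + zₙ conj wₙ − 1. -/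
def pair (z w : Fin n → ℂ) : ℂ := ∑ i, z i * star (w i) - 1

/-- The Hermitian form of signature (n,1) on ℂ^{n+1}:
⟨⟨u,v⟩⟩ = u₁ conj v₁ + ... + uₙ conj vₙ − u_{n+1} conj v_{n+1}. -/
def herm (u v : Fin (n + 1) → ℂ) : ℂ :=
  ∑ i : Fin n, u i.castSucc * star (v i.castSucc) - u (Fin.last n) * star (v (Fin.last n))

/-- SU(n,1): determinant-one matrices preserving the (n,1) Hermitian form. -/
def SU (n : ℕ) : Set (Matrix (Fin (n + 1)) (Fin (n + 1)) ℂ) :=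
  {A | A.det = 1 ∧ ∀ u v, herm (A.mulVec u) (A.mulVec v) = herm u v}

/-- The denominator a_{n+1,1} z₁ + ... + a_{n+1,n} zₙ + a_{n+1,n+1} of the
fractional-linear action. -/
def denom (A : Matrix (Fin (n + 1)) (Fin (n + 1)) ℂ) (z : Fin n → ℂ) : ℂ :=
  ∑ j : Fin n, A (Fin.last n) j.castSucc * z j + A (Fin.last n) (Fin.last n)

/-- The fractional-linear action of a matrix on ℂⁿ (defined on the ball). -/
def act (A : Matrix (Fin (n + 1)) (Fin (n + 1)) ℂ) (z : Fin n → ℂ) : Fin n → ℂ :=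
  fun j => (∑ l : Fin n, A j.castSucc l.castSucc * z l + A j.castSucc (Fin.last n)) / denom A z

/-- The complex Jacobian J(A,z) = (denominator)^{-(n+1)}. -/
def jac (A : Matrix (Fin (n + 1)) (Fin (n + 1)) ℂ) (z : Fin n → ℂ) : ℂ :=
  (denom A z)⁻¹ ^ (n + 1)

/-- The Bergman kernel K(z,w) = (n!/πⁿ) (−⟨z,w⟩)^{−(n+1)}. -/
def Kc (z w : Fin n → ℂ) : ℂ :=
  (((Nat.factorial n : ℝ) / Real.pi ^ n : ℝ) : ℂ) * (-(pair z w))⁻¹ ^ (n + 1)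

/-- K(z,z) as a real-valued function: K(z,z) = (n!/πⁿ) (1−|z|²)^{−(n+1)}. -/
def Kr (z : Fin n → ℂ) : ℝ :=
  (Nat.factorial n : ℝ) / Real.pi ^ n * ((1 - ∑ i, ‖z i‖ ^ 2)⁻¹) ^ (n + 1)

/-- c(𝔹ⁿ,k) = C((n+1)(k−1)+n, n). -/
def cB (n k : ℕ) : ℕ := Nat.choose ((n + 1) * (k - 1) + n) n

/-- The last index of Fin n. -/
def lastI (n : ℕ) (hn : 0 < n) : Fin n := ⟨n - 1, by omega⟩

/-- The geodesic C̃₀ = {z ∈ 𝔹ⁿ : z₁ = ... = z_{n−1} = 0, zₙ ∈ (−1,1) real}. -/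
def geo0 (n : ℕ) (hn : 0 < n) : Set (Fin n → ℂ) :=
  {z | (∀ i : Fin n, (i : ℕ) < n - 1 → z i = 0) ∧ (z (lastI n hn)).im = 0 ∧
    -1 < (z (lastI n hn)).re ∧ (z (lastI n hn)).re < 1}

/-- The point (0,...,0,x) of C̃₀. -/
def curve (n : ℕ) (hn : 0 < n) (x : ℝ) : Fin n → ℂ :=
  fun i => if i = lastI n hn then (x : ℂ) else 0

/-- The vector (X,1) ∈ ℂ^{n+1}. -/
def snoc1 (X : Fin n → ℂ) : Fin (n + 1) → ℂ := Fin.snoc X 1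

/-- The matrix A_γ, with columns v₁,...,v_{n−1},
⟨X,Y⟩⁻¹(X,1) + (1/2)(Y,1), ⟨X,Y⟩⁻¹(X,1) − (1/2)(Y,1). -/
def Amat (n : ℕ) (v : Fin (n - 1) → Fin (n + 1) → ℂ) (X Y : Fin n → ℂ) :
    Matrix (Fin (n + 1)) (Fin (n + 1)) ℂ :=
  Matrix.of fun i j =>
    if h : (j : ℕ) < n - 1 then v ⟨j, h⟩ i
    else if (j : ℕ) = n - 1 then ((pair X Y)⁻¹ • snoc1 X + (2 : ℂ)⁻¹ • snoc1 Y) i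
    else ((pair X Y)⁻¹ • snoc1 X - (2 : ℂ)⁻¹ • snoc1 Y) i

/-- σ = diag(1,...,1,−1). -/
def sigmaM (n : ℕ) : Matrix (Fin (n + 1)) (Fin (n + 1)) ℂ :=
  Matrix.diagonal fun i => if i = Fin.last n then -1 else 1

/-- Inverse hyperbolic cosine. -/
def arcosh (x : ℝ) : ℝ := Real.log (x + Real.sqrt (x ^ 2 - 1))

/-- Inverse hyperbolic tangent. -/
def artanh (x : ℝ) : ℝ := Real.log ((1 + x) / (1 - x)) / 2

/-- The hyperbolic (Bergman) distance on the ball, determined by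
cosh²(ρ(z,w)/2) = ⟨z,w⟩⟨w,z⟩/(⟨z,z⟩⟨w,w⟩). -/
def rho (z w : Fin n → ℂ) : ℝ :=
  2 * arcosh (Real.sqrt ((pair z w * pair w z).re / (pair z z * pair w w).re))

/-- A discrete subgroup Γ of SU(n,1) acting freely on the ball with compact quotient. -/
structure DiscreteGroup (n : ℕ) where
  Γ : Set (Matrix (Fin (n + 1)) (Fin (n + 1)) ℂ)
  sub_SU : Γ ⊆ SU n
  one_mem : 1 ∈ Γ
  mul_mem : ∀ {A B}, A ∈ Γ → B ∈ Γ → A * B ∈ Γ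
  inv_mem : ∀ {A}, A ∈ Γ → A⁻¹ ∈ Γ
  discrete : DiscreteTopology ↥Γ
  free : ∀ A ∈ Γ, (∃ z ∈ ball n, act A z = z) → A = 1
  cocompact : ∃ F : Set (Fin n → ℂ), F ⊆ ball n ∧ IsCompact F ∧
    ∀ z ∈ ball n, ∃ A ∈ Γ, act A z ∈ F

/-- A hyperbolic element γ of Γ, with real eigenvalues, real fixed points X, Y on the
boundary, eigenvalue data λ, and the eigenvectors v₁,...,v_{n−1} for eigenvalues ±1,
orthonormal with respect to the form ⟨⟨.,.⟩⟩. -/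
structure HypElt (n : ℕ) (G : DiscreteGroup n) where
  γ : Matrix (Fin (n + 1)) (Fin (n + 1)) ℂ
  mem : γ ∈ G.Γ
  ne_one : γ ≠ 1
  eig_real : ∀ μ ∈ spectrum ℂ γ, μ.im = 0
  X : Fin n → ℂ
  Y : Fin n → ℂ
  X_bd : ∑ i, ‖X i‖ ^ 2 = 1
  Y_bd : ∑ i, ‖Y i‖ ^ 2 = 1
  X_real : ∀ i, (X i).im = 0
  Y_real : ∀ i, (Y i).im = 0
  lam : ℝ
  lam_sq : 1 < lam ^ 2
  eigX : γ.mulVec (snoc1 X) = (lam : ℂ) • snoc1 X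
  eigY : γ.mulVec (snoc1 Y) = ((lam : ℂ))⁻¹ • snoc1 Y
  primitive : ∀ A ∈ G.Γ, ∀ m : ℕ, 2 ≤ m → A ^ m ≠ γ
  v : Fin (n - 1) → Fin (n + 1) → ℂ
  alph : Fin (n - 1) → ℂ
  alph_pm : ∀ j, alph j = 1 ∨ alph j = -1
  v_eig : ∀ j, γ.mulVec (v j) = alph j • v j
  v_on : ∀ j l, herm (v j) (v l) = if j = l then 1 else 0

variable {G : DiscreteGroup n}

/-- The matrix A_γ associated to the hyperbolic element γ. -/
def HypElt.A (H : HypElt n G) : Matrix (Fin (n + 1)) (Fin (n + 1)) ℂ :=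
  Amat n H.v H.X H.Y

/-- γ₀ = A_γ⁻¹ γ A_γ. -/
def HypElt.g0 (H : HypElt n G) : Matrix (Fin (n + 1)) (Fin (n + 1)) ℂ :=
  (H.A)⁻¹ * H.γ * H.A

/-- T = (λ²−1)/(λ²+1), the last coordinate of γ₀(0). -/
def HypElt.T (H : HypElt n G) : ℝ := (H.lam ^ 2 - 1) / (H.lam ^ 2 + 1)

/-- The geodesic C̃ in 𝔹ⁿ with endpoints X, Y, as the image of C̃₀ under A_γ. -/
def HypElt.Ct (H : HypElt n G) (hn : 0 < n) : Set (Fin n → ℂ) :=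
  act H.A '' geo0 n hn

/-- The length l(C) of the closed geodesic C, the hyperbolic distance from 0 to γ₀(0). -/
def HypElt.lenC (H : HypElt n G) : ℝ :=
  rho (0 : Fin n → ℂ) (act H.g0 (0 : Fin n → ℂ))

/-- A (measure-theoretic) fundamental domain for the action of Γ on the ball. -/
def IsFundDom (G : DiscreteGroup n) (F : Set (Fin n → ℂ)) : Prop :=
  F ⊆ ball n ∧ MeasurableSet F ∧ (∀ z ∈ ball n, ∃ A ∈ G.Γ, act A z ∈ F) ∧
    ∀ A ∈ G.Γ, A ≠ 1 → volume {z ∈ F | act A z ∈ F} = 0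

/-- The automorphy condition f(Az) J(A,z)^k = f(z). -/
def Automorphic (G : DiscreteGroup n) (k : ℕ) (f : (Fin n → ℂ) → ℂ) : Prop :=
  ∀ A ∈ G.Γ, ∀ z ∈ ball n, f (act A z) * jac A z ^ k = f z

/-- Membership in H̃⁰_Γ(k): holomorphic on the ball and automorphic of weight k. -/
def Htilde (G : DiscreteGroup n) (k : ℕ) (f : (Fin n → ℂ) → ℂ) : Prop :=
  DifferentiableOn ℂ f (ball n) ∧ Automorphic G k f

/-- The inner product (f,g) = ∫_M f ḡ K(z,z)^{−k} dV = ∫_F f ḡ K(z,z)^{1−k} dV_e,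
computed over a fundamental domain F. -/
def iprod (F : Set (Fin n → ℂ)) (k : ℕ) (f g : (Fin n → ℂ) → ℂ) : ℂ :=
  ∫ z in F, f z * star (g z) * ((Kr z ^ ((1 : ℤ) - (k : ℤ)) : ℝ) : ℂ)

/-- The Poincaré series Θ_w^{(k)}(z) = c(𝔹ⁿ,k) Σ_{A∈Γ} K(Az,w)^k J(A,z)^k. -/
def ThetaPt (G : DiscreteGroup n) (k : ℕ) (w z : Fin n → ℂ) : ℂ :=
  (cB n k : ℂ) * ∑' A : ↥G.Γ, Kc (act (A : Matrix (Fin (n + 1)) (Fin (n + 1)) ℂ) z) w ^ k *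
    jac (A : Matrix (Fin (n + 1)) (Fin (n + 1)) ℂ) z ^ k

/-- The relative Poincaré series
Θ_C^{(k)}(z) = ∫_C Θ_w^{(k)}(z) K(w,w)^{−k/2} ((A_γ⁻¹)*φ)(w), written out over one
period of C̃, parametrized by w = A_γ(0,...,0,x), x ∈ [0,T]. -/
def ThetaC (hn : 0 < n) (H : HypElt n G) (k : ℕ) (z : Fin n → ℂ) : ℂ :=
  ∫ x in (0 : ℝ)..H.T, ThetaPt G k (act H.A (curve n hn x)) z *
    ((Kr (act H.A (curve n hn x)) ^ (-(k : ℝ) / 2) : ℝ) : ℂ) *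
    ((Kr (curve n hn x) ^ (((n : ℝ) + 1))⁻¹ : ℝ) : ℂ)

/-- The set of integer powers of a matrix. -/
def zpows (g : Matrix (Fin (n + 1)) (Fin (n + 1)) ℂ) :
    Set (Matrix (Fin (n + 1)) (Fin (n + 1)) ℂ) := {h | ∃ m : ℤ, h = g ^ m}

/-- The conjugate group A_γ⁻¹ Γ A_γ. -/
def conjGrp (G : DiscreteGroup n) (H : HypElt n G) :
    Set (Matrix (Fin (n + 1)) (Fin (n + 1)) ℂ) :=
  (fun g => (H.A)⁻¹ * g * H.A) '' G.Γ

end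

end BallPaper

namespace BallPaper

section Hermitian

variable {n : ℕ}

@[simp] lemma snoc1_castSucc (z : Fin n → ℂ) (i : Fin n) : snoc1 z i.castSucc = z i := by
  simp [snoc1]

@[simp] lemma snoc1_last (z : Fin n → ℂ) : snoc1 z (Fin.last n) = 1 := by
  simp [snoc1]

lemma herm_add_left (u v w : Fin (n + 1) → ℂ) : herm (u + v) w = herm u w + herm v w := by
  simp only [herm, Pi.add_apply, add_mul, Finset.sum_add_distrib]; ring

lemma herm_smul_left (c : ℂ) (u v : Fin (n + 1) → ℂ) : herm (c • u) v = c * herm u v := by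
  simp only [herm, Pi.smul_apply, smul_eq_mul, mul_assoc, mul_sub, Finset.mul_sum]

lemma herm_conj (u v : Fin (n + 1) → ℂ) : star (herm u v) = herm v u := by
  simp only [herm, star_sub, star_sum, star_mul', star_star, mul_comm]

lemma herm_add_right (u v w : Fin (n + 1) → ℂ) : herm u (v + w) = herm u v + herm u w := by
  rw [← herm_conj, herm_add_left, star_add, herm_conj, herm_conj]

lemma herm_smul_right (c : ℂ) (u v : Fin (n + 1) → ℂ) :
    herm u (c • v) = star c * herm u v := by
  rw [← herm_conj, herm_smul_left, star_mul', herm_conj]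

lemma norm_herm_comm (u v : Fin (n + 1) → ℂ) : ‖herm u v‖ = ‖herm v u‖ := by
  rw [← herm_conj, norm_star]

lemma herm_sub_left (u v w : Fin (n + 1) → ℂ) : herm (u - v) w = herm u w - herm v w := by
  simp only [herm, Pi.sub_apply, sub_mul, Finset.sum_sub_distrib]; ring

lemma herm_sub_right (u v w : Fin (n + 1) → ℂ) : herm u (v - w) = herm u v - herm u w := by
  rw [← herm_conj, herm_sub_left, star_sub, herm_conj, herm_conj]

/-- The real quadratic form attached to the Hermitian form. -/
noncomputable def hq (v : Fin (n + 1) → ℂ) : ℝ :=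
  ∑ i : Fin n, ‖v i.castSucc‖ ^ 2 - ‖v (Fin.last n)‖ ^ 2

lemma herm_self (v : Fin (n + 1) → ℂ) : herm v v = (hq v : ℂ) := by
  simp [herm, hq, Complex.mul_conj, Complex.normSq_eq_norm_sq]

lemma hq_eq_of_herm {v : Fin (n + 1) → ℂ} {r : ℝ} (h : herm v v = (r : ℂ)) : hq v = r := by
  rw [herm_self] at h; exact_mod_cast h

lemma herm_snoc1 (z w : Fin n → ℂ) : herm (snoc1 z) (snoc1 w) = pair z w := by
  simp [herm, pair]

lemma hq_snoc1 (z : Fin n → ℂ) : hq (snoc1 z) = -(1 - ∑ i, ‖z i‖ ^ 2) := by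
  simp [hq]

lemma hq_smul (c : ℂ) (v : Fin (n + 1) → ℂ) : hq (c • v) = ‖c‖ ^ 2 * hq v := by
  simp [hq, mul_pow, mul_sub, Finset.mul_sum]

/-- The last standard basis vector, representing the centre of the ball. -/
noncomputable def e0 (n : ℕ) : Fin (n + 1) → ℂ := Pi.single (Fin.last n) 1

lemma herm_e0 (v : Fin (n + 1) → ℂ) : herm v (e0 n) = -v (Fin.last n) := by
  simp [herm, e0]

lemma snoc1_zero : snoc1 (0 : Fin n → ℂ) = e0 n := by
  funext i
  refine Fin.lastCases ?_ (fun j => ?_) i <;> simp [e0]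

lemma norm_sum_mul_star_le (x y : Fin n → ℂ) :
    ‖∑ i, x i * star (y i)‖ ^ 2 ≤ (∑ i, ‖x i‖ ^ 2) * ∑ i, ‖y i‖ ^ 2 := by
  calc ‖∑ i, x i * star (y i)‖ ^ 2 ≤ (∑ i, ‖x i‖ * ‖y i‖) ^ 2 := by
        gcongr
        refine (norm_sum_le _ _).trans (le_of_eq ?_)
        simp
    _ ≤ _ := Finset.sum_mul_sq_le_sq_mul_sq _ _ _

/-- Reverse Cauchy–Schwarz bound by last coordinates. -/
lemma norm_herm_ge {u x : Fin (n + 1) → ℂ} {r : ℝ} (hr : 0 ≤ r)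
    (hu : ∑ i : Fin n, ‖u i.castSucc‖ ^ 2 ≤ (r * ‖u (Fin.last n)‖) ^ 2) (hx : hq x ≤ 0) :
    (1 - r) * ‖u (Fin.last n)‖ * ‖x (Fin.last n)‖ ≤ ‖herm x u‖ := by
  have h1 := norm_sum_mul_star_le (fun i : Fin n => x i.castSucc) (fun i => u i.castSucc)
  have h2 : ∑ i : Fin n, ‖x i.castSucc‖ ^ 2 ≤ ‖x (Fin.last n)‖ ^ 2 := by
    simpa [hq] using hx
  have h3 : ‖∑ i : Fin n, x i.castSucc * star (u i.castSucc)‖ ≤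
      ‖x (Fin.last n)‖ * (r * ‖u (Fin.last n)‖) := by
    refine le_of_sq_le_sq ?_ (by positivity)
    calc _ ≤ _ := h1
      _ ≤ ‖x (Fin.last n)‖ ^ 2 * (r * ‖u (Fin.last n)‖) ^ 2 := by gcongr
      _ = _ := by ring
  have h4 : ‖x (Fin.last n) * star (u (Fin.last n))‖ -
      ‖∑ i : Fin n, x i.castSucc * star (u i.castSucc)‖ ≤ ‖herm x u‖ := by
    rw [herm, norm_sub_rev]; exact norm_sub_norm_le _ _
  rw [norm_mul, norm_star] at h4
  nlinarith

/-- The form is positive definite on the orthogonal complement of a negative vector. -/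
lemma hq_nonneg_of_orth {b x : Fin (n + 1) → ℂ} (hb : hq b < 0) (h : herm x b = 0) :
    0 ≤ hq x ∧ (hq x = 0 → x = 0) := by
  have h1 := norm_sum_mul_star_le (fun i : Fin n => x i.castSucc) (fun i => b i.castSucc)
  beta_reduce at h1
  have h2 : ∑ i : Fin n, x i.castSucc * star (b i.castSucc) =
      x (Fin.last n) * star (b (Fin.last n)) := sub_eq_zero.mp h
  rw [h2, norm_mul, norm_star, mul_pow] at h1
  unfold hq at *
  set X := ∑ i : Fin n, ‖x i.castSucc‖ ^ 2 with hX
  set Bq := ∑ i : Fin n, ‖b i.castSucc‖ ^ 2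
  have hX0 : 0 ≤ X := by positivity
  have hB0 : 0 ≤ Bq := by positivity
  have hx0 : 0 ≤ ‖x (Fin.last n)‖ ^ 2 := by positivity
  constructor
  · by_contra! hc
    nlinarith
  · intro h0
    have hx : ‖x (Fin.last n)‖ ^ 2 = 0 := by
      by_contra hne
      have : 0 < ‖x (Fin.last n)‖ ^ 2 := lt_of_le_of_ne hx0 (Ne.symm hne)
      nlinarith
    have hX' : X = 0 := by linarith
    have := (Finset.sum_eq_zero_iff_of_nonneg (fun i _ => by positivity)).mp hX'
    funext i
    refine Fin.lastCases ?_ (fun j => ?_) i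
    · simpa using hx
    · simpa using this j (Finset.mem_univ j)

/-- Two unit negative vectors pair to at least one in modulus, with equality only if
they are proportional. -/
lemma one_le_norm_herm {u v : Fin (n + 1) → ℂ} (hu : hq u = -1) (hv : hq v = -1) :
    1 ≤ ‖herm v u‖ ∧ (‖herm v u‖ = 1 → v = (-herm v u) • u) := by
  have huu : herm u u = -1 := by rw [herm_self, hu]; simp
  have hvv : herm v v = -1 := by rw [herm_self, hv]; simp
  set x := v + herm v u • u with hx
  have hxu : herm x u = 0 := by
    rw [hx, herm_add_left, herm_smul_left, huu]; ring
  have hxx : hq x = ‖herm v u‖ ^ 2 - 1 := by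
    apply hq_eq_of_herm
    have : herm x x = herm x v := by
      conv_lhs => rw [hx, herm_add_right, herm_smul_right, ← hx, hxu]
      simp
    rw [this, hx, herm_add_left, herm_smul_left, hvv, ← herm_conj v u]
    simp only [Complex.star_def, Complex.mul_conj, Complex.normSq_eq_norm_sq]
    push_cast; ring
  have := hq_nonneg_of_orth (by rw [hu]; norm_num) hxu
  refine ⟨?_, fun h => ?_⟩
  · nlinarith [norm_nonneg (herm v u), this.1]
  · have h0 := this.2 (by rw [hxx, h]; norm_num)
    rw [neg_smul]; exact eq_neg_of_add_eq_zero_left (hx ▸ h0)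

/-- Bessel's inequality for a pair consisting of a positive and a negative unit vector. -/
lemma bessel_pair {a b v : Fin (n + 1) → ℂ} (ha : herm a a = 1) (hb : herm b b = -1)
    (hab : herm a b = 0) (hv : hq v = -1) :
    1 + ‖herm v a‖ ^ 2 ≤ ‖herm v b‖ ^ 2 := by
  have hba : herm b a = 0 := by rw [← herm_conj, hab, star_zero]
  have hvv : herm v v = -1 := by rw [herm_self, hv]; simp
  set x := v - herm v a • a + herm v b • b with hx
  have hxb : herm x b = 0 := by
    rw [hx, herm_add_left, herm_sub_left, herm_smul_left, herm_smul_left, hb, hab]; ring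
  have hxa : herm x a = 0 := by
    rw [hx, herm_add_left, herm_sub_left, herm_smul_left, herm_smul_left, ha, hba]; ring
  have hxx : hq x = -1 - ‖herm v a‖ ^ 2 + ‖herm v b‖ ^ 2 := by
    apply hq_eq_of_herm
    have : herm x x = herm x v := by
      conv_lhs => rw [hx, herm_add_right, herm_sub_right, herm_smul_right, herm_smul_right, ← hx,
        hxa, hxb]
      simp
    rw [this, hx, herm_add_left, herm_sub_left, herm_smul_left, herm_smul_left, hvv,
      ← herm_conj v a, ← herm_conj v b]
    simp only [Complex.star_def, Complex.mul_conj, Complex.normSq_eq_norm_sq]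
    push_cast; ring
  have hb' : hq b < 0 := by
    rw [hq_eq_of_herm (r := -1) (by rw [hb]; simp)]; norm_num
  linarith [(hq_nonneg_of_orth hb' hxb).1]

lemma exists_cosh_le (p q : ℂ) (h : 1 + ‖p‖ ^ 2 ≤ ‖q‖ ^ 2) :
    ∃ t₀ : ℝ, ∀ t : ℝ, Real.cosh (t - t₀) ≤ ‖(Real.sinh t : ℂ) * p + (Real.cosh t : ℂ) * q‖ := by
  have hq0 : 0 < ‖q‖ := by
    by_contra! hc
    have : ‖q‖ = 0 := le_antisymm hc (norm_nonneg _)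
    rw [this] at h; nlinarith [sq_nonneg ‖p‖]
  set c : ℂ := star q / ‖q‖ with hc
  have hcn : ‖c‖ = 1 := by
    rw [hc, norm_div, norm_star]; simp [hq0.ne']
  have hcq : c * q = (‖q‖ : ℂ) := by
    have : star q * q = (‖q‖ : ℂ) ^ 2 := by
      rw [mul_comm, Complex.star_def, Complex.mul_conj, Complex.normSq_eq_norm_sq]; simp
    rw [hc, div_mul_eq_mul_div, this]
    field_simp
  set r := (c * p).re with hr
  have hrp : r ^ 2 ≤ ‖p‖ ^ 2 := by
    have : |r| ≤ ‖c * p‖ := Complex.abs_re_le_norm _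
    rw [norm_mul, hcn, one_mul] at this
    exact sq_le_sq' (by linarith [neg_abs_le r]) (by linarith [le_abs_self r])
  refine ⟨-Real.arsinh r, fun t => ?_⟩
  have hn : ‖(Real.sinh t : ℂ) * p + (Real.cosh t : ℂ) * q‖ =
      ‖c * ((Real.sinh t : ℂ) * p + (Real.cosh t : ℂ) * q)‖ := by
    rw [norm_mul, hcn, one_mul]
  have hre : (c * ((Real.sinh t : ℂ) * p + (Real.cosh t : ℂ) * q)).re =
      Real.sinh t * r + Real.cosh t * ‖q‖ := by
    have : c * ((Real.sinh t : ℂ) * p + (Real.cosh t : ℂ) * q) =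
      (Real.sinh t : ℂ) * (c * p) + ((Real.cosh t * ‖q‖ : ℝ) : ℂ) := by
      push_cast; rw [← hcq]; ring
    rw [this, Complex.add_re, Complex.re_ofReal_mul, Complex.ofReal_re]
  rw [hn]
  refine le_trans ?_ ((le_abs_self _).trans (Complex.abs_re_le_norm _))
  rw [hre, sub_neg_eq_add, Real.cosh_add, Real.sinh_arsinh, Real.cosh_arsinh]
  have : Real.sqrt (1 + r ^ 2) ≤ ‖q‖ := by
    apply Real.sqrt_le_iff.mpr ⟨hq0.le, by linarith⟩
  nlinarith [Real.cosh_pos t]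

end Hermitian

section Unitary

variable {n : ℕ}

/-- Matrices preserving the Hermitian form. -/
def IsU (A : Matrix (Fin (n + 1)) (Fin (n + 1)) ℂ) : Prop :=
  ∀ u v, herm (A *ᵥ u) (A *ᵥ v) = herm u v

/-- The defining function of the ball, positive inside. -/
noncomputable def defect (z : Fin n → ℂ) : ℝ := 1 - ∑ i, ‖z i‖ ^ 2

lemma mem_ball_iff {z : Fin n → ℂ} : z ∈ ball n ↔ 0 < defect z := by
  simp [ball, defect]

lemma hq_snoc1' (z : Fin n → ℂ) : hq (snoc1 z) = -defect z := hq_snoc1 z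

lemma mulVec_snoc1_last (A : Matrix (Fin (n + 1)) (Fin (n + 1)) ℂ) (z : Fin n → ℂ) :
    (A *ᵥ snoc1 z) (Fin.last n) = denom A z := by
  simp [mulVec, dotProduct, Fin.sum_univ_castSucc, denom]

lemma mulVec_snoc1 (A : Matrix (Fin (n + 1)) (Fin (n + 1)) ℂ) (z : Fin n → ℂ)
    (h : denom A z ≠ 0) : A *ᵥ snoc1 z = denom A z • snoc1 (act A z) := by
  funext i
  refine Fin.lastCases ?_ (fun j => ?_) i
  · simp [mulVec_snoc1_last]
  · simp only [Pi.smul_apply, snoc1_castSucc, act, smul_eq_mul]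
    rw [mul_div_cancel₀ _ h]
    simp [mulVec, dotProduct, Fin.sum_univ_castSucc]

lemma snoc1_injective : Function.Injective (snoc1 : (Fin n → ℂ) → Fin (n + 1) → ℂ) := by
  intro z w h
  funext i
  simpa using congrFun h i.castSucc

lemma act_eq_of_mulVec {A : Matrix (Fin (n + 1)) (Fin (n + 1)) ℂ} {z w : Fin n → ℂ} {c : ℂ}
    (hc : c ≠ 0) (h : A *ᵥ snoc1 z = c • snoc1 w) : act A z = w := by
  have hd : denom A z = c := by
    rw [← mulVec_snoc1_last, h]; simp
  rw [mulVec_snoc1 A z (hd ▸ hc), hd] at h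
  exact snoc1_injective (smul_right_injective _ hc h)

lemma IsU.hq {A : Matrix (Fin (n + 1)) (Fin (n + 1)) ℂ} (hA : IsU A) (v : Fin (n + 1) → ℂ) :
    hq (A *ᵥ v) = hq v :=
  hq_eq_of_herm (by rw [hA, herm_self])

lemma last_ne_zero_of_hq_neg {v : Fin (n + 1) → ℂ} (h : hq v < 0) : v (Fin.last n) ≠ 0 := by
  intro h0
  rw [BallPaper.hq, h0] at h
  have : 0 ≤ ∑ i : Fin n, ‖v i.castSucc‖ ^ 2 := by positivity
  simp at h; linarith

lemma IsU.denom_ne_zero {A : Matrix (Fin (n + 1)) (Fin (n + 1)) ℂ} (hA : IsU A)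
    {z : Fin n → ℂ} (hz : z ∈ ball n) : denom A z ≠ 0 := by
  rw [← mulVec_snoc1_last]
  apply last_ne_zero_of_hq_neg
  rw [hA.hq, hq_snoc1']
  linarith [mem_ball_iff.mp hz]

lemma IsU.mulVec_snoc1 {A : Matrix (Fin (n + 1)) (Fin (n + 1)) ℂ} (hA : IsU A)
    {z : Fin n → ℂ} (hz : z ∈ ball n) : A *ᵥ snoc1 z = denom A z • snoc1 (act A z) :=
  BallPaper.mulVec_snoc1 A z (hA.denom_ne_zero hz)

lemma IsU.defect_eq {A : Matrix (Fin (n + 1)) (Fin (n + 1)) ℂ} (hA : IsU A)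
    {z : Fin n → ℂ} (hz : z ∈ ball n) : defect z = ‖denom A z‖ ^ 2 * defect (act A z) := by
  have := hA.hq (snoc1 z)
  rw [hA.mulVec_snoc1 hz, hq_smul, hq_snoc1', hq_snoc1'] at this
  linarith

lemma IsU.act_mem {A : Matrix (Fin (n + 1)) (Fin (n + 1)) ℂ} (hA : IsU A)
    {z : Fin n → ℂ} (hz : z ∈ ball n) : act A z ∈ ball n := by
  have h := hA.defect_eq hz
  rw [mem_ball_iff] at *
  by_contra! hc
  nlinarith [sq_nonneg ‖denom A z‖]

lemma isU_one : IsU (1 : Matrix (Fin (n + 1)) (Fin (n + 1)) ℂ) := fun u v => by simp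

lemma herm_eq_dotProduct (u v : Fin (n + 1) → ℂ) :
    herm u v = star v ⬝ᵥ (sigmaM n *ᵥ u) := by
  simp [herm, sigmaM, mulVec_diagonal, dotProduct, Fin.sum_univ_castSucc, mul_comm,
    sub_eq_add_neg, (Fin.castSucc_lt_last _).ne]

lemma IsU.conjTranspose_mul {A : Matrix (Fin (n + 1)) (Fin (n + 1)) ℂ} (hA : IsU A) :
    Aᴴ * sigmaM n * A = sigmaM n := by
  ext i j
  have key : ∀ B : Matrix (Fin (n + 1)) (Fin (n + 1)) ℂ,
      (Bᴴ * sigmaM n * B) i j = herm (B *ᵥ Pi.single j 1) (B *ᵥ Pi.single i 1) := by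
    intro B
    rw [herm_eq_dotProduct, star_mulVec, ← dotProduct_mulVec, mulVec_mulVec, mulVec_mulVec]
    simp
  have h1 := key 1
  simp only [conjTranspose_one, Matrix.one_mul, Matrix.mul_one] at h1
  rw [h1, key, hA, one_mulVec, one_mulVec]

lemma sigmaM_mul_self : sigmaM n * sigmaM n = 1 := by
  rw [sigmaM, diagonal_mul_diagonal, ← diagonal_one]
  congr 1; funext i; split_ifs <;> simp

lemma IsU.norm_det {A : Matrix (Fin (n + 1)) (Fin (n + 1)) ℂ} (hA : IsU A) : ‖A.det‖ = 1 := by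
  have h := congrArg det hA.conjTranspose_mul
  have hs : (sigmaM n).det * (sigmaM n).det = 1 := by
    rw [← det_mul, sigmaM_mul_self, det_one]
  have hs0 : (sigmaM n).det ≠ 0 := left_ne_zero_of_mul_eq_one hs
  rw [det_mul, det_mul, det_conjTranspose] at h
  have h2 : star A.det * A.det = 1 := by
    apply mul_right_cancel₀ hs0
    linear_combination h
  have h3 := congrArg norm h2
  rw [norm_mul, norm_star, norm_one] at h3
  nlinarith [norm_nonneg A.det]

lemma IsU.isUnit_det {A : Matrix (Fin (n + 1)) (Fin (n + 1)) ℂ} (hA : IsU A) :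
    IsUnit A.det := by
  rw [isUnit_iff_ne_zero, ← norm_ne_zero_iff, hA.norm_det]; exact one_ne_zero

lemma IsU.mul_inv_cancel {A : Matrix (Fin (n + 1)) (Fin (n + 1)) ℂ} (hA : IsU A) : A * A⁻¹ = 1 :=
  mul_nonsing_inv A hA.isUnit_det

lemma IsU.inv_mul_cancel {A : Matrix (Fin (n + 1)) (Fin (n + 1)) ℂ} (hA : IsU A) : A⁻¹ * A = 1 :=
  nonsing_inv_mul A hA.isUnit_det

lemma IsU.inv {A : Matrix (Fin (n + 1)) (Fin (n + 1)) ℂ} (hA : IsU A) : IsU A⁻¹ := fun u v => by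
  rw [← hA (A⁻¹ *ᵥ u), mulVec_mulVec, mulVec_mulVec, hA.mul_inv_cancel, one_mulVec, one_mulVec]

lemma IsU.herm_mulVec_left {A : Matrix (Fin (n + 1)) (Fin (n + 1)) ℂ} (hA : IsU A)
    (u v : Fin (n + 1) → ℂ) : herm (A *ᵥ u) v = herm u (A⁻¹ *ᵥ v) := by
  rw [← hA u, mulVec_mulVec, hA.mul_inv_cancel, one_mulVec]

lemma IsU.act_mul {A B : Matrix (Fin (n + 1)) (Fin (n + 1)) ℂ} (hA : IsU A) (hB : IsU B)
    {z : Fin n → ℂ} (hz : z ∈ ball n) : act (A * B) z = act A (act B z) := by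
  apply act_eq_of_mulVec (c := denom B z * denom A (act B z))
    (mul_ne_zero (hB.denom_ne_zero hz) (hA.denom_ne_zero (hB.act_mem hz)))
  rw [← mulVec_mulVec, hB.mulVec_snoc1 hz, mulVec_smul, hA.mulVec_snoc1 (hB.act_mem hz), smul_smul]

lemma act_one (z : Fin n → ℂ) : act 1 z = z :=
  act_eq_of_mulVec (c := 1) one_ne_zero (by simp)

lemma IsU.act_inv_act {A : Matrix (Fin (n + 1)) (Fin (n + 1)) ℂ} (hA : IsU A)
    {z : Fin n → ℂ} (hz : z ∈ ball n) : act A⁻¹ (act A z) = z := by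
  rw [← hA.inv.act_mul hA hz, hA.inv_mul_cancel, act_one]

lemma IsU.act_act_inv {A : Matrix (Fin (n + 1)) (Fin (n + 1)) ℂ} (hA : IsU A)
    {z : Fin n → ℂ} (hz : z ∈ ball n) : act A (act A⁻¹ z) = z := by
  rw [← hA.act_mul hA.inv hz, hA.mul_inv_cancel, act_one]

lemma entry_last (A : Matrix (Fin (n + 1)) (Fin (n + 1)) ℂ) :
    herm (A *ᵥ e0 n) (e0 n) = -A (Fin.last n) (Fin.last n) := by
  rw [herm_e0]; simp [e0]

lemma hq_e0 : hq (e0 n) = -1 := by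
  simp [hq, e0]

lemma IsU.norm_inv_last {A : Matrix (Fin (n + 1)) (Fin (n + 1)) ℂ} (hA : IsU A) :
    ‖A⁻¹ (Fin.last n) (Fin.last n)‖ = ‖A (Fin.last n) (Fin.last n)‖ := by
  rw [← norm_neg, ← entry_last, norm_herm_comm, ← hA.herm_mulVec_left, entry_last, norm_neg]

lemma IsU.one_le_last {A : Matrix (Fin (n + 1)) (Fin (n + 1)) ℂ} (hA : IsU A) :
    1 ≤ ‖A (Fin.last n) (Fin.last n)‖ := by
  rw [← norm_neg, ← entry_last]
  exact (one_le_norm_herm hq_e0 (by rw [hA.hq, hq_e0])).1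

lemma norm_castSucc_le {v : Fin (n + 1) → ℂ} {r : ℝ} (hr : 0 ≤ r)
    (h : hq v + ‖v (Fin.last n)‖ ^ 2 ≤ r ^ 2) (i : Fin n) : ‖v i.castSucc‖ ≤ r := by
  refine le_of_sq_le_sq ?_ hr
  refine le_trans ?_ h
  simp only [hq, sub_add_cancel]
  exact Finset.single_le_sum (f := fun i : Fin n => ‖v i.castSucc‖ ^ 2)
    (fun i _ => by positivity) (Finset.mem_univ i)

lemma IsU.norm_entry_le {A : Matrix (Fin (n + 1)) (Fin (n + 1)) ℂ} (hA : IsU A)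
    (i j : Fin (n + 1)) : ‖A i j‖ ≤ 2 * ‖A (Fin.last n) (Fin.last n)‖ := by
  have h1 := hA.one_le_last
  have hcol : ∀ B : Matrix (Fin (n + 1)) (Fin (n + 1)) ℂ, ∀ j,
      B *ᵥ Pi.single j 1 = fun i => B i j := by
    intro B j; funext i; simp
  have hrow : ∀ j : Fin n, ‖A (Fin.last n) j.castSucc‖ ≤ ‖A (Fin.last n) (Fin.last n)‖ := by
    intro j
    have h2 : ‖A (Fin.last n) j.castSucc‖ = ‖A⁻¹ j.castSucc (Fin.last n)‖ := by
      have := hA.herm_mulVec_left (Pi.single j.castSucc 1) (e0 n)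
      rw [herm_e0, hcol, e0, hcol] at this
      have h3 := congrArg norm this
      rw [norm_neg] at h3
      rw [h3]
      simp [herm, Pi.single_apply]
    rw [h2, ← hA.norm_inv_last]
    have h4 := hA.inv.hq (e0 n)
    rw [hq_e0, e0, hcol] at h4
    exact norm_castSucc_le (v := fun i => A⁻¹ i (Fin.last n)) (norm_nonneg _)
      (by rw [h4]; linarith) j
  refine Fin.lastCases ?_ (fun i => ?_) i
  · refine Fin.lastCases (by linarith) (fun j => ?_) j
    linarith [hrow j]
  · refine Fin.lastCases ?_ (fun j => ?_) j
    · have h4 := hA.hq (e0 n)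
      rw [hq_e0, e0, hcol] at h4
      refine norm_castSucc_le (v := fun i => A i (Fin.last n)) (by positivity) ?_ i
      rw [h4]; nlinarith
    · have h4 := hA.hq (Pi.single j.castSucc 1)
      rw [hcol] at h4
      refine norm_castSucc_le (v := fun i => A i j.castSucc) (by positivity) ?_ i
      rw [h4]
      have : BallPaper.hq (Pi.single j.castSucc 1 : Fin (n + 1) → ℂ) = 1 := by
        simp [BallPaper.hq, Pi.single_apply, apply_ite]
      rw [this]
      nlinarith [hrow j, norm_nonneg (A (Fin.last n) j.castSucc)]

/-- The form-preserving group acts transitively on negative lines. -/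
lemma exists_isU_e0 {v : Fin (n + 1) → ℂ} (hv : hq v < 0) :
    ∃ B : Matrix (Fin (n + 1)) (Fin (n + 1)) ℂ, IsU B ∧ ∃ c : ℂ, c ≠ 0 ∧ B *ᵥ (c • e0 n) = v := by
  set s : ℝ := Real.sqrt (-hq v) with hs
  have hs0 : 0 < s := Real.sqrt_pos.mpr (by linarith)
  have hs2 : s ^ 2 = -hq v := Real.sq_sqrt (by linarith)
  have hl := last_ne_zero_of_hq_neg hv
  have hl' : 0 < ‖v (Fin.last n)‖ := norm_pos_iff.mpr hl
  set ζ : ℂ := -(star (v (Fin.last n)) / ‖v (Fin.last n)‖) * (s : ℂ)⁻¹ with hζ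
  have hζn : ‖ζ‖ = s⁻¹ := by
    simp [hζ, abs_of_pos hs0, hl'.ne']
  have hζ0 : ζ ≠ 0 := by
    rw [← norm_ne_zero_iff, hζn]; positivity
  set w := ζ • v with hw
  have hwq : hq w = -1 := by
    rw [hw, hq_smul, hζn, inv_pow, hs2]
    have : hq v ≠ 0 := by linarith
    field_simp
  set r : ℝ := -(‖v (Fin.last n)‖ / s) with hr
  have hwl : w (Fin.last n) = (r : ℂ) := by
    have : star (v (Fin.last n)) * v (Fin.last n) = (‖v (Fin.last n)‖ : ℂ) ^ 2 := by
      rw [mul_comm, Complex.star_def, Complex.mul_conj, Complex.normSq_eq_norm_sq]; simp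
    have h3 : (‖v (Fin.last n)‖ : ℂ) ≠ 0 := by exact_mod_cast hl'.ne'
    have h4 : (s : ℂ) ≠ 0 := by exact_mod_cast hs0.ne'
    simp only [hw, hζ, Pi.smul_apply, smul_eq_mul, hr]
    push_cast
    field_simp
    linear_combination -this
  have hr0 : r < 0 := by rw [hr]; simp; positivity
  have hww : herm w w = -1 := by rw [herm_self, hwq]; simp
  have hee : herm (e0 n) (e0 n) = -1 := by rw [herm_self, hq_e0]; simp
  have hwe : herm w (e0 n) = -(r : ℂ) := by rw [herm_e0, hwl]
  have hew : herm (e0 n) w = -(r : ℂ) := by rw [← herm_conj, hwe]; simp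
  set m := e0 n - w with hm
  have hmm : herm m m = 2 * ((r : ℂ) - 1) := by
    rw [hm, herm_sub_left, herm_sub_right, herm_sub_right, hww, hee, hwe, hew]; ring
  have hr1 : (r : ℂ) - 1 ≠ 0 := by
    have : r - 1 ≠ 0 := by linarith
    exact_mod_cast this
  have hem : herm (e0 n) m = (r : ℂ) - 1 := by
    rw [hm, herm_sub_right, hee, hew]; ring
  set κ : ℂ := ((r : ℂ) - 1)⁻¹ with hκ
  have hκs : star κ = κ := by simp [hκ]
  clear_value m
  -- the reflection `x ↦ x - κ ⟨x, m⟩ m`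
  let R : (Fin (n + 1) → ℂ) →ₗ[ℂ] (Fin (n + 1) → ℂ) :=
    { toFun := fun x => x - (κ * herm x m) • m
      map_add' := fun x y => by rw [herm_add_left, mul_add, add_smul]; abel
      map_smul' := fun c x => by
        rw [herm_smul_left, RingHom.id_apply, smul_sub, smul_smul]; congr 2; ring }
  have hR : ∀ x, LinearMap.toMatrix' R *ᵥ x = x - (κ * herm x m) • m := by
    intro x
    rw [← Matrix.toLin'_apply, Matrix.toLin'_toMatrix']; rfl
  refine ⟨LinearMap.toMatrix' R, ?_, ζ⁻¹, inv_ne_zero hζ0, ?_⟩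
  · intro x y
    rw [hR, hR, herm_sub_left, herm_sub_right, herm_sub_right, herm_smul_left, herm_smul_right,
      herm_smul_left, herm_smul_right, star_mul', hκs, hmm, ← herm_conj y m]
    have : κ * ((r : ℂ) - 1) = 1 := inv_mul_cancel₀ hr1
    linear_combination 2 * κ * herm x m * star (herm y m) * this
  · rw [mulVec_smul, hR, hem, inv_mul_cancel₀ hr1, one_smul, hm, sub_sub_cancel, hw, smul_smul,
      inv_mul_cancel₀ hζ0, one_smul]

end Unitary

section Invariant

variable {n : ℕ}

lemma continuous_denom (A : Matrix (Fin (n + 1)) (Fin (n + 1)) ℂ) : Continuous (denom A) := by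
  unfold denom; fun_prop

lemma measurable_act (A : Matrix (Fin (n + 1)) (Fin (n + 1)) ℂ) : Measurable (act A) := by
  refine measurable_pi_iff.mpr fun j => ?_
  refine Measurable.div (Continuous.measurable ?_) (continuous_denom A).measurable
  fun_prop

lemma continuous_defect : Continuous (defect : (Fin n → ℂ) → ℝ) := by
  unfold defect; fun_prop

lemma measurableSet_ball : MeasurableSet (ball n) := by
  have : ball n = defect ⁻¹' Set.Ioi 0 := by ext z; exact mem_ball_iff
  rw [this]
  exact continuous_defect.measurable measurableSet_Ioi

/-- The complex Jacobian matrix of the fractional-linear action. -/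
noncomputable def actDeriv (A : Matrix (Fin (n + 1)) (Fin (n + 1)) ℂ) (z : Fin n → ℂ) :
    Matrix (Fin n) (Fin n) ℂ :=
  (denom A z)⁻¹ • Matrix.of fun j l =>
    A j.castSucc l.castSucc - act A z j * A (Fin.last n) l.castSucc

lemma hasFDerivAt_act (A : Matrix (Fin (n + 1)) (Fin (n + 1)) ℂ) (z : Fin n → ℂ)
    (hd : denom A z ≠ 0) :
    HasFDerivAt (act A) (LinearMap.toContinuousLinearMap (Matrix.toLin' (actDeriv A z))) z := by
  rw [hasFDerivAt_pi']
  intro j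
  have hlin : ∀ i : Fin (n + 1), HasFDerivAt
      (fun z : Fin n → ℂ => ∑ l : Fin n, A i l.castSucc * z l + A i (Fin.last n))
      (∑ l : Fin n, A i l.castSucc • ContinuousLinearMap.proj (R := ℂ) (φ := fun _ : Fin n => ℂ) l)
      z := by
    intro i
    refine HasFDerivAt.add_const _ (HasFDerivAt.fun_sum fun l _ => ?_)
    exact (ContinuousLinearMap.proj (R := ℂ) (φ := fun _ : Fin n => ℂ) l).hasFDerivAt.const_mul _
  have h := (hlin j.castSucc).fun_mul
    ((hasDerivAt_inv (x := denom A z) hd).comp_hasFDerivAt z (hlin (Fin.last n)))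
  refine h.congr_fderiv ?_
  ext x
  have hd' : ∑ l : Fin n, A (Fin.last n) l.castSucc * z l + A (Fin.last n) (Fin.last n) ≠ 0 := hd
  simp only [actDeriv, act, denom, _root_.smul_apply, _root_.sum_apply,
    ContinuousLinearMap.proj_apply, smul_eq_mul, ContinuousLinearMap.comp_apply,
    LinearMap.coe_toContinuousLinearMap', Matrix.toLin'_apply, _root_.add_apply,
    Function.comp_apply, smul_mulVec, Pi.smul_apply, mulVec, dotProduct, Matrix.of_apply]
  simp only [sub_mul, Finset.sum_sub_distrib, mul_assoc, ← Finset.mul_sum]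
  field_simp
  ring

lemma det_actDeriv (A : Matrix (Fin (n + 1)) (Fin (n + 1)) ℂ) (z : Fin n → ℂ)
    (hd : denom A z ≠ 0) : (actDeriv A z).det = A.det / denom A z ^ (n + 1) := by
  set y := act A z with hy
  let P : Matrix (Fin (n + 1)) (Fin (n + 1)) ℂ := Matrix.of fun i j =>
    if i = j then 1 else if j = Fin.last n then -snoc1 y i else 0
  let Q : Matrix (Fin (n + 1)) (Fin (n + 1)) ℂ := Matrix.of fun i j =>
    if i = j then 1 else if j = Fin.last n then snoc1 z i else 0
  have hP : P.det = 1 := by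
    rw [det_of_isUpperTriangular]
    · simp [P]
    · intro i j hij
      have h1 : i ≠ j := ne_of_gt hij
      have h2 : j ≠ Fin.last n := ne_of_lt (lt_of_lt_of_le hij (Fin.le_last i))
      simp [P, h1, h2]
  have hQ : Q.det = 1 := by
    rw [det_of_isUpperTriangular]
    · simp [Q]
    · intro i j hij
      have h1 : i ≠ j := ne_of_gt hij
      have h2 : j ≠ Fin.last n := ne_of_lt (lt_of_lt_of_le hij (Fin.le_last i))
      simp [Q, h1, h2]
  have hPA : ∀ (i : Fin n) j, (P * A) i.castSucc j = A i.castSucc j - y i * A (Fin.last n) j := by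
    intro i j
    rw [Matrix.mul_apply, Fin.sum_univ_castSucc]
    simp [P, Fin.castSucc_ne_last, sub_eq_add_neg]
  have hPAl : ∀ j, (P * A) (Fin.last n) j = A (Fin.last n) j := by
    intro j
    rw [Matrix.mul_apply, Fin.sum_univ_castSucc]
    simp [P, Fin.castSucc_ne_last, Ne.symm (Fin.castSucc_ne_last _)]
  have hMQ : ∀ (M : Matrix (Fin (n + 1)) (Fin (n + 1)) ℂ) i (l : Fin n),
      (M * Q) i l.castSucc = M i l.castSucc := by
    intro M i l
    rw [Matrix.mul_apply, Fin.sum_univ_castSucc]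
    simp [Q, Fin.castSucc_ne_last, Ne.symm (Fin.castSucc_ne_last _)]
  have hMQl : ∀ (M : Matrix (Fin (n + 1)) (Fin (n + 1)) ℂ) i,
      (M * Q) i (Fin.last n) = (M *ᵥ snoc1 z) i := by
    intro M i
    rw [Matrix.mul_apply, Fin.sum_univ_castSucc]
    simp [Q, Fin.castSucc_ne_last, mulVec, dotProduct, Fin.sum_univ_castSucc]
  have hlast : ∀ i : Fin n, (P * A * Q) i.castSucc (Fin.last n) = 0 := by
    intro i
    have h1 : (A *ᵥ snoc1 z) i.castSucc = denom A z * y i := by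
      rw [mulVec_snoc1 A z hd]; simp [hy]
    have h2 : ((P * A) *ᵥ snoc1 z) i.castSucc =
        (A *ᵥ snoc1 z) i.castSucc - y i * (A *ᵥ snoc1 z) (Fin.last n) := by
      simp only [mulVec, dotProduct, hPA, sub_mul, Finset.sum_sub_distrib, mul_assoc,
        Finset.mul_sum]
    rw [hMQl, h2, h1, mulVec_snoc1_last]; ring
  have hll : (P * A * Q) (Fin.last n) (Fin.last n) = denom A z := by
    rw [hMQl, ← mulVec_snoc1_last]
    simp only [mulVec, dotProduct, hPAl]
  have hdet : A.det = (P * A * Q).det := by rw [det_mul, det_mul, hP, hQ]; ring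
  have hsub : (P * A * Q).submatrix (Fin.last n).succAbove (Fin.last n).succAbove =
      denom A z • actDeriv A z := by
    ext i j
    simp only [submatrix_apply, Fin.succAbove_last, hMQ, hPA, actDeriv, smul_smul,
      mul_inv_cancel₀ hd, one_smul, Matrix.of_apply, ← hy]
  rw [det_succ_column (P * A * Q) (Fin.last n), Fin.sum_univ_castSucc] at hdet
  simp only [hlast, hll, hsub, mul_zero, zero_mul, Finset.sum_const_zero, zero_add, Fin.val_last,
    ← two_mul, pow_mul, neg_one_sq, one_pow, one_mul, det_smul, Fintype.card_fin] at hdet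
  rw [hdet]
  field_simp
  ring

/-- The invariant measure on the ball. -/
noncomputable def hypMeasure (n : ℕ) : Measure (Fin n → ℂ) :=
  (volume.restrict (ball n)).withDensity fun z => ENNReal.ofReal ((defect z)⁻¹ ^ (n + 1))

instance : SFinite (hypMeasure n) := by
  unfold hypMeasure; infer_instance

lemma measurable_density :
    Measurable fun z : Fin n → ℂ => ENNReal.ofReal ((defect z)⁻¹ ^ (n + 1)) :=
  ((continuous_defect.measurable.inv).pow_const _).ennreal_ofReal

lemma abs_det_restrictScalars (M : Matrix (Fin n) (Fin n) ℂ) :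
    |((LinearMap.toContinuousLinearMap (Matrix.toLin' M)).restrictScalars ℝ).det| =
      ‖M.det‖ ^ 2 := by
  have : ((LinearMap.toContinuousLinearMap (Matrix.toLin' M)).restrictScalars ℝ).det =
      LinearMap.det ((Matrix.toLin' M).restrictScalars ℝ) := rfl
  rw [this, LinearMap.det_restrictScalars, LinearMap.det_toLin', Algebra.norm_complex_apply,
    Complex.normSq_eq_norm_sq, abs_of_nonneg (by positivity)]

lemma IsU.injOn {A : Matrix (Fin (n + 1)) (Fin (n + 1)) ℂ} (hA : IsU A) :
    Set.InjOn (act A) (ball n) := by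
  intro z hz w hw h
  rw [← hA.act_inv_act hz, h, hA.act_inv_act hw]

lemma IsU.measurePreserving {A : Matrix (Fin (n + 1)) (Fin (n + 1)) ℂ} (hA : IsU A) :
    MeasurePreserving (act A) (hypMeasure n) (hypMeasure n) := by
  refine ⟨measurable_act A, ?_⟩
  ext S hS
  rw [Measure.map_apply (measurable_act A) hS, hypMeasure,
    withDensity_apply _ (measurable_act A hS), withDensity_apply _ hS,
    Measure.restrict_restrict (measurable_act A hS), Measure.restrict_restrict hS]
  have him : S ∩ ball n = act A '' (act A ⁻¹' S ∩ ball n) := by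
    ext z
    constructor
    · rintro ⟨hzS, hz⟩
      refine ⟨act A⁻¹ z, ⟨?_, hA.inv.act_mem hz⟩, hA.act_act_inv hz⟩
      rw [Set.mem_preimage, hA.act_act_inv hz]; exact hzS
    · rintro ⟨w, ⟨hwS, hw⟩, rfl⟩
      exact ⟨hwS, hA.act_mem hw⟩
  rw [him, lintegral_image_eq_lintegral_abs_det_fderiv_mul volume
    ((measurable_act A hS).inter measurableSet_ball)
    (f' := fun z => (LinearMap.toContinuousLinearMap
      (Matrix.toLin' (actDeriv A z))).restrictScalars ℝ)
    (fun z hz => ((hasFDerivAt_act A z (hA.denom_ne_zero hz.2)).restrictScalars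
      ℝ).hasFDerivWithinAt) (hA.injOn.mono Set.inter_subset_right)]
  refine setLIntegral_congr_fun ((measurable_act A hS).inter measurableSet_ball) fun z hz => ?_
  have hd := hA.denom_ne_zero hz.2
  rw [abs_det_restrictScalars, det_actDeriv A z hd, ← ENNReal.ofReal_mul (by positivity),
    hA.defect_eq hz.2, norm_div, hA.norm_det, norm_pow]
  congr 1
  rw [mul_inv, mul_pow, one_div]
  ring

lemma ae_mem_ball : ∀ᵐ z ∂hypMeasure n, z ∈ ball n :=
  (withDensity_absolutelyContinuous _ _) (ae_restrict_mem measurableSet_ball)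

lemma hypMeasure_absolutelyContinuous : hypMeasure n ≪ volume :=
  (withDensity_absolutelyContinuous _ _).trans Measure.restrict_le_self.absolutelyContinuous

end Invariant

section Reproducing

variable {n : ℕ}

/-- The power `(-⟨⟨v, u⟩⟩)^{-N}` of the form. -/
noncomputable def ker (N : ℕ) (v u : Fin (n + 1) → ℂ) : ℂ := (-herm v u)⁻¹ ^ N

lemma ker_smul_left (N : ℕ) (c : ℂ) (v u : Fin (n + 1) → ℂ) :
    ker N (c • v) u = c⁻¹ ^ N * ker N v u := by
  rw [ker, ker, herm_smul_left, ← mul_neg, mul_inv, mul_pow]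

lemma ker_smul_right (N : ℕ) (c : ℂ) (v u : Fin (n + 1) → ℂ) :
    ker N v (c • u) = (star c)⁻¹ ^ N * ker N v u := by
  rw [ker, ker, herm_smul_right, ← mul_neg, mul_inv, mul_pow]

lemma star_ker (N : ℕ) (v u : Fin (n + 1) → ℂ) : star (ker N v u) = ker N u v := by
  rw [ker, ker, star_pow, star_inv₀, star_neg, herm_conj]

lemma continuous_snoc1 : Continuous (snoc1 : (Fin n → ℂ) → Fin (n + 1) → ℂ) := by
  refine continuous_pi fun i => ?_
  refine Fin.lastCases ?_ (fun j => ?_) i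
  · simp only [snoc1_last]; exact continuous_const
  · simp only [snoc1_castSucc]; exact continuous_apply j

lemma continuous_herm : Continuous fun p : (Fin (n + 1) → ℂ) × (Fin (n + 1) → ℂ) =>
    herm p.1 p.2 := by
  unfold herm; fun_prop

/-- The contraction factor of a negative vector. -/
noncomputable def slope (u : Fin (n + 1) → ℂ) : ℝ :=
  Real.sqrt (∑ i : Fin n, ‖u i.castSucc‖ ^ 2) / ‖u (Fin.last n)‖

lemma slope_nonneg (u : Fin (n + 1) → ℂ) : 0 ≤ slope u := by unfold slope; positivity

lemma slope_lt_one {u : Fin (n + 1) → ℂ} (hu : hq u < 0) : slope u < 1 := by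
  have hl : 0 < ‖u (Fin.last n)‖ := norm_pos_iff.mpr (last_ne_zero_of_hq_neg hu)
  rw [slope, div_lt_one hl, Real.sqrt_lt' hl]
  unfold hq at hu
  linarith

lemma norm_herm_ge_slope {u x : Fin (n + 1) → ℂ} (hu : hq u < 0) (hx : hq x ≤ 0) :
    (1 - slope u) * ‖u (Fin.last n)‖ * ‖x (Fin.last n)‖ ≤ ‖herm x u‖ := by
  have hl : 0 < ‖u (Fin.last n)‖ := norm_pos_iff.mpr (last_ne_zero_of_hq_neg hu)
  refine norm_herm_ge (slope_nonneg u) ?_ hx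
  rw [slope, div_mul_cancel₀ _ hl.ne', Real.sq_sqrt (by positivity)]

lemma herm_ne_zero {u x : Fin (n + 1) → ℂ} (hu : hq u < 0) (hx : hq x < 0) : herm x u ≠ 0 := by
  have hl : 0 < ‖u (Fin.last n)‖ := norm_pos_iff.mpr (last_ne_zero_of_hq_neg hu)
  have hl' : 0 < ‖x (Fin.last n)‖ := norm_pos_iff.mpr (last_ne_zero_of_hq_neg hx)
  rw [← norm_pos_iff]
  have : 0 < 1 - slope u := by linarith [slope_lt_one hu]
  exact lt_of_lt_of_le (by positivity) (norm_herm_ge_slope hu hx.le)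

lemma norm_ker (N : ℕ) (v u : Fin (n + 1) → ℂ) : ‖ker N v u‖ = (‖herm v u‖⁻¹) ^ N := by
  rw [ker, norm_pow, norm_inv, norm_neg]

lemma norm_ker_le (N : ℕ) {u x : Fin (n + 1) → ℂ} (hu : hq u < 0) (hx : hq x < 0) :
    ‖ker N x u‖ ≤ (((1 - slope u) * ‖u (Fin.last n)‖ * ‖x (Fin.last n)‖)⁻¹) ^ N := by
  have hl : 0 < ‖u (Fin.last n)‖ := norm_pos_iff.mpr (last_ne_zero_of_hq_neg hu)
  have hl' : 0 < ‖x (Fin.last n)‖ := norm_pos_iff.mpr (last_ne_zero_of_hq_neg hx)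
  have : 0 < 1 - slope u := by linarith [slope_lt_one hu]
  rw [norm_ker]
  gcongr
  exact norm_herm_ge_slope hu hx.le

lemma hq_snoc1_neg {z : Fin n → ℂ} (hz : z ∈ ball n) : hq (snoc1 z) < 0 := by
  rw [hq_snoc1']; linarith [mem_ball_iff.mp hz]

lemma defect_le_one (z : Fin n → ℂ) : defect z ≤ 1 := by
  have : 0 ≤ ∑ i, ‖z i‖ ^ 2 := by positivity
  unfold defect; linarith

lemma volume_ball_lt_top : volume (ball n) < ⊤ := by
  refine lt_of_le_of_lt (measure_mono ?_)
    (measure_closedBall_lt_top (x := (0 : Fin n → ℂ)) (r := 1))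
  intro z hz
  rw [mem_closedBall_zero_iff, pi_norm_le_iff_of_nonneg zero_le_one]
  intro i
  have h1 : ‖z i‖ ^ 2 ≤ ∑ i, ‖z i‖ ^ 2 :=
    Finset.single_le_sum (f := fun i => ‖z i‖ ^ 2) (fun i _ => by positivity) (Finset.mem_univ i)
  have h2 : ∑ i, ‖z i‖ ^ 2 < 1 := hz
  have h3 := norm_nonneg (z i)
  nlinarith

/-- Integration against the invariant measure, in terms of Lebesgue measure. -/
lemma integral_hypMeasure {E : Type*} [NormedAddCommGroup E] [NormedSpace ℝ E]
    (f : (Fin n → ℂ) → E) :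
    ∫ z, f z ∂hypMeasure n = ∫ z in ball n, ((defect z)⁻¹ ^ (n + 1)) • f z := by
  rw [hypMeasure, integral_withDensity_eq_integral_toReal_smul measurable_density
    (Eventually.of_forall fun _ => ENNReal.ofReal_lt_top)]
  refine setIntegral_congr_fun measurableSet_ball fun z hz => ?_
  have := mem_ball_iff.mp hz
  rw [ENNReal.toReal_ofReal (by positivity)]

lemma integrable_hypMeasure_iff {E : Type*} [NormedAddCommGroup E] [NormedSpace ℝ E]
    {f : (Fin n → ℂ) → E} :
    Integrable f (hypMeasure n) ↔
      IntegrableOn (fun z => ((defect z)⁻¹ ^ (n + 1)) • f z) (ball n) := by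
  rw [hypMeasure, integrable_withDensity_iff_integrable_smul' measurable_density
    (Eventually.of_forall fun _ => ENNReal.ofReal_lt_top)]
  refine integrableOn_congr_fun (fun z hz => ?_) measurableSet_ball
  have := mem_ball_iff.mp hz
  rw [ENNReal.toReal_ofReal (by positivity)]

lemma integrable_defect_pow {N : ℕ} (hN : n + 1 ≤ N) :
    Integrable (fun z => defect z ^ N) (hypMeasure n) := by
  rw [integrable_hypMeasure_iff]
  refine Measure.integrableOn_of_bounded (M := 1) volume_ball_lt_top.ne
    (((continuous_defect.measurable.inv.pow_const _).mul
      (continuous_defect.measurable.pow_const _)).aestronglyMeasurable) ?_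
  filter_upwards [ae_restrict_mem measurableSet_ball] with z hz
  have h0 := mem_ball_iff.mp hz
  obtain ⟨j, rfl⟩ := Nat.exists_eq_add_of_le hN
  have : (defect z)⁻¹ ^ (n + 1) • defect z ^ (n + 1 + j) = defect z ^ j := by
    rw [smul_eq_mul, pow_add (defect z) (n + 1) j, inv_pow,
      inv_mul_cancel_left₀ (by positivity)]
  rw [this, Real.norm_of_nonneg (by positivity)]
  exact pow_le_one₀ h0.le (defect_le_one z)

/-- The matrix rotating the first `n` coordinates by a unit scalar. -/
noncomputable def rotM (n : ℕ) (c : ℂ) : Matrix (Fin (n + 1)) (Fin (n + 1)) ℂ :=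
  Matrix.diagonal fun i => if i = Fin.last n then 1 else c

lemma isU_rotM {c : ℂ} (hc : ‖c‖ = 1) : IsU (rotM n c) := by
  intro u v
  have h : c * star c = 1 := by
    rw [Complex.star_def, Complex.mul_conj, Complex.normSq_eq_norm_sq, hc]; simp
  simp only [herm, rotM, Matrix.mulVec_diagonal, if_true, Fin.castSucc_ne_last, if_false, one_mul,
    star_mul']
  congr 1
  refine Finset.sum_congr rfl fun i _ => ?_
  linear_combination (u i.castSucc * star (v i.castSucc)) * h

lemma act_rotM {c : ℂ} (z : Fin n → ℂ) : act (rotM n c) z = c • z := by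
  refine act_eq_of_mulVec one_ne_zero ?_
  rw [one_smul]
  funext i
  refine Fin.lastCases ?_ (fun j => ?_) i
  · simp [rotM, Matrix.mulVec_diagonal]
  · simp [rotM, Matrix.mulVec_diagonal, Fin.castSucc_ne_last]

lemma defect_smul {c : ℂ} (hc : ‖c‖ = 1) (z : Fin n → ℂ) : defect (c • z) = defect z := by
  simp [defect, hc]

lemma integral_rot {c : ℂ} (hc : ‖c‖ = 1) {f : (Fin n → ℂ) → ℂ} (hf : Measurable f) :
    ∫ z, f (c • z) ∂hypMeasure n = ∫ z, f z ∂hypMeasure n := by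
  have h := (isU_rotM (n := n) hc).measurePreserving
  conv_rhs => rw [← h.map_eq]
  rw [integral_map (measurable_act _).aemeasurable hf.aestronglyMeasurable]
  simp only [act_rotM]

lemma integral_comp_act {A : Matrix (Fin (n + 1)) (Fin (n + 1)) ℂ} (hA : IsU A)
    {f : (Fin n → ℂ) → ℂ} (hf : Measurable f) :
    ∫ z, f (act A z) ∂hypMeasure n = ∫ z, f z ∂hypMeasure n := by
  have h := hA.measurePreserving
  conv_rhs => rw [← h.map_eq]
  rw [integral_map (measurable_act _).aemeasurable hf.aestronglyMeasurable]

/-- The total mass of a power of the defect. -/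
noncomputable def mass (n N : ℕ) : ℝ := ∫ z, defect z ^ N ∂hypMeasure n

lemma measurable_ker_snoc1 (N : ℕ) (u : Fin (n + 1) → ℂ) :
    Measurable fun z : Fin n → ℂ => ker N (snoc1 z) u := by
  have h : Continuous fun z : Fin n → ℂ => herm (snoc1 z) u :=
    continuous_herm.comp (continuous_snoc1.prodMk continuous_const)
  exact (h.neg.measurable.inv).pow_const N

lemma norm_ker_snoc1_le (N : ℕ) {u : Fin (n + 1) → ℂ} (hu : hq u < 0) {z : Fin n → ℂ}
    (hz : z ∈ ball n) :
    ‖ker N (snoc1 z) u‖ ≤ (((1 - slope u) * ‖u (Fin.last n)‖)⁻¹) ^ N := by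
  simpa using norm_ker_le N hu (hq_snoc1_neg hz)

lemma circleAverage_ker (N : ℕ) {u : Fin (n + 1) → ℂ} (hu : hq u < 0) {z : Fin n → ℂ}
    (hz : z ∈ ball n) :
    Real.circleAverage (fun c => ker N (snoc1 (c • z)) u) 0 1 = ker N (e0 n) u := by
  have hmem : ∀ c : ℂ, ‖c‖ ≤ 1 → c • z ∈ ball n := by
    intro c hc
    have hz' : ∑ i, ‖z i‖ ^ 2 < 1 := hz
    refine lt_of_le_of_lt (b := ∑ i, ‖z i‖ ^ 2) ?_ hz'
    refine Finset.sum_le_sum fun i _ => ?_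
    rw [Pi.smul_apply, norm_smul]
    have := norm_nonneg (z i)
    have := norm_nonneg c
    gcongr
    nlinarith
  have hherm : ∀ c : ℂ, herm (snoc1 (c • z)) u =
      c * (∑ i : Fin n, z i * star (u i.castSucc)) - star (u (Fin.last n)) := by
    intro c
    simp [herm, Finset.mul_sum, mul_assoc]
  have hdiff : ∀ c ∈ Metric.closedBall (0 : ℂ) |1|,
      DifferentiableAt ℂ (fun c => ker N (snoc1 (c • z)) u) c := by
    intro c hc
    rw [abs_one, mem_closedBall_zero_iff] at hc
    have hne := herm_ne_zero hu (hq_snoc1_neg (hmem c hc))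
    simp only [ker, hherm] at hne ⊢
    have h1 : DifferentiableAt ℂ (fun c : ℂ =>
        -(c * (∑ i : Fin n, z i * star (u i.castSucc)) - star (u (Fin.last n)))) c := by fun_prop
    exact (h1.inv (neg_ne_zero.mpr hne)).pow N
  rw [circleAverage_of_differentiable_on_off_countable Set.countable_empty
    (fun c hc => (hdiff c hc).continuousAt.continuousWithinAt)
    (fun c hc => hdiff c (Metric.ball_subset_closedBall hc.1)), zero_smul, snoc1_zero]

/-- The mean value property against the weighted invariant measure. -/
lemma integral_ker_mul_defect {N : ℕ} (hN : n + 1 ≤ N) {u : Fin (n + 1) → ℂ} (hu : hq u < 0) :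
    ∫ z, ker N (snoc1 z) u * (defect z ^ N : ℝ) ∂hypMeasure n = mass n N * ker N (e0 n) u := by
  set f : (Fin n → ℂ) → ℂ := fun z => ker N (snoc1 z) u with hf
  have hfm : Measurable f := measurable_ker_snoc1 N u
  set I := ∫ z, f z * (defect z ^ N : ℝ) ∂hypMeasure n with hI
  have hρm : Measurable fun z : Fin n → ℂ => ((defect z ^ N : ℝ) : ℂ) :=
    Complex.measurable_ofReal.comp (continuous_defect.measurable.pow_const N)
  have hrot : ∀ θ : ℝ, ∫ z, f (circleMap 0 1 θ • z) * (defect z ^ N : ℝ) ∂hypMeasure n = I := by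
    intro θ
    have hc : ‖circleMap 0 1 θ‖ = 1 := by simp
    have h := integral_rot hc (hfm.mul hρm)
    simp only [Pi.mul_apply, defect_smul hc] at h
    exact h
  have hmeas : Measurable fun p : ℝ × (Fin n → ℂ) => f (circleMap 0 1 p.1 • p.2) := by
    refine hfm.comp (Continuous.measurable ?_)
    have : Continuous (circleMap 0 1) := continuous_circleMap 0 1
    fun_prop
  have hswap : ∫ θ in Set.Ioc (0 : ℝ) (2 * Real.pi),
      ∫ z, f (circleMap 0 1 θ • z) * (defect z ^ N : ℝ)
      ∂hypMeasure n = ∫ z, (∫ θ in Set.Ioc (0 : ℝ) (2 * Real.pi),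
        f (circleMap 0 1 θ • z) * (defect z ^ N : ℝ)) ∂hypMeasure n := by
    refine integral_integral_swap ?_
    refine Integrable.bdd_mul (c := (((1 - slope u) * ‖u (Fin.last n)‖)⁻¹) ^ N)
      (g := fun p : ℝ × (Fin n → ℂ) => ((defect p.2 ^ N : ℝ) : ℂ)) ?_
      hmeas.aestronglyMeasurable ?_
    · have h1 : Integrable (fun _ : ℝ => (1 : ℂ)) (volume.restrict (Set.Ioc 0 (2 * Real.pi))) :=
        integrable_const _
      simpa using h1.mul_prod (Integrable.ofReal (𝕜 := ℂ) (integrable_defect_pow (n := n) hN))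
    · have h2 : ∀ᵐ p : ℝ × (Fin n → ℂ) ∂((volume.restrict (Set.Ioc 0 (2 * Real.pi))).prod
          (hypMeasure n)), p.2 ∈ ball n :=
        Measure.quasiMeasurePreserving_snd.ae ae_mem_ball
      filter_upwards [h2] with p hp
      refine norm_ker_snoc1_le N hu ?_
      rw [mem_ball_iff, defect_smul (by simp)]
      exact mem_ball_iff.mp hp
  simp only [hrot] at hswap
  have hinner : ∀ z ∈ ball n, ∫ θ in Set.Ioc (0 : ℝ) (2 * Real.pi),
      f (circleMap 0 1 θ • z) * (defect z ^ N : ℝ) =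
        2 * Real.pi * ker N (e0 n) u * (defect z ^ N : ℝ) := by
    intro z hz
    have h := circleAverage_ker N hu hz
    rw [Real.circleAverage, intervalIntegral.integral_of_le Real.two_pi_pos.le] at h
    rw [integral_mul_const, ← h]
    have : (Real.pi : ℂ) ≠ 0 := by exact_mod_cast Real.pi_ne_zero
    simp only [Complex.real_smul, hf]
    push_cast
    field_simp
  rw [integral_congr_ae (ae_mem_ball.mono hinner), integral_const_mul, setIntegral_const,
    integral_complex_ofReal] at hswap
  have hpi : (2 * Real.pi : ℂ) ≠ 0 := by exact_mod_cast Real.two_pi_pos.ne'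
  apply mul_left_cancel₀ hpi
  have h5 : (volume.real (Set.Ioc 0 (2 * Real.pi))) = 2 * Real.pi := by
    simp [Real.two_pi_pos.le]
  rw [h5, Complex.real_smul] at hswap
  push_cast at hswap
  rw [hswap, mass]; ring

lemma ker_act {B : Matrix (Fin (n + 1)) (Fin (n + 1)) ℂ} (hB : IsU B) (N : ℕ) {z : Fin n → ℂ}
    (hz : z ∈ ball n) (u : Fin (n + 1) → ℂ) :
    ker N (snoc1 (act B z)) (B *ᵥ u) = denom B z ^ N * ker N (snoc1 z) u := by
  have h : snoc1 (act B z) = (denom B z)⁻¹ • (B *ᵥ snoc1 z) := by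
    rw [hB.mulVec_snoc1 hz, smul_smul, inv_mul_cancel₀ (hB.denom_ne_zero hz), one_smul]
  rw [h, ker_smul_left, inv_inv, ker, ker, hB]

/-- The reproducing property of the weighted Bergman kernels. -/
theorem reproducing {N : ℕ} (hN : n + 1 ≤ N) {u v : Fin (n + 1) → ℂ} (hu : hq u < 0)
    (hv : hq v < 0) :
    ∫ z, ker N (snoc1 z) u * star (ker N (snoc1 z) v) * (defect z ^ N : ℝ) ∂hypMeasure n =
      mass n N * ker N v u := by
  obtain ⟨B, hB, c, hc, rfl⟩ := exists_isU_e0 hv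
  obtain ⟨u, rfl⟩ : ∃ w, B *ᵥ w = u := ⟨B⁻¹ *ᵥ u, by
    rw [mulVec_mulVec, hB.mul_inv_cancel, one_mulVec]⟩
  rw [hB.hq] at hu
  have hm : Measurable fun z : Fin n → ℂ => ker N (snoc1 z) (B *ᵥ u) *
      star (ker N (snoc1 z) (B *ᵥ (c • e0 n))) * (defect z ^ N : ℝ) := by
    refine ((measurable_ker_snoc1 N _).mul
      (continuous_star.measurable.comp (measurable_ker_snoc1 N _))).mul ?_
    exact Complex.measurable_ofReal.comp (continuous_defect.measurable.pow_const N)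
  rw [← integral_comp_act hB hm]
  have hk : ker N (B *ᵥ (c • e0 n)) (B *ᵥ u) = ker N (c • e0 n) u := by
    rw [ker, ker, hB]
  rw [hk, ker_smul_left, ← mul_assoc, mul_comm _ (c⁻¹ ^ N), mul_assoc,
    ← integral_ker_mul_defect hN hu, ← integral_const_mul]
  refine integral_congr_ae (ae_mem_ball.mono fun z hz => ?_)
  have hd := hB.denom_ne_zero hz
  simp only [ker_act hB N hz, star_mul', star_ker, ker_smul_left]
  have h1 : ker N (e0 n) (snoc1 z) = 1 := by
    rw [← star_ker, ker, herm_e0]; simp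
  have h2 : (defect z : ℂ) = denom B z * star (denom B z) * defect (act B z) := by
    rw [hB.defect_eq hz, Complex.star_def, Complex.mul_conj, Complex.normSq_eq_norm_sq]
    push_cast; ring
  rw [h1]
  push_cast
  rw [h2, star_pow]
  ring

end Reproducing

section Mass

variable {n : ℕ}

lemma volume_superlevel (hn : 0 < n) {t : ℝ} (ht : 0 ≤ t) (ht1 : t ≤ 1) :
    (volume.restrict (ball n)) {z | t < defect z} =
      ENNReal.ofReal ((1 - t) ^ n * (Real.pi ^ n / n.factorial)) := by
  have : Nonempty (Fin n) := ⟨⟨0, hn⟩⟩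
  have hm : MeasurableSet {z : Fin n → ℂ | t < defect z} :=
    continuous_defect.measurable measurableSet_Ioi
  have h1t : 0 ≤ 1 - t := by linarith
  rw [Measure.restrict_apply hm]
  have hset : {z : Fin n → ℂ | t < defect z} ∩ ball n =
      {z | (∑ i, ‖z i‖ ^ (2 : ℝ)) ^ (1 / (2 : ℝ)) < Real.sqrt (1 - t)} := by
    ext z
    simp only [Set.mem_inter_iff, mem_ball_iff, Set.mem_ofPred_eq, Real.rpow_ofNat,
      ← Real.sqrt_eq_rpow]
    rw [Real.sqrt_lt_sqrt_iff (by positivity), defect]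
    constructor
    · rintro ⟨h, -⟩; linarith
    · intro h; exact ⟨by linarith, by linarith⟩
  have hv := Complex.volume_sum_rpow_lt (ι := Fin n) (p := 2) one_le_two (Real.sqrt (1 - t))
  rw [hset, hv, ← ENNReal.ofReal_pow (Real.sqrt_nonneg _),
    ← ENNReal.ofReal_mul (by positivity), Fintype.card_fin, pow_mul, Real.sq_sqrt h1t]
  congr 2
  have h2 : (2 : ℝ) / 2 + 1 = 2 := by norm_num
  have h3 : 2 * (n : ℝ) / 2 + 1 = n + 1 := by ring
  rw [h2, h3, Real.Gamma_nat_eq_factorial, Real.Gamma_two, mul_one]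

lemma integral_one_sub_pow_mul_pow (n m : ℕ) :
    ∫ t in (0 : ℝ)..1, (1 - t) ^ n * t ^ m = n.factorial * m.factorial / (n + m + 1).factorial := by
  have h := Complex.betaIntegral_eq_Gamma_mul_div (m + 1) (n + 1)
    (by simp; positivity) (by simp; positivity)
  have h1 : (m + 1 + (n + 1) : ℂ) = ((n + m + 1 : ℕ) : ℂ) + 1 := by push_cast; ring
  rw [h1, Complex.Gamma_nat_eq_factorial, Complex.Gamma_nat_eq_factorial,
    Complex.Gamma_nat_eq_factorial, Complex.betaIntegral] at h
  have h2 : ∀ t : ℝ, (t : ℂ) ^ ((m : ℂ) + 1 - 1) * (1 - (t : ℂ)) ^ ((n : ℂ) + 1 - 1) =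
      (((1 - t) ^ n * t ^ m : ℝ) : ℂ) := by
    intro t
    rw [add_sub_cancel_right, add_sub_cancel_right, Complex.cpow_natCast, Complex.cpow_natCast]
    push_cast; ring
  simp only [h2] at h
  rw [intervalIntegral.integral_ofReal] at h
  have h4 : (((∫ t in (0 : ℝ)..1, (1 - t) ^ n * t ^ m) : ℝ) : ℂ) =
      ((n.factorial * m.factorial / (n + m + 1).factorial : ℝ) : ℂ) := by
    rw [h]; push_cast; ring
  exact_mod_cast h4

lemma mass_eq (hn : 0 < n) (m : ℕ) :
    mass n (n + 2 + m) = Real.pi ^ n * (m + 1).factorial / (n + m + 1).factorial := by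
  have h1 : mass n (n + 2 + m) = ∫ z in ball n, defect z ^ ((m : ℝ) + 1) := by
    rw [mass, integral_hypMeasure]
    refine setIntegral_congr_fun measurableSet_ball fun z hz => ?_
    have := mem_ball_iff.mp hz
    have h2 : ((m : ℝ) + 1) = ((m + 1 : ℕ) : ℝ) := by push_cast; ring
    have h3 : n + 2 + m = (n + 1) + (m + 1) := by ring
    rw [h2, Real.rpow_natCast, smul_eq_mul, h3, pow_add (defect z) (n + 1), inv_pow,
      inv_mul_cancel_left₀ (by positivity)]
  have hnn : 0 ≤ᵐ[volume.restrict (ball n)] (defect : (Fin n → ℂ) → ℝ) := by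
    filter_upwards [ae_restrict_mem measurableSet_ball] with z hz
    exact (mem_ball_iff.mp hz).le
  have hp : (0 : ℝ) < (m : ℝ) + 1 := by positivity
  have h2 := lintegral_rpow_eq_lintegral_meas_lt_mul (volume.restrict (ball n)) hnn
    continuous_defect.measurable.aemeasurable hp
  rw [h1, integral_eq_lintegral_of_nonneg_ae
    (hnn.mono fun z hz => Real.rpow_nonneg hz _)
    (continuous_defect.measurable.pow_const _).aestronglyMeasurable, h2]
  have h3 : ∫⁻ t in Set.Ioi (0 : ℝ), (volume.restrict (ball n)) {z | t < defect z} *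
      ENNReal.ofReal (t ^ ((m : ℝ) + 1 - 1)) = ∫⁻ t in Set.Ioc (0 : ℝ) 1,
        ENNReal.ofReal ((Real.pi ^ n / n.factorial) * ((1 - t) ^ n * t ^ m)) := by
    rw [← Set.Ioc_union_Ioi_eq_Ioi (zero_le_one' ℝ), lintegral_union measurableSet_Ioi
      (Set.Ioc_disjoint_Ioi le_rfl)]
    have h4 : ∫⁻ t in Set.Ioi (1 : ℝ), (volume.restrict (ball n)) {z | t < defect z} *
        ENNReal.ofReal (t ^ ((m : ℝ) + 1 - 1)) = 0 := by
      refine (setLIntegral_congr_fun measurableSet_Ioi fun t ht => ?_).trans lintegral_zero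
      have : {z : Fin n → ℂ | t < defect z} = ∅ := by
        ext z
        simp only [Set.mem_ofPred_eq, Set.mem_empty_iff_false, iff_false, not_lt]
        exact (defect_le_one z).trans (le_of_lt ht)
      rw [this, measure_empty, zero_mul]
    rw [h4, add_zero]
    refine setLIntegral_congr_fun measurableSet_Ioc fun t ht => ?_
    have h5 : 0 ≤ 1 - t := by linarith [ht.2]
    rw [volume_superlevel hn ht.1.le ht.2, add_sub_cancel_right, Real.rpow_natCast,
      ← ENNReal.ofReal_mul (by positivity)]
    congr 1; ring
  rw [h3, ← ofReal_integral_eq_lintegral_ofReal, ← ENNReal.ofReal_mul hp.le, ENNReal.toReal_ofReal]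
  · rw [← intervalIntegral.integral_of_le zero_le_one, intervalIntegral.integral_const_mul,
      integral_one_sub_pow_mul_pow, Nat.factorial_succ m]
    have : (n.factorial : ℝ) ≠ 0 := by positivity
    push_cast
    field_simp
  · refine mul_nonneg hp.le (setIntegral_nonneg measurableSet_Ioc fun t ht => ?_)
    have h5 : 0 ≤ 1 - t := by linarith [ht.2]
    have h6 := ht.1
    positivity
  · exact (intervalIntegrable_iff_integrableOn_Ioc_of_le zero_le_one).mp
      (Continuous.intervalIntegrable (by fun_prop) _ _)
  · filter_upwards [ae_restrict_mem measurableSet_Ioc] with t ht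
    have h5 : 0 ≤ 1 - t := by linarith [ht.2]
    have h6 := ht.1
    simp only [Pi.zero_apply]
    positivity

/-- The mass is the reciprocal of the Bergman kernel constant. -/
lemma mass_mul_cB (hn : 0 < n) {k : ℕ} (hk : 2 ≤ k) :
    mass n ((n + 1) * k) * cB n k * (n.factorial / Real.pi ^ n) = 1 := by
  obtain ⟨j, rfl⟩ := Nat.exists_eq_add_of_le hk
  obtain ⟨m, hm⟩ : ∃ m, (n + 1) * (2 + j) = n + 2 + m := ⟨n + (n + 1) * j, by ring⟩
  have hm' : (n + 1) * (2 + j - 1) + n = n + (m + 1) := by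
    have : 2 + j - 1 = j + 1 := by omega
    rw [this]; nlinarith
  rw [hm, mass_eq hn, cB, hm', Nat.cast_add_choose]
  have h1 : (n.factorial : ℝ) ≠ 0 := by positivity
  have h2 : ((m + 1).factorial : ℝ) ≠ 0 := by positivity
  have h3 : ((n + m + 1).factorial : ℝ) ≠ 0 := by positivity
  have h4 := Real.pi_ne_zero
  rw [← add_assoc]
  field_simp

end Mass

section GroupSums

variable {n : ℕ}

/-- The distance of a negative vector to the light cone. -/
noncomputable def gap (u : Fin (n + 1) → ℂ) : ℝ :=
  ‖u (Fin.last n)‖ - Real.sqrt (∑ i : Fin n, ‖u i.castSucc‖ ^ 2)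

lemma continuous_gap : Continuous (gap : (Fin (n + 1) → ℂ) → ℝ) := by
  unfold gap; fun_prop

lemma gap_pos {u : Fin (n + 1) → ℂ} (hu : hq u < 0) : 0 < gap u := by
  have hl : 0 < ‖u (Fin.last n)‖ := norm_pos_iff.mpr (last_ne_zero_of_hq_neg hu)
  rw [gap, sub_pos, Real.sqrt_lt' hl]
  unfold hq at hu
  linarith

lemma norm_herm_ge_gap {u x : Fin (n + 1) → ℂ} (hu : hq u < 0) (hx : hq x ≤ 0) :
    gap u * ‖x (Fin.last n)‖ ≤ ‖herm x u‖ := by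
  have hl : 0 < ‖u (Fin.last n)‖ := norm_pos_iff.mpr (last_ne_zero_of_hq_neg hu)
  have h := norm_herm_ge_slope hu hx
  rwa [slope, sub_mul, one_mul, div_mul_cancel₀ _ hl.ne'] at h

lemma IsU.norm_herm_mulVec_ge {A : Matrix (Fin (n + 1)) (Fin (n + 1)) ℂ} (hA : IsU A)
    {u v : Fin (n + 1) → ℂ} (hu : BallPaper.hq u < 0) (hv : BallPaper.hq v < 0) :
    gap u * gap v * ‖A (Fin.last n) (Fin.last n)‖ ≤ ‖herm (A *ᵥ v) u‖ := by
  have h1 : gap v * ‖A (Fin.last n) (Fin.last n)‖ ≤ ‖(A *ᵥ v) (Fin.last n)‖ := by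
    have h2 : ‖(A *ᵥ v) (Fin.last n)‖ = ‖herm (A⁻¹ *ᵥ e0 n) v‖ := by
      rw [norm_herm_comm, ← hA.herm_mulVec_left, herm_e0, norm_neg]
    have h3 : ‖(A⁻¹ *ᵥ e0 n) (Fin.last n)‖ = ‖A (Fin.last n) (Fin.last n)‖ := by
      rw [← hA.norm_inv_last, ← norm_neg, ← herm_e0, entry_last, norm_neg]
    rw [h2, ← h3]
    exact norm_herm_ge_gap hv (by rw [hA.inv.hq, hq_e0]; norm_num)
  calc gap u * gap v * ‖A (Fin.last n) (Fin.last n)‖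
      = gap u * (gap v * ‖A (Fin.last n) (Fin.last n)‖) := by ring
    _ ≤ gap u * ‖(A *ᵥ v) (Fin.last n)‖ := by
        gcongr
        exact (gap_pos hu).le
    _ ≤ _ := norm_herm_ge_gap hu (by rw [hA.hq]; exact hv.le)

lemma exists_gap_ge {K : Set (Fin (n + 1) → ℂ)} (hK : IsCompact K) (hneg : ∀ u ∈ K, hq u < 0) :
    ∃ c > 0, ∀ u ∈ K, c ≤ gap u := by
  rcases K.eq_empty_or_nonempty with rfl | hne
  · exact ⟨1, one_pos, by simp⟩
  · obtain ⟨x, hx, hmin⟩ := hK.exists_isMinOn hne continuous_gap.continuousOn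
    exact ⟨gap x, gap_pos (hneg x hx), fun u hu => hmin hu⟩

/-- The family of entries of a matrix, as a vector in a normed space. -/
def entries (A : Matrix (Fin (n + 1)) (Fin (n + 1)) ℂ) : Fin (n + 1) × Fin (n + 1) → ℂ :=
  fun p => A p.1 p.2

variable (G : DiscreteGroup n)

lemma DiscreteGroup.isU {A : Matrix (Fin (n + 1)) (Fin (n + 1)) ℂ} (hA : A ∈ G.Γ) : IsU A :=
  (G.sub_SU hA).2

/-- The identity is isolated in a discrete group. -/
lemma DiscreteGroup.exists_isolated : ∃ ε > 0, ∀ A ∈ G.Γ,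
    (∀ i j, ‖A i j - (1 : Matrix (Fin (n + 1)) (Fin (n + 1)) ℂ) i j‖ < ε) → A = 1 := by
  have := G.discrete
  obtain ⟨U, hU, hU1⟩ := isOpen_induced_iff.mp (isOpen_discrete {(⟨1, G.one_mem⟩ : ↥G.Γ)})
  have h1 : (1 : Matrix (Fin (n + 1)) (Fin (n + 1)) ℂ) ∈ U := by
    have : (⟨1, G.one_mem⟩ : ↥G.Γ) ∈ Subtype.val ⁻¹' U := by rw [hU1]; rfl
    exact this
  have hc : Continuous fun x : Fin (n + 1) × Fin (n + 1) → ℂ =>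
      (Matrix.of fun i j => x (i, j) : Matrix (Fin (n + 1)) (Fin (n + 1)) ℂ) :=
    continuous_pi fun i => continuous_pi fun j => continuous_apply (i, j)
  obtain ⟨ε, hε, hball⟩ := Metric.isOpen_iff.mp (hU.preimage hc) (entries 1) h1
  refine ⟨ε, hε, fun A hA h => ?_⟩
  have hAU : A ∈ U := by
    have : entries A ∈ Metric.ball (entries 1) ε := by
      rw [Metric.mem_ball, dist_pi_lt_iff hε]
      intro p
      rw [dist_eq_norm]
      exact h p.1 p.2
    exact hball this
  have : (⟨A, hA⟩ : ↥G.Γ) ∈ Subtype.val ⁻¹' U := hAU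
  rw [hU1] at this
  exact congrArg Subtype.val this

/-- The modulus of the bottom right entry. -/
noncomputable def height (A : Matrix (Fin (n + 1)) (Fin (n + 1)) ℂ) : ℝ :=
  ‖A (Fin.last n) (Fin.last n)‖

lemma DiscreteGroup.exists_separated : ∃ δ > 0, δ ≤ 1 ∧ ∀ A ∈ G.Γ, ∀ B ∈ G.Γ, A ≠ B →
    2 * (δ / height A) ≤ dist (entries A) (entries B) := by
  obtain ⟨ε, hε, h⟩ := G.exists_isolated
  have hn : (0 : ℝ) < n + 1 := by positivity
  refine ⟨min (ε / (4 * (n + 1))) 1, lt_min (by positivity) one_pos, min_le_right _ _,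
    fun A hA B hB hAB => ?_⟩
  have hUA := G.isU hA
  have ha : 0 < height A := lt_of_lt_of_le one_pos hUA.one_le_last
  have hne : A⁻¹ * B ≠ 1 := by
    intro h1
    apply hAB
    have := congrArg (A * ·) h1
    simp only [← mul_assoc, hUA.mul_inv_cancel, one_mul, mul_one] at this
    exact this.symm
  have hex : ∃ i j, ε ≤ ‖(A⁻¹ * B) i j - (1 : Matrix (Fin (n + 1)) (Fin (n + 1)) ℂ) i j‖ := by
    by_contra! hcon
    exact hne (h _ (G.mul_mem (G.inv_mem hA) hB) hcon)
  obtain ⟨i, j, hij⟩ := hex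
  set D := dist (entries A) (entries B) with hD
  have hentry : ∀ l, ‖B l j - A l j‖ ≤ D := by
    intro l
    rw [← dist_eq_norm, dist_comm, hD]
    exact dist_le_pi_dist (entries A) (entries B) (l, j)
  have hbd : ‖(A⁻¹ * B) i j - (1 : Matrix (Fin (n + 1)) (Fin (n + 1)) ℂ) i j‖ ≤
      (n + 1) * (2 * height A * D) := by
    have h2 : (A⁻¹ * B) i j - (1 : Matrix (Fin (n + 1)) (Fin (n + 1)) ℂ) i j =
        ∑ l, A⁻¹ i l * (B l j - A l j) := by
      rw [← hUA.inv_mul_cancel, Matrix.mul_apply, Matrix.mul_apply, ← Finset.sum_sub_distrib]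
      simp only [mul_sub]
    rw [h2]
    refine (norm_sum_le _ _).trans ?_
    refine (Finset.sum_le_card_nsmul _ _ (2 * height A * D) fun l _ => ?_).trans ?_
    · rw [norm_mul]
      have := hUA.inv.norm_entry_le i l
      rw [hUA.norm_inv_last] at this
      exact mul_le_mul this (hentry l) (norm_nonneg _) (by positivity)
    · simp
  have h3 : ε ≤ (n + 1) * (2 * height A * D) := hij.trans hbd
  calc 2 * (min (ε / (4 * (n + 1))) 1 / height A)
      ≤ 2 * ((ε / (4 * (n + 1))) / height A) := by gcongr; exact min_le_left _ _
    _ ≤ D := by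
      rw [div_div, ← mul_div_assoc, div_le_iff₀ (by positivity)]
      nlinarith

/-- Polynomial summability of the heights over a discrete group. -/
lemma DiscreteGroup.exists_summable :
    ∃ M : ℕ, Summable fun A : ↥G.Γ =>
      (height (A : Matrix (Fin (n + 1)) (Fin (n + 1)) ℂ))⁻¹ ^ M := by
  obtain ⟨δ, hδ, hδ1, hsep⟩ := G.exists_separated
  set d := Module.finrank ℝ (Fin (n + 1) × Fin (n + 1) → ℂ) with hd
  have hint : Integrable (fun x : (Fin (n + 1) × Fin (n + 1) → ℂ) =>
      (1 + ‖x‖) ^ (-((d : ℝ) + 1))) :=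
    integrable_one_add_norm (by rw [← hd]; linarith)
  refine ⟨2 * d + 1, ?_⟩
  set f : (Fin (n + 1) × Fin (n + 1) → ℂ) → ℝ := fun x => (1 + ‖x‖) ^ (-((d : ℝ) + 1)) with hf
  have hf0 : ∀ x, 0 ≤ f x := fun x => by positivity
  set V := (volume (Metric.ball (0 : (Fin (n + 1) × Fin (n + 1) → ℂ)) 1)).toReal with hV
  have hV0 : 0 < V := ENNReal.toReal_pos (Metric.measure_ball_pos _ _ one_pos).ne'
    measure_ball_lt_top.ne
  set c : ℝ := V * δ ^ d * (4 ^ (d + 1))⁻¹ with hc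
  have hc0 : 0 < c := by positivity
  have hlow : ∀ A : ↥G.Γ, c * (height (A : Matrix (Fin (n + 1)) (Fin (n + 1)) ℂ))⁻¹ ^ (2 * d + 1) ≤
      ∫ x in Metric.ball (entries A.1) (δ / height A.1), f x := by
    intro A
    have hU := G.isU A.2
    have ha : 1 ≤ height A.1 := hU.one_le_last
    have ha0 : 0 < height A.1 := by linarith
    have hr : 0 < δ / height A.1 := by positivity
    have hr1 : δ / height A.1 ≤ 1 := (div_le_one ha0).mpr (by linarith)
    have hA : ‖entries A.1‖ ≤ 2 * height A.1 := by
      rw [pi_norm_le_iff_of_nonneg (by positivity)]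
      exact fun p => hU.norm_entry_le p.1 p.2
    have hvol : volume.real (Metric.ball (entries A.1) (δ / height A.1)) =
        (δ / height A.1) ^ d * V := by
      rw [Measure.real, Measure.addHaar_ball _ _ hr.le, ENNReal.toReal_mul,
        ENNReal.toReal_ofReal (by positivity)]
    have h1 : ∀ x ∈ Metric.ball (entries A.1) (δ / height A.1),
        ((4 * height A.1) ^ (d + 1))⁻¹ ≤ f x := by
      intro x hx
      have h2 : 1 + ‖x‖ ≤ 4 * height A.1 := by
        have := norm_le_norm_add_norm_sub' x (entries A.1)
        rw [mem_ball_iff_norm] at hx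
        linarith
      change _ ≤ (1 + ‖x‖) ^ (-((d : ℝ) + 1))
      have h3 : ((d : ℝ) + 1) = ((d + 1 : ℕ) : ℝ) := by push_cast; ring
      rw [Real.rpow_neg (by positivity), h3, Real.rpow_natCast]
      gcongr
    calc c * (height A.1)⁻¹ ^ (2 * d + 1)
        = ∫ x in Metric.ball (entries A.1) (δ / height A.1), ((4 * height A.1) ^ (d + 1))⁻¹ := by
          rw [setIntegral_const, hvol, hc, smul_eq_mul, div_eq_mul_inv, mul_pow, mul_pow, mul_inv,
            ← inv_pow]
          ring
      _ ≤ _ := by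
          refine setIntegral_mono_on ?_ hint.integrableOn Metric.isOpen_ball.measurableSet h1
          exact integrableOn_const measure_ball_lt_top.ne
  have hsum : Summable fun A : ↥G.Γ =>
      c * (height (A : Matrix (Fin (n + 1)) (Fin (n + 1)) ℂ))⁻¹ ^ (2 * d + 1) := by
    refine summable_of_sum_le (c := ∫ x, f x) (fun A => ?_) fun S => ?_
    · have : 0 ≤ height A.1 := norm_nonneg _
      positivity
    · refine (Finset.sum_le_sum fun A _ => hlow A).trans ?_
      rw [← integral_biUnion_finset]
      · exact setIntegral_le_integral hint (Eventually.of_forall hf0)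
      · exact fun A _ => Metric.isOpen_ball.measurableSet
      · intro A _ B _ hAB
        refine Metric.ball_disjoint_ball ?_
        have hne : A.1 ≠ B.1 := fun h => hAB (Subtype.ext h)
        have h1 := hsep A.1 A.2 B.1 B.2 hne
        have h2 := hsep B.1 B.2 A.1 A.2 hne.symm
        rw [dist_comm] at h2
        linarith
      · exact fun A _ => hint.integrableOn
  exact (summable_mul_left_iff hc0.ne').mp hsum

instance DiscreteGroup.countable : Countable ↥G.Γ := by
  obtain ⟨M, hM⟩ := G.exists_summable
  have h := hM.countable_support
  have hs : Function.support (fun A : ↥G.Γ =>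
      (height (A : Matrix (Fin (n + 1)) (Fin (n + 1)) ℂ))⁻¹ ^ M) = Set.univ := by
    ext A
    have : 1 ≤ height A.1 := (G.isU A.2).one_le_last
    simp only [Function.mem_support, Set.mem_univ, iff_true]
    positivity
  rw [hs] at h
  exact Set.countable_univ_iff.mp h

end GroupSums

section Unfolding

variable {n : ℕ} (G : DiscreteGroup n)

/-- Right multiplication by a group element as a permutation of the group. -/
noncomputable def DiscreteGroup.mulRight {B : Matrix (Fin (n + 1)) (Fin (n + 1)) ℂ}
    (hB : B ∈ G.Γ) : ↥G.Γ ≃ ↥G.Γ where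
  toFun A := ⟨A.1 * B, G.mul_mem A.2 hB⟩
  invFun A := ⟨A.1 * B⁻¹, G.mul_mem A.2 (G.inv_mem hB)⟩
  left_inv A := Subtype.ext (by
    change A.1 * B * B⁻¹ = A.1
    rw [Matrix.mul_assoc, (G.isU hB).mul_inv_cancel, Matrix.mul_one])
  right_inv A := Subtype.ext (by
    change A.1 * B⁻¹ * B = A.1
    rw [Matrix.mul_assoc, (G.isU hB).inv_mul_cancel, Matrix.mul_one])

variable {G}

/-- The translates of a fundamental domain tile the ball. -/
lemma IsFundDom.sum_map {F : Set (Fin n → ℂ)} (hF : IsFundDom G F) :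
    Measure.sum (fun A : ↥G.Γ => ((hypMeasure n).restrict F).map (act A.1)) = hypMeasure n := by
  obtain ⟨hFb, hFm, hcov, hdisj⟩ := hF
  set s : ↥G.Γ → Set (Fin n → ℂ) := fun A => act (A.1)⁻¹ ⁻¹' F ∩ ball n with hs
  have hsm : ∀ A, MeasurableSet (s A) := fun A =>
    (measurable_act _ hFm).inter measurableSet_ball
  have hmap : ∀ A : ↥G.Γ, ((hypMeasure n).restrict F).map (act A.1) =
      (hypMeasure n).restrict (s A) := by
    intro A
    have hA := G.isU A.2
    have h := (hA.measurePreserving.restrict_preimage (hsm A)).map_eq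
    rw [← h]
    congr 1
    refine Measure.restrict_congr_set ?_
    filter_upwards [ae_mem_ball] with z hz
    refine propext ?_
    change z ∈ F ↔ act A.1⁻¹ (act A.1 z) ∈ F ∧ act A.1 z ∈ ball n
    rw [hA.act_inv_act hz]
    exact ⟨fun h => ⟨h, hA.act_mem hz⟩, fun h => h.1⟩
  simp only [hmap]
  rw [← Measure.restrict_iUnion_ae, Measure.restrict_eq_self_of_ae_mem]
  · filter_upwards [ae_mem_ball] with z hz
    obtain ⟨A, hA, hAz⟩ := hcov z hz
    refine Set.mem_iUnion.mpr ⟨⟨A⁻¹, G.inv_mem hA⟩, ?_, hz⟩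
    have hU := G.isU hA
    have : A⁻¹⁻¹ = A := Matrix.nonsing_inv_nonsing_inv _ hU.isUnit_det
    simp only [Set.mem_preimage, this]
    exact hAz
  · intro A B hAB
    have hA := G.isU A.2
    have hB := G.isU B.2
    have hne : B.1⁻¹ * A.1 ≠ 1 := by
      intro h
      apply hAB
      have := congrArg (B.1 * ·) h
      simp only [← mul_assoc, hB.mul_inv_cancel, one_mul, mul_one] at this
      exact Subtype.ext this
    have hnull := hdisj _ (G.mul_mem (G.inv_mem B.2) A.2) hne
    have h2 := hA.inv.measurePreserving.quasiMeasurePreserving.preimage_null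
      (hypMeasure_absolutelyContinuous hnull)
    refine measure_mono_null ?_ h2
    rintro w ⟨⟨hwA, hw⟩, ⟨hwB, -⟩⟩
    refine ⟨hwA, ?_⟩
    rw [(hB.inv).act_mul hA (hA.inv.act_mem hw), hA.act_act_inv hw]
    exact hwB
  · exact fun A => (hsm A).nullMeasurableSet

lemma IsFundDom.hasSum_integral {F : Set (Fin n → ℂ)} (hF : IsFundDom G F)
    {E : Type*} [NormedAddCommGroup E] [NormedSpace ℝ E]
    {f : (Fin n → ℂ) → E} (hf : Integrable f (hypMeasure n)) :
    HasSum (fun A : ↥G.Γ => ∫ z in F, f (act A.1 z) ∂hypMeasure n)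
      (∫ z, f z ∂hypMeasure n) := by
  have h1 := hF.sum_map
  have h2 : Integrable f (Measure.sum fun A : ↥G.Γ =>
      ((hypMeasure n).restrict F).map (act A.1)) := by rwa [h1]
  have h := hasSum_integral_measure h2
  rw [h1] at h
  convert h using 2 with A
  refine (integral_map (measurable_act _).aemeasurable ?_).symm
  exact h2.aestronglyMeasurable.mono_measure (Measure.le_sum _ A)

variable (G) in
/-- A function on `ℂ^{n+1}`, homogeneous of degree `-N`, that seeds a Poincaré series. -/
structure IsSeed (N : ℕ) (Φ : (Fin (n + 1) → ℂ) → ℂ) : Prop where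
  smul : ∀ c : ℂ, ∀ v, Φ (c • v) = c⁻¹ ^ N * Φ v
  meas : Measurable Φ
  bdd : ∃ M, ∀ z ∈ ball n, ‖Φ (snoc1 z)‖ ≤ M
  decay : ∀ K ⊆ ball n, IsCompact K → ∃ M, ∀ A ∈ G.Γ, ∀ z ∈ K,
    ‖Φ (A *ᵥ snoc1 z)‖ ≤ M * (height A)⁻¹ ^ N

/-- The Poincaré series generated by `Φ`. -/
noncomputable def DiscreteGroup.poincare (G : DiscreteGroup n) (Φ : (Fin (n + 1) → ℂ) → ℂ)
    (z : Fin n → ℂ) : ℂ :=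
  ∑' A : ↥G.Γ, Φ (A.1 *ᵥ snoc1 z)

/-- The series of absolute values of the Poincaré series generated by `Φ`. -/
noncomputable def DiscreteGroup.absPoincare (G : DiscreteGroup n) (Φ : (Fin (n + 1) → ℂ) → ℂ)
    (z : Fin n → ℂ) : ℝ :=
  ∑' A : ↥G.Γ, ‖Φ (A.1 *ᵥ snoc1 z)‖

namespace IsSeed

variable {N : ℕ} {Φ : (Fin (n + 1) → ℂ) → ℂ}

lemma summable_norm (hΦ : IsSeed G N Φ) (hs : Summable fun A : ↥G.Γ => (height A.1)⁻¹ ^ N)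
    {z : Fin n → ℂ} (hz : z ∈ ball n) : Summable fun A : ↥G.Γ => ‖Φ (A.1 *ᵥ snoc1 z)‖ := by
  obtain ⟨M, hM⟩ := hΦ.decay {z} (by simpa using hz) isCompact_singleton
  exact Summable.of_nonneg_of_le (fun _ => norm_nonneg _)
    (fun A => hM A.1 A.2 z rfl) (hs.mul_left M)

lemma apply_mul (hΦ : IsSeed G N Φ) {B : Matrix (Fin (n + 1)) (Fin (n + 1)) ℂ} (hB : IsU B)
    (A : Matrix (Fin (n + 1)) (Fin (n + 1)) ℂ) {z : Fin n → ℂ} (hz : z ∈ ball n) :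
    Φ (A *ᵥ snoc1 (act B z)) = denom B z ^ N * Φ ((A * B) *ᵥ snoc1 z) := by
  have hd := hB.denom_ne_zero hz
  rw [← Matrix.mulVec_mulVec, hB.mulVec_snoc1 hz, Matrix.mulVec_smul, hΦ.smul, ← mul_assoc,
    ← mul_pow, mul_inv_cancel₀ hd, one_pow, one_mul]

lemma poincare_act (hΦ : IsSeed G N Φ) {B : Matrix (Fin (n + 1)) (Fin (n + 1)) ℂ}
    (hB : B ∈ G.Γ) {z : Fin n → ℂ} (hz : z ∈ ball n) :
    G.poincare Φ (act B z) = denom B z ^ N * G.poincare Φ z := by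
  unfold DiscreteGroup.poincare
  rw [← (G.mulRight hB).tsum_eq (fun A : ↥G.Γ => Φ (A.1 *ᵥ snoc1 z)), ← tsum_mul_left]
  exact tsum_congr fun A => hΦ.apply_mul (G.isU hB) A.1 hz

lemma absPoincare_act (hΦ : IsSeed G N Φ) {B : Matrix (Fin (n + 1)) (Fin (n + 1)) ℂ}
    (hB : B ∈ G.Γ) {z : Fin n → ℂ} (hz : z ∈ ball n) :
    G.absPoincare Φ (act B z) = ‖denom B z‖ ^ N * G.absPoincare Φ z := by
  unfold DiscreteGroup.absPoincare
  rw [← (G.mulRight hB).tsum_eq (fun A : ↥G.Γ => ‖Φ (A.1 *ᵥ snoc1 z)‖), ← tsum_mul_left]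
  refine tsum_congr fun A => ?_
  rw [hΦ.apply_mul (G.isU hB) A.1 hz, norm_mul, norm_pow]
  rfl

lemma absPoincare_nonneg (z : Fin n → ℂ) : 0 ≤ G.absPoincare Φ z :=
  tsum_nonneg fun _ => norm_nonneg _

lemma exists_sq_mul_defect_le (hΦ : IsSeed G N Φ)
    (hs : Summable fun A : ↥G.Γ => (height A.1)⁻¹ ^ N) :
    ∃ M, 0 ≤ M ∧ ∀ z ∈ ball n, G.absPoincare Φ z ^ 2 * defect z ^ N ≤ M ^ 2 := by
  obtain ⟨K, hKb, hK, hcov⟩ := G.cocompact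
  obtain ⟨M, hM⟩ := hΦ.decay K hKb hK
  set M' : ℝ := ∑' A : ↥G.Γ, M * (height A.1)⁻¹ ^ N
  have hle : ∀ z ∈ K, G.absPoincare Φ z ≤ M' := fun z hz =>
    (hΦ.summable_norm hs (hKb hz)).tsum_le_tsum (fun A => hM A.1 A.2 z hz) (hs.mul_left M)
  refine ⟨|M'|, abs_nonneg _, fun z hz => ?_⟩
  obtain ⟨B, hB, hBz⟩ := hcov z hz
  have hU := G.isU hB
  have h1 : G.absPoincare Φ z ^ 2 * defect z ^ N =
      G.absPoincare Φ (act B z) ^ 2 * defect (act B z) ^ N := by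
    rw [hΦ.absPoincare_act hB hz, hU.defect_eq hz]
    ring
  have hz' := hKb hBz
  have h2 : G.absPoincare Φ (act B z) ≤ |M'| := (hle _ hBz).trans (le_abs_self _)
  have h3 : defect (act B z) ^ N ≤ 1 :=
    pow_le_one₀ (mem_ball_iff.mp hz').le (defect_le_one _)
  rw [h1]
  calc _ ≤ G.absPoincare Φ (act B z) ^ 2 * 1 := by gcongr
    _ ≤ _ := by
      rw [mul_one]
      exact pow_le_pow_left₀ (absPoincare_nonneg _) h2 2

lemma norm_poincare_le (hΦ : IsSeed G N Φ)
    (hs : Summable fun A : ↥G.Γ => (height A.1)⁻¹ ^ N) {z : Fin n → ℂ} (hz : z ∈ ball n) :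
    ‖G.poincare Φ z‖ ≤ G.absPoincare Φ z :=
  norm_tsum_le_tsum_norm (hΦ.summable_norm hs hz)

lemma measurable_term (hΦ : IsSeed G N Φ) (A : Matrix (Fin (n + 1)) (Fin (n + 1)) ℂ) :
    Measurable fun z : Fin n → ℂ => Φ (A *ᵥ snoc1 z) :=
  hΦ.meas.comp (Continuous.measurable (by
    have := continuous_snoc1 (n := n)
    fun_prop))

lemma measurable_absPoincare (hΦ : IsSeed G N Φ) : Measurable (G.absPoincare Φ) :=
  Measurable.tsum fun A => (hΦ.measurable_term A.1).norm

lemma measurable_poincare (hΦ : IsSeed G N Φ) : Measurable (G.poincare Φ) :=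
  Measurable.tsum fun A => hΦ.measurable_term A.1

lemma integrable_mul_absPoincare (hΦ : IsSeed G N Φ) (hN : 2 * (n + 1) ≤ N)
    (hs : Summable fun A : ↥G.Γ => (height A.1)⁻¹ ^ N) :
    Integrable (fun z => ‖Φ (snoc1 z)‖ * G.absPoincare Φ z * defect z ^ N) (hypMeasure n) := by
  obtain ⟨M, hM0, hM⟩ := hΦ.exists_sq_mul_defect_le hs
  obtain ⟨M', hM'⟩ := hΦ.bdd
  have hj : n + 1 ≤ N / 2 := by omega
  have hmeas : Measurable fun z : Fin n → ℂ =>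
      ‖Φ (snoc1 z)‖ * G.absPoincare Φ z * defect z ^ (N - N / 2) :=
    ((hΦ.meas.comp continuous_snoc1.measurable).norm.mul hΦ.measurable_absPoincare).mul
      (continuous_defect.measurable.pow_const _)
  have hint := (integrable_defect_pow (n := n) hj).bdd_mul (c := |M'| * M)
    hmeas.aestronglyMeasurable (by
      filter_upwards [ae_mem_ball] with z hz
      have hd := mem_ball_iff.mp hz
      have h0 := absPoincare_nonneg (G := G) (Φ := Φ) z
      have h1 : G.absPoincare Φ z * defect z ^ (N - N / 2) ≤ M := by
        refine le_of_sq_le_sq ?_ hM0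
        refine le_trans ?_ (hM z hz)
        rw [mul_pow, ← pow_mul]
        have := pow_le_pow_of_le_one hd.le (defect_le_one z)
          (show N ≤ (N - N / 2) * 2 by omega)
        gcongr
      rw [Real.norm_of_nonneg (by positivity), mul_assoc]
      exact mul_le_mul ((hM' z hz).trans (le_abs_self _)) h1 (by positivity) (abs_nonneg _))
  refine hint.congr (Eventually.of_forall fun z => ?_)
  change _ * _ * _ * _ = _
  rw [mul_assoc, ← pow_add, Nat.sub_add_cancel (Nat.div_le_self _ _)]

/-- Unfolding of the Petersson norm of a Poincaré series. -/
theorem unfold (hΦ : IsSeed G N Φ) (hN : 2 * (n + 1) ≤ N)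
    (hs : Summable fun A : ↥G.Γ => (height A.1)⁻¹ ^ N) {F : Set (Fin n → ℂ)}
    (hF : IsFundDom G F) :
    ∫ z in F, G.poincare Φ z * star (G.poincare Φ z) * ((defect z ^ N : ℝ) : ℂ) ∂hypMeasure n =
      ∑' A : ↥G.Γ, ∫ z, Φ (snoc1 z) * star (Φ (A.1 *ᵥ snoc1 z)) * ((defect z ^ N : ℝ) : ℂ)
        ∂hypMeasure n := by
  have hg := hΦ.integrable_mul_absPoincare hN hs
  have hmΦ : Measurable fun z : Fin n → ℂ => Φ (snoc1 z) :=
    hΦ.meas.comp continuous_snoc1.measurable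
  have hmd : Measurable fun z : Fin n → ℂ => ((defect z ^ N : ℝ) : ℂ) :=
    Complex.measurable_ofReal.comp (continuous_defect.measurable.pow_const _)
  set h : (Fin n → ℂ) → ℂ := fun z =>
    Φ (snoc1 z) * star (G.poincare Φ z) * ((defect z ^ N : ℝ) : ℂ) with hh
  have hint : Integrable h (hypMeasure n) := by
    refine hg.mono' ((hmΦ.aestronglyMeasurable.mul
      hΦ.measurable_poincare.aestronglyMeasurable.star).mul hmd.aestronglyMeasurable) ?_
    filter_upwards [ae_mem_ball] with z hz
    have hd := mem_ball_iff.mp hz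
    have := hΦ.norm_poincare_le hs hz
    rw [norm_mul, norm_mul, norm_star, Complex.norm_of_nonneg (by positivity)]
    gcongr
  have hact : ∀ A : ↥G.Γ, ∀ z ∈ ball n, h (act A.1 z) =
      Φ (A.1 *ᵥ snoc1 z) * (star (G.poincare Φ z) * ((defect z ^ N : ℝ) : ℂ)) := by
    intro A z hz
    have hU := G.isU A.2
    have h1 := hΦ.apply_mul hU 1 hz
    have h2 : ((defect z ^ N : ℝ) : ℂ) = denom A.1 z ^ N * star (denom A.1 z) ^ N *
        ((defect (act A.1 z) ^ N : ℝ) : ℂ) := by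
      rw [hU.defect_eq hz, mul_pow]
      push_cast
      rw [← mul_pow (denom A.1 z), Complex.star_def, Complex.mul_conj']
    rw [Matrix.one_mulVec, Matrix.one_mul] at h1
    simp only [hh]
    rw [h1, hΦ.poincare_act A.2 hz, h2, star_mul', star_pow]
    ring
  have hFint : ∀ A : ↥G.Γ, Integrable (fun z => h (act A.1 z)) ((hypMeasure n).restrict F) :=
    fun A => (((G.isU A.2).measurePreserving).integrable_comp_of_integrable hint).restrict
  have hsum1 := hF.hasSum_integral hint
  have hsum2 := hF.hasSum_integral hint.norm
  have hsum3 := hasSum_integral_of_summable_integral_norm hFint hsum2.summable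
  have hL : ∫ z in F, G.poincare Φ z * star (G.poincare Φ z) * ((defect z ^ N : ℝ) : ℂ)
      ∂hypMeasure n = ∫ z, h z ∂hypMeasure n := by
    rw [hsum1.unique hsum3]
    refine integral_congr_ae ?_
    filter_upwards [ae_restrict_of_ae ae_mem_ball] with z hz
    rw [tsum_congr fun A => hact A z hz, tsum_mul_right, mul_assoc]
    rfl
  rw [hL]
  set f : ↥G.Γ → (Fin n → ℂ) → ℂ := fun A z =>
    Φ (snoc1 z) * star (Φ (A.1 *ᵥ snoc1 z)) * ((defect z ^ N : ℝ) : ℂ) with hf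
  have hfm : ∀ A, AEStronglyMeasurable (f A) (hypMeasure n) := fun A =>
    ((hmΦ.aestronglyMeasurable.mul (hΦ.measurable_term A.1).aestronglyMeasurable.star).mul
      hmd.aestronglyMeasurable)
  have hnorm : ∀ s : Finset ↥G.Γ, ∀ z ∈ ball n,
      ∑ A ∈ s, ‖f A z‖ ≤ ‖Φ (snoc1 z)‖ * G.absPoincare Φ z * defect z ^ N := by
    intro s z hz
    have hd := mem_ball_iff.mp hz
    have := (hΦ.summable_norm hs hz).sum_le_tsum s fun _ _ => norm_nonneg _
    simp only [hf, norm_mul, norm_star, Complex.norm_of_nonneg (pow_nonneg hd.le N)]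
    rw [← Finset.sum_mul, ← Finset.mul_sum]
    exact mul_le_mul_of_nonneg_right (mul_le_mul_of_nonneg_left this (norm_nonneg _))
      (pow_nonneg hd.le N)
  have hfi : ∀ A, Integrable (f A) (hypMeasure n) := fun A => hg.mono' (hfm A) (by
    filter_upwards [ae_mem_ball] with z hz
    simpa using hnorm {A} z hz)
  have hfs : Summable fun A => ∫ z, ‖f A z‖ ∂hypMeasure n := by
    refine summable_of_sum_le (c := ∫ z, ‖Φ (snoc1 z)‖ * G.absPoincare Φ z * defect z ^ N
      ∂hypMeasure n) (fun A => integral_nonneg fun _ => norm_nonneg _) fun s => ?_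
    rw [← integral_finsetSum s fun A _ => (hfi A).norm]
    refine integral_mono_ae (integrable_finsetSum s fun A _ => (hfi A).norm) hg ?_
    filter_upwards [ae_mem_ball] with z hz using hnorm s z hz
  rw [(hasSum_integral_of_summable_integral_norm hfi hfs).tsum_eq]
  refine integral_congr_ae ?_
  filter_upwards [ae_mem_ball] with z hz
  simp only [hf, hh]
  rw [tsum_mul_right, tsum_mul_left, DiscreteGroup.poincare, tsum_star]

end IsSeed

end Unfolding

section PathKernel

variable {n : ℕ} {N : ℕ} {u w : ℝ → Fin (n + 1) → ℂ} {L : ℝ}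

/-- The kernel function `ker N v ·` integrated over a path. -/
noncomputable def pathKer (N : ℕ) (u : ℝ → Fin (n + 1) → ℂ) (L : ℝ) (v : Fin (n + 1) → ℂ) : ℂ :=
  ∫ t in Set.Ioc 0 L, ker N v (u t)

/-- The double integral of the kernel along a path and its translate. -/
noncomputable def pathEnergy (N : ℕ) (u : ℝ → Fin (n + 1) → ℂ) (L : ℝ)
    (A : Matrix (Fin (n + 1)) (Fin (n + 1)) ℂ) : ℂ :=
  ∫ p in Set.Ioc 0 L ×ˢ Set.Ioc 0 L, ker N (u p.2) (A *ᵥ u p.1)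

lemma measurable_ker_comp {α : Type*} [MeasurableSpace α] {f g : α → Fin (n + 1) → ℂ} (N : ℕ)
    (hf : Measurable f) (hg : Measurable g) : Measurable fun x => ker N (f x) (g x) := by
  have h : Measurable fun x => herm (f x) (g x) := by
    unfold herm
    fun_prop
  exact h.neg.inv.pow_const N

lemma exists_gap_path (hu : Continuous u) (hneg : ∀ t, hq (u t) < 0) (L : ℝ) :
    ∃ c > 0, ∀ t ∈ Set.Ioc 0 L, c ≤ gap (u t) := by
  obtain ⟨c, hc, h⟩ := exists_gap_ge ((isCompact_Icc (a := (0 : ℝ)) (b := L)).image hu)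
    (by rintro _ ⟨t, -, rfl⟩; exact hneg t)
  exact ⟨c, hc, fun t ht => h _ ⟨t, Set.Ioc_subset_Icc_self ht, rfl⟩⟩

lemma norm_ker_le_of_le (N : ℕ) {m : ℝ} {x y : Fin (n + 1) → ℂ} (hm : 0 < m)
    (h : m ≤ ‖herm x y‖) : ‖ker N x y‖ ≤ m⁻¹ ^ N := by
  rw [norm_ker]
  gcongr

lemma exists_norm_ker_path_le (hu : Continuous u) (hneg : ∀ t, hq (u t) < 0) (N : ℕ) (L : ℝ) :
    ∃ M, ∀ z ∈ ball n, ∀ t ∈ Set.Ioc 0 L, ‖ker N (snoc1 z) (u t)‖ ≤ M := by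
  obtain ⟨c, hc, h⟩ := exists_gap_path hu hneg L
  refine ⟨c⁻¹ ^ N, fun z hz t ht => norm_ker_le_of_le N hc ?_⟩
  have := norm_herm_ge_gap (hneg t) (hq_snoc1_neg hz).le
  rw [snoc1_last, norm_one, mul_one] at this
  exact (h t ht).trans this

lemma isSeed_pathKer (G : DiscreteGroup n) (hu : Continuous u) (hneg : ∀ t, hq (u t) < 0) :
    IsSeed G N (pathKer N u L) where
  smul c v := by
    simp only [pathKer, ker_smul_left, integral_const_mul]
  meas := by
    have h : Measurable fun p : (Fin (n + 1) → ℂ) × ℝ => ker N p.1 (u p.2) :=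
      measurable_ker_comp N measurable_fst (hu.measurable.comp measurable_snd)
    exact (h.stronglyMeasurable.integral_prod_right
      (ν := volume.restrict (Set.Ioc 0 L))).measurable
  bdd := by
    obtain ⟨M, hM⟩ := exists_norm_ker_path_le hu hneg N L
    refine ⟨M * volume.real (Set.Ioc 0 L), fun z hz => ?_⟩
    exact norm_setIntegral_le_of_norm_le_const (by simp) (hM z hz)
  decay K hK hKc := by
    obtain ⟨c, hc, h⟩ := exists_gap_path hu hneg L
    obtain ⟨d, hd, h'⟩ := exists_gap_ge (hKc.image continuous_snoc1)
      (by rintro _ ⟨z, hz, rfl⟩; exact hq_snoc1_neg (hK hz))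
    refine ⟨(c * d)⁻¹ ^ N * volume.real (Set.Ioc 0 L), fun A hA z hz => ?_⟩
    have hU := G.isU hA
    have hh : 0 < height A := one_pos.trans_le hU.one_le_last
    have key : ∀ t ∈ Set.Ioc 0 L, ‖ker N (A *ᵥ snoc1 z) (u t)‖ ≤ (c * d * height A)⁻¹ ^ N := by
      intro t ht
      refine norm_ker_le_of_le N (by positivity) ?_
      refine le_trans ?_ (hU.norm_herm_mulVec_ge (hneg t) (hq_snoc1_neg (hK hz)))
      have h1 := h t ht
      have h2 := h' _ ⟨z, hz, rfl⟩
      change _ ≤ gap (u t) * gap (snoc1 z) * height A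
      gcongr
      exact hc.le.trans h1
    refine (norm_setIntegral_le_of_norm_le_const (by simp) key).trans_eq ?_
    rw [mul_inv, mul_pow]
    ring

lemma pathKer_mulVec {A : Matrix (Fin (n + 1)) (Fin (n + 1)) ℂ} (hA : IsU A)
    (v : Fin (n + 1) → ℂ) :
    pathKer N u L (A *ᵥ v) = pathKer N (fun t => A⁻¹ *ᵥ u t) L v := by
  simp only [pathKer, ker, hA.herm_mulVec_left]

lemma integral_pathKer_mul_star (hN : n + 1 ≤ N) (hu : Continuous u) (hun : ∀ t, hq (u t) < 0)
    (hw : Continuous w) (hwn : ∀ t, hq (w t) < 0) :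
    ∫ z, pathKer N u L (snoc1 z) * star (pathKer N w L (snoc1 z)) * ((defect z ^ N : ℝ) : ℂ)
      ∂hypMeasure n =
    mass n N * ∫ p in Set.Ioc 0 L ×ˢ Set.Ioc 0 L, ker N (w p.2) (u p.1) := by
  set ν : Measure ℝ := volume.restrict (Set.Ioc 0 L) with hν
  have hprod : ∀ z, pathKer N u L (snoc1 z) * star (pathKer N w L (snoc1 z)) *
      ((defect z ^ N : ℝ) : ℂ) = ∫ p, ker N (snoc1 z) (u p.1) * star (ker N (snoc1 z) (w p.2)) *
        ((defect z ^ N : ℝ) : ℂ) ∂ν.prod ν := by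
    intro z
    rw [integral_mul_const, integral_prod_mul (fun t => ker N (snoc1 z) (u t))
      (fun t => star (ker N (snoc1 z) (w t)))]
    congr 2
    rw [pathKer]
    exact integral_conj.symm
  simp only [hprod]
  obtain ⟨M, hM⟩ := exists_norm_ker_path_le hu hun N L
  obtain ⟨M', hM'⟩ := exists_norm_ker_path_le hw hwn N L
  have hint : Integrable (Function.uncurry fun (z : Fin n → ℂ) (p : ℝ × ℝ) =>
      ker N (snoc1 z) (u p.1) * star (ker N (snoc1 z) (w p.2)) * ((defect z ^ N : ℝ) : ℂ))
      ((hypMeasure n).prod (ν.prod ν)) := by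
    have h1 : Integrable (fun q : (Fin n → ℂ) × (ℝ × ℝ) => ((defect q.1 ^ N : ℝ) : ℂ))
        ((hypMeasure n).prod (ν.prod ν)) := by
      have h0 : Integrable (fun z : Fin n → ℂ => ((defect z ^ N : ℝ) : ℂ)) (hypMeasure n) :=
        (integrable_defect_pow hN).ofReal
      exact h0.comp_fst (ν.prod ν)
    have hm1 : Measurable fun q : (Fin n → ℂ) × (ℝ × ℝ) => ker N (snoc1 q.1) (u q.2.1) :=
      measurable_ker_comp N (continuous_snoc1.measurable.comp measurable_fst)
        (hu.measurable.comp (measurable_fst.comp measurable_snd))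
    have hm2 : Measurable fun q : (Fin n → ℂ) × (ℝ × ℝ) => ker N (snoc1 q.1) (w q.2.2) :=
      measurable_ker_comp N (continuous_snoc1.measurable.comp measurable_fst)
        (hw.measurable.comp (measurable_snd.comp measurable_snd))
    refine h1.bdd_mul (c := |M| * |M'|)
      (hm1.aestronglyMeasurable.mul hm2.aestronglyMeasurable.star) ?_
    have a1 : ∀ᵐ q ∂(hypMeasure n).prod (ν.prod ν), q.1 ∈ ball n :=
      Measure.quasiMeasurePreserving_fst.ae ae_mem_ball
    have a0 : ∀ᵐ t ∂ν, t ∈ Set.Ioc 0 L := ae_restrict_mem measurableSet_Ioc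
    have a2 : ∀ᵐ q ∂(hypMeasure n).prod (ν.prod ν), q.2.1 ∈ Set.Ioc 0 L :=
      Measure.quasiMeasurePreserving_snd.ae (Measure.quasiMeasurePreserving_fst.ae a0)
    have a3 : ∀ᵐ q ∂(hypMeasure n).prod (ν.prod ν), q.2.2 ∈ Set.Ioc 0 L :=
      Measure.quasiMeasurePreserving_snd.ae (Measure.quasiMeasurePreserving_snd.ae a0)
    filter_upwards [a1, a2, a3] with q h1 h2 h3
    rw [norm_mul, norm_star]
    exact mul_le_mul ((hM _ h1 _ h2).trans (le_abs_self _)) ((hM' _ h1 _ h3).trans (le_abs_self _))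
      (norm_nonneg _) (abs_nonneg _)
  rw [integral_integral_swap hint]
  simp only [reproducing hN (hun _) (hwn _)]
  rw [integral_const_mul, hν, Measure.prod_restrict]
  rfl

/-- The Petersson norm of the Poincaré series of a path as a sum of double integrals. -/
theorem petersson_pathKer {G : DiscreteGroup n} (hN : 2 * (n + 1) ≤ N)
    (hs : Summable fun A : ↥G.Γ => (height A.1)⁻¹ ^ N) (hu : Continuous u)
    (hneg : ∀ t, hq (u t) < 0) {F : Set (Fin n → ℂ)} (hF : IsFundDom G F) :
    ∫ z in F, G.poincare (pathKer N u L) z * star (G.poincare (pathKer N u L) z) *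
      ((defect z ^ N : ℝ) : ℂ) ∂hypMeasure n =
    mass n N * ∑' A : ↥G.Γ, pathEnergy N u L A.1 := by
  rw [(isSeed_pathKer G hu hneg).unfold hN hs hF, ← tsum_mul_left]
  refine tsum_congr fun A => ?_
  have hU := G.isU A.2
  simp only [pathKer_mulVec hU]
  rw [integral_pathKer_mul_star (by omega) hu hneg (by fun_prop)
    (fun t => by rw [hU.inv.hq]; exact hneg t), pathEnergy]
  congr 1
  refine integral_congr_ae (Eventually.of_forall fun p => ?_)
  have h : herm (A.1⁻¹ *ᵥ u p.2) (u p.1) = herm (u p.2) (A.1 *ᵥ u p.1) := by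
    rw [← hU (A.1⁻¹ *ᵥ u p.2), Matrix.mulVec_mulVec, hU.mul_inv_cancel, Matrix.one_mulVec]
  simp only [ker, h]

end PathKernel

section Sech

lemma one_add_sq_div_two_le_cosh (y : ℝ) : 1 + y ^ 2 / 2 ≤ Real.cosh y := by
  have h1 : Real.cosh y = 1 + 2 * Real.sinh (y / 2) ^ 2 := by
    have h := Real.cosh_two_mul (y / 2)
    rw [Real.cosh_sq, mul_div_cancel₀ y two_ne_zero] at h
    linarith
  have h2 : (y / 2) ^ 2 ≤ Real.sinh (y / 2) ^ 2 := by
    rcases le_total 0 (y / 2) with h | h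
    · have := Real.self_le_sinh_iff.mpr h
      nlinarith
    · have := Real.sinh_le_self_iff.mpr h
      nlinarith
  rw [h1]
  linarith

lemma one_add_mul_sq_le_cosh_pow (N : ℕ) (y : ℝ) :
    1 + (N : ℝ) * (y ^ 2 / 2) ≤ Real.cosh y ^ N :=
  (one_add_mul_le_pow (by have := sq_nonneg y; linarith) N).trans
    (pow_le_pow_left₀ (by positivity) (one_add_sq_div_two_le_cosh y) N)

lemma sech_pow_le (N : ℕ) (y : ℝ) :
    (Real.cosh y)⁻¹ ^ N ≤ (1 + (√(N / 2 : ℝ) * y) ^ 2)⁻¹ := by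
  rw [inv_pow]
  refine inv_anti₀ (by positivity) (le_trans (le_of_eq ?_) (one_add_mul_sq_le_cosh_pow N y))
  rw [mul_pow, Real.sq_sqrt (by positivity)]
  ring

lemma continuous_sech_pow (N : ℕ) : Continuous fun y : ℝ => (Real.cosh y)⁻¹ ^ N :=
  (Real.continuous_cosh.inv₀ fun y => (Real.cosh_pos y).ne').pow N

lemma sqrt_mul_integral_sech_le {N : ℕ} (hN : 1 ≤ N) (t₀ L : ℝ) :
    √(N : ℝ) * ∫ t in Set.Ioc 0 L, (Real.cosh (t - t₀))⁻¹ ^ N ≤ √2 * Real.pi := by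
  have hN' : (0 : ℝ) < N := by exact_mod_cast hN
  have ha : 0 < √(N / 2 : ℝ) := Real.sqrt_pos.mpr (by positivity)
  have hg : Integrable fun t : ℝ => (1 + (√(N / 2 : ℝ) * (t - t₀)) ^ 2)⁻¹ :=
    (integrable_inv_one_add_sq.comp_mul_left' ha.ne').comp_sub_right t₀
  have hc : Continuous fun t : ℝ => (Real.cosh (t - t₀))⁻¹ ^ N :=
    (continuous_sech_pow N).comp (continuous_id.sub continuous_const)
  have h1 : ∫ t in Set.Ioc 0 L, (Real.cosh (t - t₀))⁻¹ ^ N ≤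
      ∫ t : ℝ, (1 + (√(N / 2 : ℝ) * (t - t₀)) ^ 2)⁻¹ := by
    refine (setIntegral_mono (hc.integrableOn_Ioc) hg.integrableOn
      fun t => sech_pow_le N (t - t₀)).trans ?_
    exact setIntegral_le_integral hg (Eventually.of_forall fun t => by positivity)
  have h2 : ∫ t : ℝ, (1 + (√(N / 2 : ℝ) * (t - t₀)) ^ 2)⁻¹ = (√(N / 2 : ℝ))⁻¹ * Real.pi := by
    rw [integral_sub_right_eq_self (fun t : ℝ => (1 + (√(N / 2 : ℝ) * t) ^ 2)⁻¹) t₀,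
      Measure.integral_comp_mul_left (fun t : ℝ => (1 + t ^ 2)⁻¹), integral_univ_inv_one_add_sq,
      abs_of_pos (inv_pos.mpr ha), smul_eq_mul]
  calc _ ≤ √(N : ℝ) * ((√(N / 2 : ℝ))⁻¹ * Real.pi) := by
        rw [← h2]
        gcongr
    _ = _ := by
        rw [← mul_assoc, Real.sqrt_div hN'.le, inv_div,
          mul_div_cancel₀ _ (Real.sqrt_pos.mpr hN').ne']

lemma tendsto_sech_pow (x : ℝ) :
    Tendsto (fun N : ℕ => (Real.cosh ((√(N : ℝ))⁻¹ * x))⁻¹ ^ N) atTop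
      (𝓝 (Real.exp (-(1 / 2) * x ^ 2))) := by
  have h : Tendsto (fun N : ℕ => Real.cosh ((√(N : ℝ))⁻¹ * x) ^ N) atTop
      (𝓝 (Real.exp (x ^ 2 / 2))) := by
    refine tendsto_of_tendsto_of_tendsto_of_le_of_le' (Real.tendsto_one_add_div_pow_exp (x ^ 2 / 2))
      tendsto_const_nhds ?_ ?_
    · filter_upwards [eventually_ge_atTop 1] with N hN
      have hN' : (0 : ℝ) < N := by exact_mod_cast hN
      refine pow_le_pow_left₀ (by positivity)
        (le_trans (le_of_eq ?_) (one_add_sq_div_two_le_cosh _)) N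
      rw [mul_pow, inv_pow, Real.sq_sqrt hN'.le]
      ring
    · filter_upwards [eventually_ge_atTop 1] with N hN
      have hN' : (0 : ℝ) < N := by exact_mod_cast hN
      refine (pow_le_pow_left₀ (Real.cosh_pos _).le (Real.cosh_le_exp_half_sq _) N).trans_eq ?_
      rw [← Real.exp_nat_mul, mul_pow, inv_pow, Real.sq_sqrt hN'.le]
      congr 1
      field_simp
  have h2 := h.inv₀ (Real.exp_pos _).ne'
  rw [← Real.exp_neg] at h2
  simp only [inv_pow]
  convert h2 using 3
  ring

lemma tendsto_sqrt_mul_integral_sech {L s : ℝ} (hs : s ∈ Set.Ioo 0 L) :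
    Tendsto (fun N : ℕ => √(N : ℝ) * ∫ t in Set.Ioc 0 L, (Real.cosh (t - s))⁻¹ ^ N) atTop
      (𝓝 (√(2 * Real.pi))) := by
  set f : ℕ → ℝ → ℝ := fun N y =>
    (Set.Ioc 0 L).indicator (fun t => (Real.cosh (t - s))⁻¹ ^ N) (y + s) with hf
  have hfm : ∀ N, Measurable (f N) := fun N =>
    (((continuous_sech_pow N).comp (continuous_id.sub continuous_const)).measurable.indicator
      measurableSet_Ioc).comp (measurable_id.add_const s)
  have hle : ∀ N y, ‖f N y‖ ≤ (Real.cosh y)⁻¹ ^ N := by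
    intro N y
    simp only [hf]
    refine (norm_indicator_le_norm_self _ _).trans ?_
    rw [add_sub_cancel_right,
      Real.norm_of_nonneg (pow_nonneg (inv_nonneg.mpr (Real.cosh_pos _).le) _)]
  have key : Tendsto (fun N : ℕ => ∫ x, f (N + 1) ((√((N + 1 : ℕ) : ℝ))⁻¹ * x)) atTop
      (𝓝 (∫ x : ℝ, Real.exp (-(1 / 2) * x ^ 2))) := by
    refine tendsto_integral_of_dominated_convergence
      (fun x => (1 + (√(1 / 2 : ℝ) * x) ^ 2)⁻¹)
      (fun N => ((hfm _).comp (measurable_const_mul _)).aestronglyMeasurable)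
      (integrable_inv_one_add_sq.comp_mul_left' (by positivity)) ?_ ?_
    · refine fun N => Eventually.of_forall fun x => ?_
      have hN' : (0 : ℝ) < ((N + 1 : ℕ) : ℝ) := by positivity
      refine (hle _ _).trans ((sech_pow_le _ _).trans_eq ?_)
      rw [mul_pow, mul_pow, inv_pow, mul_pow, Real.sq_sqrt hN'.le, Real.sq_sqrt (by positivity),
        Real.sq_sqrt (by positivity)]
      field_simp
    · refine Eventually.of_forall fun x => ?_
      have h0 : Tendsto (fun N : ℕ => (√(N : ℝ))⁻¹ * x + s) atTop (𝓝 (0 * x + s)) :=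
        (((Real.tendsto_sqrt_atTop.comp tendsto_natCast_atTop_atTop).inv_tendsto_atTop).mul_const
          x).add_const s
      rw [zero_mul, zero_add] at h0
      have h1 := h0.eventually (Ioo_mem_nhds hs.1 hs.2)
      have h2 : Tendsto (fun N : ℕ => f N ((√(N : ℝ))⁻¹ * x)) atTop
          (𝓝 (Real.exp (-(1 / 2) * x ^ 2))) := by
        refine (tendsto_sech_pow x).congr' ?_
        filter_upwards [h1] with N hN
        simp only [hf]
        rw [Set.indicator_of_mem (Set.Ioo_subset_Ioc_self hN), add_sub_cancel_right]
      exact (tendsto_add_atTop_iff_nat 1).mpr h2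
  rw [integral_gaussian] at key
  rw [← tendsto_add_atTop_iff_nat 1]
  refine (key.congr fun N => ?_).trans (le_of_eq ?_)
  · have hN' : (0 : ℝ) < ((N + 1 : ℕ) : ℝ) := by positivity
    rw [Measure.integral_comp_mul_left (f (N + 1)), inv_inv, abs_of_nonneg (Real.sqrt_nonneg _),
      smul_eq_mul, ← integral_indicator measurableSet_Ioc]
    congr 1
    exact integral_add_right_eq_self
      (fun y => (Set.Ioc 0 L).indicator (fun t => (Real.cosh (t - s))⁻¹ ^ (N + 1)) y) s
  · congr 2
    ring

end Sech

section Energy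

variable {n : ℕ}

/-- The unit speed geodesic spanned by an orthonormal pair, lifted to the hyperboloid. -/
noncomputable def geoPath (a b : Fin (n + 1) → ℂ) (t : ℝ) : Fin (n + 1) → ℂ :=
  (Real.sinh t : ℂ) • a + (Real.cosh t : ℂ) • b

lemma continuous_geoPath (a b : Fin (n + 1) → ℂ) : Continuous (geoPath a b) := by
  unfold geoPath
  have h1 : Continuous fun t : ℝ => (Real.sinh t : ℂ) :=
    Complex.continuous_ofReal.comp Real.continuous_sinh
  have h2 : Continuous fun t : ℝ => (Real.cosh t : ℂ) :=
    Complex.continuous_ofReal.comp Real.continuous_cosh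
  fun_prop

/-- An orthonormal pair of signature `(1,1)`. -/
structure IsGeoPair (a b : Fin (n + 1) → ℂ) : Prop where
  pos : herm a a = 1
  neg : herm b b = -1
  orth : herm a b = 0

namespace IsGeoPair

variable {a b : Fin (n + 1) → ℂ}

lemma orth' (h : IsGeoPair a b) : herm b a = 0 := by rw [← herm_conj, h.orth, star_zero]

lemma herm_geoPath (h : IsGeoPair a b) (s t : ℝ) :
    herm (geoPath a b s) (geoPath a b t) = -(Real.cosh (t - s) : ℂ) := by
  simp only [geoPath, herm_add_left, herm_add_right, herm_smul_left, herm_smul_right, h.pos,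
    h.neg, h.orth, h.orth', Complex.star_def, Complex.conj_ofReal]
  rw [Real.cosh_sub]
  push_cast
  ring

lemma hq_geoPath (h : IsGeoPair a b) (t : ℝ) : BallPaper.hq (geoPath a b t) = -1 := by
  have h1 := herm_self (geoPath a b t)
  rw [h.herm_geoPath, sub_self, Real.cosh_zero] at h1
  have h2 : ((BallPaper.hq (geoPath a b t) : ℝ) : ℂ) = ((-1 : ℝ) : ℂ) := by
    rw [← h1]
    simp
  exact_mod_cast h2

lemma hq_geoPath_neg (h : IsGeoPair a b) (t : ℝ) : BallPaper.hq (geoPath a b t) < 0 := by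
  rw [h.hq_geoPath]; norm_num

lemma exists_cosh_le_norm_herm (h : IsGeoPair a b) {w : Fin (n + 1) → ℂ}
    (hw : BallPaper.hq w = -1) :
    ∃ t₀ : ℝ, ∀ t : ℝ, Real.cosh (t - t₀) ≤ ‖herm (geoPath a b t) w‖ := by
  have h1 := bessel_pair h.pos h.neg h.orth hw
  rw [norm_herm_comm w a, norm_herm_comm w b] at h1
  obtain ⟨t₀, ht⟩ := exists_cosh_le _ _ h1
  refine ⟨t₀, fun t => (ht t).trans_eq ?_⟩
  rw [geoPath, herm_add_left, herm_smul_left, herm_smul_left]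

lemma continuous_norm_ker (h : IsGeoPair a b) (N : ℕ) {w : Fin (n + 1) → ℂ}
    (hw : BallPaper.hq w = -1) : Continuous fun t => ‖ker N (geoPath a b t) w‖ := by
  simp only [norm_ker]
  have h1 : Continuous fun t => herm (geoPath a b t) w :=
    continuous_herm.comp ((continuous_geoPath a b).prodMk continuous_const)
  exact (h1.norm.inv₀ fun t => norm_ne_zero_iff.mpr
    (herm_ne_zero (by rw [hw]; norm_num) (h.hq_geoPath_neg t))).pow N

/-- Uniform bound for a single line of the energy integral. -/
lemma sqrt_mul_integral_norm_ker_le (h : IsGeoPair a b) {N M : ℕ} (hM : 2 * M ≤ N) (hN : 1 ≤ N)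
    {w : Fin (n + 1) → ℂ} (hw : BallPaper.hq w = -1) {L m : ℝ} (hm : 0 < m)
    (hmw : ∀ t ∈ Set.Ioc 0 L, m ≤ ‖herm (geoPath a b t) w‖) :
    √(N : ℝ) * ∫ t in Set.Ioc 0 L, ‖ker N (geoPath a b t) w‖ ≤ 2 * Real.pi * m⁻¹ ^ M := by
  obtain ⟨t₀, ht₀⟩ := h.exists_cosh_le_norm_herm hw
  have hpt : ∀ t ∈ Set.Ioc 0 L, ‖ker N (geoPath a b t) w‖ ≤
      (Real.cosh (t - t₀))⁻¹ ^ (N - M) * m⁻¹ ^ M := by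
    intro t ht
    rw [norm_ker, ← Nat.sub_add_cancel (show M ≤ N by omega), pow_add, Nat.add_sub_cancel]
    have h1 := ht₀ t
    have h2 := hmw t ht
    have h3 := Real.cosh_pos (t - t₀)
    gcongr
  have hc : Continuous fun t : ℝ => (Real.cosh (t - t₀))⁻¹ ^ (N - M) :=
    (continuous_sech_pow _).comp (continuous_id.sub continuous_const)
  have h1 : ∫ t in Set.Ioc 0 L, ‖ker N (geoPath a b t) w‖ ≤
      (∫ t in Set.Ioc 0 L, (Real.cosh (t - t₀))⁻¹ ^ (N - M)) * m⁻¹ ^ M := by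
    rw [← integral_mul_const]
    exact setIntegral_mono_on (h.continuous_norm_ker N hw).integrableOn_Ioc
      ((hc.mul continuous_const).integrableOn_Ioc) measurableSet_Ioc hpt
  have h2 := sqrt_mul_integral_sech_le (show 1 ≤ N - M by omega) t₀ L
  have h3 : √(N : ℝ) ≤ √2 * √((N - M : ℕ) : ℝ) := by
    rw [← Real.sqrt_mul (by norm_num)]
    refine Real.sqrt_le_sqrt ?_
    have : N ≤ 2 * (N - M) := by omega
    exact_mod_cast this
  have hI : 0 ≤ ∫ t in Set.Ioc 0 L, (Real.cosh (t - t₀))⁻¹ ^ (N - M) :=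
    integral_nonneg fun t => by have := Real.cosh_pos (t - t₀); positivity
  calc _ ≤ (√2 * √((N - M : ℕ) : ℝ)) *
        ((∫ t in Set.Ioc 0 L, (Real.cosh (t - t₀))⁻¹ ^ (N - M)) * m⁻¹ ^ M) := by gcongr
    _ = √2 * (√((N - M : ℕ) : ℝ) *
        ∫ t in Set.Ioc 0 L, (Real.cosh (t - t₀))⁻¹ ^ (N - M)) * m⁻¹ ^ M := by ring
    _ ≤ √2 * (√2 * Real.pi) * m⁻¹ ^ M := by gcongr
    _ = _ := by rw [← mul_assoc, Real.mul_self_sqrt (by norm_num)]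

lemma integrableOn_ker (h : IsGeoPair a b) (N : ℕ) (L : ℝ)
    {A : Matrix (Fin (n + 1)) (Fin (n + 1)) ℂ} (hA : IsU A) :
    IntegrableOn (fun p : ℝ × ℝ => ker N (geoPath a b p.2) (A *ᵥ geoPath a b p.1))
      (Set.Ioc 0 L ×ˢ Set.Ioc 0 L) := by
  have hg := continuous_geoPath a b
  have h1 : Continuous fun p : ℝ × ℝ => herm (geoPath a b p.2) (A *ᵥ geoPath a b p.1) :=
    continuous_herm.comp ((hg.comp continuous_snd).prodMk
      (show Continuous fun p : ℝ × ℝ => A *ᵥ geoPath a b p.1 by fun_prop))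
  have h2 : Continuous fun p : ℝ × ℝ => ker N (geoPath a b p.2) (A *ᵥ geoPath a b p.1) :=
    (h1.neg.inv₀ fun p => neg_ne_zero.mpr
      (herm_ne_zero (by rw [hA.hq]; exact h.hq_geoPath_neg _) (h.hq_geoPath_neg _))).pow N
  exact (h2.continuousOn.integrableOn_compact (isCompact_Icc.prod isCompact_Icc)).mono_set
    (Set.prod_mono Set.Ioc_subset_Icc_self Set.Ioc_subset_Icc_self)

lemma pathEnergy_eq (h : IsGeoPair a b) (N : ℕ) (L : ℝ)
    {A : Matrix (Fin (n + 1)) (Fin (n + 1)) ℂ} (hA : IsU A) :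
    pathEnergy N (geoPath a b) L A = ∫ s in Set.Ioc 0 L, ∫ t in Set.Ioc 0 L,
      ker N (geoPath a b t) (A *ᵥ geoPath a b s) :=
  setIntegral_prod _ (h.integrableOn_ker N L hA)

lemma norm_sqrt_mul_integral_le (N : ℕ) (w : Fin (n + 1) → ℂ) (L : ℝ) :
    ‖(√(N : ℝ) : ℂ) * ∫ t in Set.Ioc 0 L, ker N (geoPath a b t) w‖ ≤
      √(N : ℝ) * ∫ t in Set.Ioc 0 L, ‖ker N (geoPath a b t) w‖ := by
  rw [norm_mul, Complex.norm_of_nonneg (Real.sqrt_nonneg _)]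
  gcongr
  exact norm_integral_le_integral_norm _

lemma norm_sqrt_mul_integral_ker_le (h : IsGeoPair a b) {N : ℕ} (hN : 1 ≤ N)
    {w : Fin (n + 1) → ℂ} (hw : BallPaper.hq w = -1) (L : ℝ) :
    ‖(√(N : ℝ) : ℂ) * ∫ t in Set.Ioc 0 L, ker N (geoPath a b t) w‖ ≤ 2 * Real.pi := by
  refine (norm_sqrt_mul_integral_le N w L).trans ?_
  have := h.sqrt_mul_integral_norm_ker_le (M := 0) (by omega) hN hw (L := L) one_pos
    fun t _ => (one_le_norm_herm hw (h.hq_geoPath t)).1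
  simpa using this

/-- Bound for the energies, summable over the group. -/
lemma exists_energy_bound (h : IsGeoPair a b) {L : ℝ} (hL : 0 ≤ L) : ∃ c > 0,
    ∀ A : Matrix (Fin (n + 1)) (Fin (n + 1)) ℂ, IsU A → ∀ M N : ℕ, 2 * M ≤ N → 1 ≤ N →
    ‖(√(N : ℝ) : ℂ) * pathEnergy N (geoPath a b) L A‖ ≤
      L * (2 * Real.pi * c⁻¹ ^ M) * (height A)⁻¹ ^ M := by
  obtain ⟨c, hc, hcL⟩ := exists_gap_path (continuous_geoPath a b) h.hq_geoPath_neg L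
  refine ⟨c * c, by positivity, fun A hA M N hM hN => ?_⟩
  have hh : 0 < height A := one_pos.trans_le hA.one_le_last
  rw [h.pathEnergy_eq N L hA, ← integral_const_mul]
  have key : ∀ s ∈ Set.Ioc 0 L, ‖(√(N : ℝ) : ℂ) * ∫ t in Set.Ioc 0 L,
      ker N (geoPath a b t) (A *ᵥ geoPath a b s)‖ ≤ 2 * Real.pi * (c * c * height A)⁻¹ ^ M := by
    intro s hs
    refine (norm_sqrt_mul_integral_le N _ L).trans ?_
    refine h.sqrt_mul_integral_norm_ker_le hM hN (by rw [hA.hq, h.hq_geoPath]) (by positivity) ?_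
    intro t ht
    rw [norm_herm_comm]
    refine le_trans ?_ (hA.norm_herm_mulVec_ge (h.hq_geoPath_neg t) (h.hq_geoPath_neg s))
    have h1 := hcL t ht
    have h2 := hcL s hs
    change _ ≤ gap _ * gap _ * height A
    gcongr
    exact hc.le.trans h1
  refine (norm_setIntegral_le_of_norm_le_const (by simp) key).trans_eq ?_
  rw [Real.volume_real_Ioc_of_le hL, mul_inv, mul_pow]
  ring

lemma aestronglyMeasurable_inner (h : IsGeoPair a b) (N : ℕ) (L : ℝ)
    {A : Matrix (Fin (n + 1)) (Fin (n + 1)) ℂ} (hA : IsU A) :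
    AEStronglyMeasurable (fun s => (√(N : ℝ) : ℂ) * ∫ t in Set.Ioc 0 L,
      ker N (geoPath a b t) (A *ᵥ geoPath a b s)) (volume.restrict (Set.Ioc 0 L)) := by
  have h1 := h.integrableOn_ker N L hA
  rw [IntegrableOn, Measure.volume_eq_prod, ← Measure.prod_restrict] at h1
  exact (h1.integral_prod_left.aestronglyMeasurable).const_mul _

lemma tendsto_energy (h : IsGeoPair a b) (L : ℝ) {A : Matrix (Fin (n + 1)) (Fin (n + 1)) ℂ}
    (hA : IsU A) {l : ℝ}
    (hl : ∀ᵐ s ∂volume.restrict (Set.Ioc 0 L), Tendsto (fun N : ℕ => (√(N : ℝ) : ℂ) *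
      ∫ t in Set.Ioc 0 L, ker N (geoPath a b t) (A *ᵥ geoPath a b s)) atTop (𝓝 (l : ℂ))) :
    Tendsto (fun N : ℕ => (√(N : ℝ) : ℂ) * pathEnergy N (geoPath a b) L A) atTop
      (𝓝 (∫ _ in Set.Ioc 0 L, (l : ℂ))) := by
  rw [← tendsto_add_atTop_iff_nat 1]
  have heq : ∀ N : ℕ, (√(N : ℝ) : ℂ) * pathEnergy N (geoPath a b) L A =
      ∫ s in Set.Ioc 0 L, (√(N : ℝ) : ℂ) * ∫ t in Set.Ioc 0 L,
        ker N (geoPath a b t) (A *ᵥ geoPath a b s) := fun N => by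
    rw [h.pathEnergy_eq N L hA, ← integral_const_mul]
  simp only [heq]
  refine tendsto_integral_of_dominated_convergence (fun _ => 2 * Real.pi)
    (fun N => h.aestronglyMeasurable_inner (N + 1) L hA) (integrable_const _) ?_ ?_
  · exact fun N => Eventually.of_forall fun s =>
      h.norm_sqrt_mul_integral_ker_le (by omega) (by rw [hA.hq, h.hq_geoPath]) L
  · filter_upwards [hl] with s hs using (tendsto_add_atTop_iff_nat 1).mpr hs

lemma tendsto_energy_one (h : IsGeoPair a b) {L : ℝ} (hL : 0 ≤ L) :
    Tendsto (fun N : ℕ => (√(N : ℝ) : ℂ) * pathEnergy N (geoPath a b) L 1) atTop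
      (𝓝 ((L * √(2 * Real.pi) : ℝ) : ℂ)) := by
  have h1 := h.tendsto_energy L isU_one (l := √(2 * Real.pi)) (by
    rw [← Measure.restrict_congr_set (Ioo_ae_eq_Ioc (μ := volume) (a := (0 : ℝ)) (b := L))]
    filter_upwards [ae_restrict_mem measurableSet_Ioo] with s hs
    have h2 := (Complex.continuous_ofReal.tendsto _).comp (tendsto_sqrt_mul_integral_sech hs)
    refine h2.congr fun N => ?_
    rw [Function.comp_apply, Complex.ofReal_mul, ← integral_complex_ofReal]
    rw [Measure.restrict_congr_set (Ioo_ae_eq_Ioc (μ := volume) (a := (0 : ℝ)) (b := L))]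
    congr 1
    refine integral_congr_ae (Eventually.of_forall fun t => ?_)
    simp only [ker, Matrix.one_mulVec, h.herm_geoPath, neg_neg]
    rw [← neg_sub s t, Real.cosh_neg]
    push_cast
    rfl)
  refine h1.trans (le_of_eq ?_)
  rw [integral_const, MeasureTheory.measureReal_restrict_apply_univ, Real.volume_real_Ioc_of_le hL,
    sub_zero]
  simp

lemma tendsto_line_zero (h : IsGeoPair a b) (L : ℝ) {w : Fin (n + 1) → ℂ}
    (hw : BallPaper.hq w = -1) (hne : ∀ t ∈ Set.Icc 0 L, ∀ ζ : ℂ, w ≠ ζ • geoPath a b t) :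
    Tendsto (fun N : ℕ => (√(N : ℝ) : ℂ) * ∫ t in Set.Ioc 0 L, ker N (geoPath a b t) w) atTop
      (𝓝 0) := by
  rcases (Set.Icc (0 : ℝ) L).eq_empty_or_nonempty with he | hne'
  · have : Set.Ioc (0 : ℝ) L = ∅ := Set.subset_empty_iff.mp (he ▸ Set.Ioc_subset_Icc_self)
    simp [this]
  have hc : Continuous fun t => ‖herm (geoPath a b t) w‖ :=
    (continuous_herm.comp ((continuous_geoPath a b).prodMk continuous_const)).norm
  obtain ⟨t₁, ht₁, hmin⟩ := isCompact_Icc.exists_isMinOn hne' hc.continuousOn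
  set m := ‖herm (geoPath a b t₁) w‖ with hm
  have hm1 : 1 < m := by
    obtain ⟨h1, h2⟩ := one_le_norm_herm (h.hq_geoPath t₁) hw
    rw [norm_herm_comm] at h1 h2
    refine lt_of_le_of_ne h1 fun he => ?_
    exact hne t₁ ht₁ _ (h2 he.symm)
  have hbound : ∀ N : ℕ, ‖(√(N : ℝ) : ℂ) * ∫ t in Set.Ioc 0 L, ker N (geoPath a b t) w‖ ≤
      (N : ℝ) * m⁻¹ ^ N * volume.real (Set.Ioc 0 L) := by
    intro N
    have h1 : ‖∫ t in Set.Ioc 0 L, ker N (geoPath a b t) w‖ ≤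
        m⁻¹ ^ N * volume.real (Set.Ioc 0 L) :=
      norm_setIntegral_le_of_norm_le_const (by simp) fun t ht =>
        norm_ker_le_of_le N (by linarith) (hmin (Set.Ioc_subset_Icc_self ht))
    have h2 : √(N : ℝ) ≤ N := by
      refine Real.sqrt_le_iff.mpr ⟨by positivity, ?_⟩
      rcases Nat.eq_zero_or_pos N with rfl | hN
      · simp
      · have : (1 : ℝ) ≤ N := by exact_mod_cast hN
        nlinarith
    rw [norm_mul, Complex.norm_of_nonneg (Real.sqrt_nonneg _), mul_assoc]
    exact mul_le_mul h2 h1 (norm_nonneg _) (by positivity)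
  refine squeeze_zero_norm hbound ?_
  have := (tendsto_self_mul_const_pow_of_lt_one (r := m⁻¹) (by positivity)
    (inv_lt_one_of_one_lt₀ hm1)).mul_const (volume.real (Set.Ioc 0 L))
  simpa using this

lemma tendsto_energy_zero (h : IsGeoPair a b) (L : ℝ)
    {A : Matrix (Fin (n + 1)) (Fin (n + 1)) ℂ} (hA : IsU A)
    (hs : {s ∈ Set.Ioc 0 L | ∃ t ∈ Set.Icc 0 L, ∃ ζ : ℂ,
      A *ᵥ geoPath a b s = ζ • geoPath a b t}.Subsingleton) :
    Tendsto (fun N : ℕ => (√(N : ℝ) : ℂ) * pathEnergy N (geoPath a b) L A) atTop (𝓝 0) := by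
  have h1 := h.tendsto_energy L hA (l := 0) (by
    have hnull := hs.measure_zero volume
    filter_upwards [ae_restrict_mem measurableSet_Ioc,
      ae_restrict_of_ae (compl_mem_ae_iff.mpr hnull)] with s hs hs'
    rw [Complex.ofReal_zero]
    refine h.tendsto_line_zero L (by rw [hA.hq, h.hq_geoPath])
      fun t ht ζ he => hs' ⟨hs, t, ht, ζ, he⟩)
  simpa using h1

/-- The asymptotics of the sum of all energies. -/
theorem tendsto_tsum_energy (h : IsGeoPair a b) (G : DiscreteGroup n) {L : ℝ} (hL : 0 ≤ L)
    (hs : ∀ A ∈ G.Γ, A ≠ 1 → {s ∈ Set.Ioc 0 L | ∃ t ∈ Set.Icc 0 L, ∃ ζ : ℂ,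
      A *ᵥ geoPath a b s = ζ • geoPath a b t}.Subsingleton) :
    Tendsto (fun N : ℕ => (√(N : ℝ) : ℂ) * ∑' A : ↥G.Γ, pathEnergy N (geoPath a b) L A.1) atTop
      (𝓝 ((L * √(2 * Real.pi) : ℝ) : ℂ)) := by
  classical
  obtain ⟨M, hM⟩ := G.exists_summable
  obtain ⟨c, hc, hbound⟩ := h.exists_energy_bound hL
  have key := tendsto_tsum_of_dominated_convergence
    (f := fun (N : ℕ) (A : ↥G.Γ) => (√(N : ℝ) : ℂ) * pathEnergy N (geoPath a b) L A.1)
    (g := fun A : ↥G.Γ => if A = ⟨1, G.one_mem⟩ then ((L * √(2 * Real.pi) : ℝ) : ℂ) else 0)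
    (𝓕 := atTop) (hM.mul_left (L * (2 * Real.pi * c⁻¹ ^ M))) ?_ ?_
  · rw [tsum_ite_eq] at key
    exact key.congr fun N => tsum_mul_left
  · intro A
    split_ifs with hA
    · subst hA
      exact h.tendsto_energy_one hL
    · exact h.tendsto_energy_zero L (G.isU A.2) (hs A.1 A.2 fun h1 => hA (Subtype.ext h1))
  · filter_upwards [eventually_ge_atTop (2 * M + 1)] with N hN A
    exact hbound A.1 (G.isU A.2) M N (by omega) (by omega)

end IsGeoPair

end Energy

section Translations

variable {n : ℕ} {G : DiscreteGroup n}

/-- The ball point of a negative vector. -/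
lemma exists_snoc1_eq {v : Fin (n + 1) → ℂ} (hv : hq v < 0) :
    ∃ z ∈ ball n, v = v (Fin.last n) • snoc1 z := by
  have hl := last_ne_zero_of_hq_neg hv
  refine ⟨fun i => (v (Fin.last n))⁻¹ * v i.castSucc, ?_, ?_⟩
  · have heq : v = v (Fin.last n) • snoc1 fun i => (v (Fin.last n))⁻¹ * v i.castSucc := by
      funext i
      refine Fin.lastCases ?_ (fun i => ?_) i
      · simp
      · simp [mul_inv_cancel_left₀ hl]
    rw [heq, hq_smul, hq_snoc1'] at hv
    rw [mem_ball_iff]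
    by_contra! h
    have := sq_nonneg ‖v (Fin.last n)‖
    nlinarith
  · funext i
    refine Fin.lastCases ?_ (fun i => ?_) i
    · simp
    · simp [mul_inv_cancel_left₀ hl]

lemma DiscreteGroup.eq_one_of_mulVec {A : Matrix (Fin (n + 1)) (Fin (n + 1)) ℂ} (hA : A ∈ G.Γ)
    {v : Fin (n + 1) → ℂ} (hv : hq v < 0) {c : ℂ} (h : A *ᵥ v = c • v) : A = 1 := by
  obtain ⟨z, hz, hvz⟩ := exists_snoc1_eq hv
  have hl := last_ne_zero_of_hq_neg hv
  set l := v (Fin.last n)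
  have hc : c ≠ 0 := by
    rintro rfl
    have h1 := (G.isU hA).hq v
    rw [h, zero_smul] at h1
    have h2 : BallPaper.hq (0 : Fin (n + 1) → ℂ) = 0 := by simp [BallPaper.hq]
    linarith
  refine G.free A hA ⟨z, hz, act_eq_of_mulVec hc ?_⟩
  have h3 : l • (A *ᵥ snoc1 z) = l • (c • snoc1 z) := by
    rw [← Matrix.mulVec_smul, ← hvz, h, smul_comm, ← hvz]
  exact smul_right_injective _ hl h3

lemma DiscreteGroup.finite_height_le (G : DiscreteGroup n) (R : ℝ) :
    {A : ↥G.Γ | height A.1 ≤ R}.Finite := by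
  obtain ⟨M, hM⟩ := G.exists_summable
  rcases le_or_gt R 0 with hR | hR
  · convert Set.finite_empty
    ext A
    simp only [Set.mem_ofPred_eq, Set.mem_empty_iff_false, iff_false, not_le]
    exact hR.trans_lt (one_pos.trans_le (G.isU A.2).one_le_last)
  · have h := hM.tendsto_cofinite_zero.eventually (gt_mem_nhds (show 0 < R⁻¹ ^ M by positivity))
    refine (Filter.eventually_cofinite.mp h).subset fun A hA => ?_
    have hh : 0 < height A.1 := one_pos.trans_le (G.isU A.2).one_le_last
    simp only [Set.mem_ofPred_eq, not_lt] at hA ⊢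
    gcongr

namespace IsGeoPair

variable {a b : Fin (n + 1) → ℂ}

lemma norm_eq_one (h : IsGeoPair a b) {A : Matrix (Fin (n + 1)) (Fin (n + 1)) ℂ} (hA : IsU A)
    {s t : ℝ} {ζ : ℂ} (he : A *ᵥ geoPath a b s = ζ • geoPath a b t) : ‖ζ‖ = 1 := by
  have h1 := hA.hq (geoPath a b s)
  rw [he, hq_smul, h.hq_geoPath, h.hq_geoPath] at h1
  have h2 : ‖ζ‖ ^ 2 = 1 := by linarith
  exact (pow_eq_one_iff_of_nonneg (norm_nonneg ζ) two_ne_zero).mp h2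

/-- The translation lengths along a geodesic form a group. -/
def translations (h : IsGeoPair a b) (G : DiscreteGroup n) : AddSubgroup ℝ where
  carrier := {τ | ∃ A ∈ G.Γ, ∃ ζ : ℂ, ∀ s, A *ᵥ geoPath a b s = ζ • geoPath a b (s + τ)}
  zero_mem' := ⟨1, G.one_mem, 1, fun s => by simp⟩
  add_mem' := by
    rintro x y ⟨A, hA, ζ, h1⟩ ⟨B, hB, ξ, h2⟩
    refine ⟨B * A, G.mul_mem hB hA, ζ * ξ, fun s => ?_⟩
    rw [← Matrix.mulVec_mulVec, h1, Matrix.mulVec_smul, h2, smul_smul, add_assoc]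
  neg_mem' := by
    rintro x ⟨A, hA, ζ, h1⟩
    have hU := G.isU hA
    have hζ : ζ ≠ 0 := norm_ne_zero_iff.mp (by rw [h.norm_eq_one hU (h1 0)]; norm_num)
    refine ⟨A⁻¹, G.inv_mem hA, ζ⁻¹, fun s => ?_⟩
    have h2 := h1 (s + -x)
    rw [neg_add_cancel_right] at h2
    have h3 := congrArg (fun v => ζ⁻¹ • (A⁻¹ *ᵥ v)) h2
    simp only [Matrix.mulVec_mulVec, hU.inv_mul_cancel, Matrix.one_mulVec, Matrix.mulVec_smul,
      smul_smul, inv_mul_cancel₀ hζ, one_smul] at h3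
    exact h3.symm

lemma exists_disjoint_translations (h : IsGeoPair a b) (G : DiscreteGroup n) :
    ∃ ε > 0, Disjoint (h.translations G : Set ℝ) (Set.Ioo 0 ε) := by
  set S : Set ℝ := (h.translations G : Set ℝ) ∩ Set.Ioo 0 1 with hS
  have hfin : S.Finite := by
    set c := gap (geoPath a b 0) with hc
    have hc0 : 0 < c := gap_pos (h.hq_geoPath_neg 0)
    have hf := G.finite_height_le (Real.cosh 1 / (c * c))
    refine (hf.image fun A : ↥G.Γ =>
      Real.arcosh ‖herm (A.1 *ᵥ geoPath a b 0) (geoPath a b 0)‖).subset ?_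
    rintro τ ⟨⟨A, hA, ζ, h1⟩, hτ0, hτ1⟩
    have hU := G.isU hA
    have h2 : ‖herm (A *ᵥ geoPath a b 0) (geoPath a b 0)‖ = Real.cosh τ := by
      rw [h1, herm_smul_left, h.herm_geoPath, norm_mul, h.norm_eq_one hU (h1 0), norm_neg,
        Complex.norm_of_nonneg (Real.cosh_pos _).le, one_mul]
      simp
    refine ⟨⟨A, hA⟩, ?_, ?_⟩
    · have h3 := hU.norm_herm_mulVec_ge (h.hq_geoPath_neg 0) (h.hq_geoPath_neg 0)
      rw [h2] at h3
      have h4 : Real.cosh τ ≤ Real.cosh 1 := by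
        rw [Real.cosh_le_cosh, abs_of_pos hτ0, abs_one]
        exact hτ1.le
      change height A ≤ _
      rw [le_div_iff₀ (by positivity), mul_comm]
      exact h3.trans h4
    · simp only [h2]
      exact Real.arcosh_cosh hτ0.le
  rcases S.eq_empty_or_nonempty with he | hne
  · exact ⟨1, one_pos, Set.disjoint_iff_inter_eq_empty.mpr he⟩
  · obtain ⟨ε, hε, hmin⟩ := Set.exists_min_image S id hfin hne
    refine ⟨ε, hε.2.1, Set.disjoint_left.mpr fun τ hτ hτ' => ?_⟩
    exact absurd (hmin τ ⟨hτ, hτ'.1, hτ'.2.trans hε.2.2⟩) (not_le.mpr hτ'.2)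

lemma pow_mulVec {A : Matrix (Fin (n + 1)) (Fin (n + 1)) ℂ} {ζ : ℂ} {τ : ℝ}
    (h1 : ∀ s, A *ᵥ geoPath a b s = ζ • geoPath a b (s + τ)) (m : ℕ) (s : ℝ) :
    (A ^ m) *ᵥ geoPath a b s = ζ ^ m • geoPath a b (s + m * τ) := by
  induction m generalizing s with
  | zero => simp
  | succ m ih =>
    rw [pow_succ, ← Matrix.mulVec_mulVec, h1, Matrix.mulVec_smul, ih, smul_smul, pow_succ',
      add_assoc]
    congr 2
    push_cast
    ring

lemma pow_mem {A : Matrix (Fin (n + 1)) (Fin (n + 1)) ℂ} (hA : A ∈ G.Γ) (m : ℕ) :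
    A ^ m ∈ G.Γ := by
  induction m with
  | zero => simpa using G.one_mem
  | succ m ih => rw [pow_succ]; exact G.mul_mem ih hA

/-- A primitive translation has the least translation length. -/
lemma not_mem_translations (h : IsGeoPair a b) {γ : Matrix (Fin (n + 1)) (Fin (n + 1)) ℂ}
    (hγ : γ ∈ G.Γ) {L : ℝ} {ζ₀ : ℂ}
    (hγL : ∀ s, γ *ᵥ geoPath a b s = ζ₀ • geoPath a b (s + L))
    (hprim : ∀ A ∈ G.Γ, ∀ m : ℕ, 2 ≤ m → A ^ m ≠ γ) {τ : ℝ} (hτ0 : τ ≠ 0) (hτL : |τ| < L) :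
    τ ∉ h.translations G := by
  intro hτ
  have hLmem : L ∈ h.translations G := ⟨γ, hγ, ζ₀, hγL⟩
  obtain ⟨ε, hε, hdisj⟩ := h.exists_disjoint_translations G
  obtain ⟨x, hx⟩ := AddSubgroup.cyclic_of_isolated_zero hε hdisj
  have hxm : x ∈ h.translations G := by
    rw [hx]
    exact AddSubgroup.mem_closure_singleton_self x
  have hτ' := hτ
  rw [hx, AddSubgroup.mem_closure_singleton] at hτ' hLmem
  obtain ⟨k, rfl⟩ := hτ'
  obtain ⟨m, hm⟩ := hLmem
  have hL0 : 0 < L := (abs_nonneg _).trans_lt hτL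
  have hk : 1 ≤ |k| := Int.one_le_abs (by rintro rfl; simp at hτ0)
  have hx0 : x ≠ 0 := by rintro rfl; simp at hτ0
  have hmk : |k| < |m| := by
    rw [← abs_of_pos hL0, ← hm, zsmul_eq_mul, zsmul_eq_mul, abs_mul, abs_mul] at hτL
    have h1 := lt_of_mul_lt_mul_right hτL (abs_nonneg x)
    exact_mod_cast h1
  obtain ⟨y, hy, hyL⟩ : ∃ y ∈ h.translations G, (m.natAbs : ℝ) * y = L := by
    rcases Int.natAbs_eq m with hm' | hm'
    · refine ⟨x, hxm, ?_⟩
      rw [← hm, zsmul_eq_mul]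
      congr 1
      rw [← Int.cast_natCast, ← hm']
    · refine ⟨-x, neg_mem hxm, ?_⟩
      rw [← hm, zsmul_eq_mul, mul_neg, ← neg_mul]
      congr 1
      rw [← Int.cast_natCast, ← Int.cast_neg, ← hm']
  obtain ⟨A, hA, ζ, h1⟩ := hy
  have hpow := pow_mulVec h1 m.natAbs 0
  rw [hyL] at hpow
  refine hprim A hA m.natAbs (by simp only [Int.abs_eq_natAbs] at hk hmk; omega) ?_
  have hγU := G.isU hγ
  have hζ₀ : ζ₀ ≠ 0 := norm_ne_zero_iff.mp (by rw [h.norm_eq_one hγU (hγL 0)]; norm_num)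
  have h3 : geoPath a b (0 + L) = ζ₀⁻¹ • (γ *ᵥ geoPath a b 0) := by
    rw [hγL, smul_smul, inv_mul_cancel₀ hζ₀, one_smul]
  have h2 : (γ⁻¹ * A ^ m.natAbs) *ᵥ geoPath a b 0 =
      (ζ ^ m.natAbs * ζ₀⁻¹) • geoPath a b 0 := by
    rw [← Matrix.mulVec_mulVec, hpow, h3, Matrix.mulVec_smul, Matrix.mulVec_smul,
      Matrix.mulVec_mulVec, hγU.inv_mul_cancel, Matrix.one_mulVec, smul_smul]
  have h4 := G.eq_one_of_mulVec (G.mul_mem (G.inv_mem hγ) (pow_mem hA _)) (h.hq_geoPath_neg 0) h2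
  have h5 := congrArg (γ * ·) h4
  simpa only [← mul_assoc, hγU.mul_inv_cancel, one_mul, mul_one] using h5

lemma sinh_smul_geoPath (s₁ s₂ s : ℝ) :
    (Real.sinh (s₂ - s₁) : ℂ) • geoPath a b s = (Real.sinh (s₂ - s) : ℂ) • geoPath a b s₁ +
      (Real.sinh (s - s₁) : ℂ) • geoPath a b s₂ := by
  simp only [geoPath, smul_add, smul_smul]
  have h1 : Real.sinh (s₂ - s₁) * Real.sinh s =
      Real.sinh (s₂ - s) * Real.sinh s₁ + Real.sinh (s - s₁) * Real.sinh s₂ := by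
    simp only [Real.sinh_sub]; ring
  have h2 : Real.sinh (s₂ - s₁) * Real.cosh s =
      Real.sinh (s₂ - s) * Real.cosh s₁ + Real.sinh (s - s₁) * Real.cosh s₂ := by
    simp only [Real.sinh_sub]; ring
  have h1' := congrArg (fun x : ℝ => (x : ℂ)) h1
  have h2' := congrArg (fun x : ℝ => (x : ℂ)) h2
  push_cast at h1' h2' ⊢
  rw [h1', h2', add_smul, add_smul]
  abel

/-- An isometry matching two points of a geodesic with two points of it preserves it. -/
lemma exists_mulVec_geoPath (h : IsGeoPair a b) {A : Matrix (Fin (n + 1)) (Fin (n + 1)) ℂ}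
    (hA : IsU A) {s₁ s₂ t₁ t₂ : ℝ} (hs : s₁ ≠ s₂) {ζ₁ ζ₂ : ℂ}
    (h1 : A *ᵥ geoPath a b s₁ = ζ₁ • geoPath a b t₁)
    (h2 : A *ᵥ geoPath a b s₂ = ζ₂ • geoPath a b t₂) :
    (t₂ - t₁ = s₂ - s₁ ∧ ∀ s, A *ᵥ geoPath a b s = ζ₁ • geoPath a b (s + (t₁ - s₁))) ∨
      (∀ s, A *ᵥ geoPath a b s = ζ₁ • geoPath a b (t₁ + s₁ - s)) := by
  have n1 := h.norm_eq_one hA h1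
  have n2 := h.norm_eq_one hA h2
  have h3 := hA (geoPath a b s₁) (geoPath a b s₂)
  rw [h1, h2, herm_smul_left, herm_smul_right, h.herm_geoPath, h.herm_geoPath] at h3
  have hcosh : Real.cosh (t₂ - t₁) = Real.cosh (s₂ - s₁) := by
    have h4 := congrArg norm h3
    rw [norm_mul, norm_mul, norm_star, n1, n2, norm_neg, norm_neg,
      Complex.norm_of_nonneg (Real.cosh_pos _).le,
      Complex.norm_of_nonneg (Real.cosh_pos _).le, one_mul, one_mul] at h4
    exact h4
  have hζ : ζ₁ = ζ₂ := by
    rw [hcosh] at h3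
    have hc : -(Real.cosh (s₂ - s₁) : ℂ) ≠ 0 :=
      neg_ne_zero.mpr (Complex.ofReal_ne_zero.mpr (Real.cosh_pos _).ne')
    rw [← mul_assoc] at h3
    have h5 : ζ₁ * star ζ₂ = 1 := mul_right_cancel₀ hc (h3.trans (one_mul _).symm)
    have h6 : star ζ₂ * ζ₂ = 1 := by
      rw [Complex.star_def, Complex.conj_mul', n2]; simp
    calc ζ₁ = ζ₁ * (star ζ₂ * ζ₂) := by rw [h6, mul_one]
      _ = ζ₂ := by rw [← mul_assoc, h5, one_mul]
  subst hζ
  have habs : |t₂ - t₁| = |s₂ - s₁| :=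
    le_antisymm (Real.cosh_le_cosh.mp hcosh.le) (Real.cosh_le_cosh.mp hcosh.ge)
  have hsinh : (Real.sinh (s₂ - s₁) : ℂ) ≠ 0 := by
    rw [Complex.ofReal_ne_zero, Real.sinh_ne_zero]
    exact sub_ne_zero.mpr hs.symm
  have key : ∀ s, (Real.sinh (s₂ - s₁) : ℂ) • (A *ᵥ geoPath a b s) = ζ₁ •
      ((Real.sinh (s₂ - s) : ℂ) • geoPath a b t₁ + (Real.sinh (s - s₁) : ℂ) • geoPath a b t₂) := by
    intro s
    rw [← Matrix.mulVec_smul, sinh_smul_geoPath s₁ s₂ s, Matrix.mulVec_add, Matrix.mulVec_smul,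
      Matrix.mulVec_smul, h1, h2, smul_add, smul_comm ζ₁, smul_comm ζ₁]
  rcases abs_eq_abs.mp habs with ht | ht
  · refine Or.inl ⟨ht, fun s => smul_right_injective _ hsinh ?_⟩
    have e := sinh_smul_geoPath (a := a) (b := b) t₁ t₂ (s + (t₁ - s₁))
    rw [ht, show t₂ - (s + (t₁ - s₁)) = s₂ - s by linarith,
      show s + (t₁ - s₁) - t₁ = s - s₁ by ring] at e
    change _ • _ = _ • _
    rw [key, ← e, smul_comm]
  · refine Or.inr fun s => smul_right_injective _ hsinh ?_
    have e := sinh_smul_geoPath (a := a) (b := b) t₁ t₂ (t₁ + s₁ - s)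
    rw [ht, show t₂ - (t₁ + s₁ - s) = -(s₂ - s) by linarith,
      show t₁ + s₁ - s - t₁ = -(s - s₁) by ring, Real.sinh_neg, Real.sinh_neg, Real.sinh_neg] at e
    push_cast at e
    rw [neg_smul, neg_smul, neg_smul, ← neg_add, neg_inj] at e
    have hk := key s
    push_cast at hk ⊢
    change _ • _ = _ • _
    rw [hk, ← e, smul_comm]

/-- Within a period, a nontrivial group element matches at most one point of the geodesic. -/
lemma subsingleton_matches (h : IsGeoPair a b) {γ : Matrix (Fin (n + 1)) (Fin (n + 1)) ℂ}
    (hγ : γ ∈ G.Γ) {L : ℝ} {ζ₀ : ℂ}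
    (hγL : ∀ s, γ *ᵥ geoPath a b s = ζ₀ • geoPath a b (s + L))
    (hprim : ∀ A ∈ G.Γ, ∀ m : ℕ, 2 ≤ m → A ^ m ≠ γ)
    {A : Matrix (Fin (n + 1)) (Fin (n + 1)) ℂ} (hA : A ∈ G.Γ) (hA1 : A ≠ 1) :
    {s ∈ Set.Ioc 0 L | ∃ t ∈ Set.Icc 0 L, ∃ ζ : ℂ,
      A *ᵥ geoPath a b s = ζ • geoPath a b t}.Subsingleton := by
  rintro s₁ ⟨hs₁, t₁, ht₁, ζ₁, h1⟩ s₂ ⟨hs₂, t₂, ht₂, ζ₂, h2⟩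
  by_contra hne
  rcases h.exists_mulVec_geoPath (G.isU hA) hne h1 h2 with ⟨ht, h3⟩ | h3
  · rcases eq_or_ne (t₁ - s₁) 0 with h0 | h0
    · exact hA1 (G.eq_one_of_mulVec hA (h.hq_geoPath_neg 0) (by simpa [h0] using h3 0))
    · refine h.not_mem_translations hγ hγL hprim h0 ?_ ⟨A, hA, ζ₁, h3⟩
      have a1 := hs₁.1
      have a2 := hs₁.2
      have a3 := hs₂.2
      have a4 := ht₁.1
      have a5 := ht₁.2
      have a6 := ht₂.1
      rw [abs_lt]
      refine ⟨?_, by linarith⟩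
      by_contra! hc
      apply hne
      linarith
  · refine hA1 (G.eq_one_of_mulVec hA (h.hq_geoPath_neg ((t₁ + s₁) / 2)) (c := ζ₁) ?_)
    rw [h3]
    congr 2
    ring

end IsGeoPair

end Translations

section ClosedGeodesic

variable {n : ℕ} {G : DiscreteGroup n}

lemma isU_of_herm_col {A : Matrix (Fin (n + 1)) (Fin (n + 1)) ℂ}
    (h : ∀ i j, herm (A.col j) (A.col i) = sigmaM n i j) : IsU A := by
  have h1 : Aᴴ * sigmaM n * A = sigmaM n := by
    ext i j
    rw [← h i j, herm_eq_dotProduct, Matrix.mul_assoc, Matrix.mul_apply']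
    congr 1
  intro u v
  rw [herm_eq_dotProduct, herm_eq_dotProduct, star_mulVec, ← dotProduct_mulVec, mulVec_mulVec,
    mulVec_mulVec, h1]

lemma pair_self (z : Fin n → ℂ) : pair z z = -(defect z : ℂ) := by
  rw [← herm_snoc1, herm_self, hq_snoc1']
  push_cast
  rfl

lemma arcosh_cosh {x : ℝ} (hx : 0 ≤ x) : arcosh (Real.cosh x) = x := by
  rw [arcosh, ← Real.sinh_sq, Real.sqrt_sq (Real.sinh_nonneg_iff.mpr hx), Real.cosh_add_sinh,
    Real.log_exp]

namespace HypElt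

variable (H : HypElt n G)

/-- The real number `⟨X,Y⟩`. -/
noncomputable def r : ℝ := (pair H.X H.Y).re

/-- The translation length of `γ` along `geoPath`. -/
noncomputable def len : ℝ := Real.log |H.lam|

/-- The positive vector tangent to the axis of `γ`. -/
noncomputable def a : Fin (n + 1) → ℂ :=
  (pair H.X H.Y)⁻¹ • snoc1 H.X + (2 : ℂ)⁻¹ • snoc1 H.Y

/-- The negative vector over the base point of the axis of `γ`. -/
noncomputable def b : Fin (n + 1) → ℂ :=
  (pair H.X H.Y)⁻¹ • snoc1 H.X - (2 : ℂ)⁻¹ • snoc1 H.Y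

lemma pair_eq_r : pair H.X H.Y = (H.r : ℂ) := by
  apply Complex.ext
  · rfl
  · simp [pair, H.X_real, H.Y_real]

lemma one_lt_abs_lam : 1 < |H.lam| := (one_lt_sq_iff_one_lt_abs _).mp H.lam_sq

lemma lam_ne_zero : H.lam ≠ 0 := abs_pos.mp (one_pos.trans H.one_lt_abs_lam)

lemma len_pos : 0 < H.len := Real.log_pos H.one_lt_abs_lam

lemma X_ne_Y : H.X ≠ H.Y := by
  intro h
  have h1 := H.eigX
  rw [h, H.eigY] at h1
  have h2 := congrFun h1 (Fin.last n)
  simp only [Pi.smul_apply, snoc1_last, smul_eq_mul, mul_one] at h2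
  have h3 : H.lam⁻¹ = H.lam := by exact_mod_cast h2
  have h4 := H.lam_sq
  have h5 := mul_inv_cancel₀ H.lam_ne_zero
  rw [h3] at h5
  nlinarith

lemma r_neg : H.r < 0 := by
  obtain ⟨i, hi⟩ := Function.ne_iff.mp H.X_ne_Y
  have h1 : ∑ i, ‖H.X i - H.Y i‖ ^ 2 = -2 * H.r := by
    have h2 : ∀ i, ‖H.X i - H.Y i‖ ^ 2 =
        ‖H.X i‖ ^ 2 + ‖H.Y i‖ ^ 2 - 2 * (H.X i * star (H.Y i)).re := by
      intro i
      simp only [← Complex.normSq_eq_norm_sq]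
      exact Complex.normSq_sub _ _
    simp only [h2, Finset.sum_sub_distrib, Finset.sum_add_distrib, H.X_bd, H.Y_bd,
      ← Finset.mul_sum, r, pair, Complex.sub_re, Complex.re_sum, Complex.one_re]
    ring
  have h3 : 0 < ∑ i, ‖H.X i - H.Y i‖ ^ 2 :=
    Finset.sum_pos' (fun _ _ => by positivity)
      ⟨i, Finset.mem_univ i, by have := norm_pos_iff.mpr (sub_ne_zero.mpr hi); positivity⟩
  linarith

lemma r_ne_zero : (H.r : ℂ) ≠ 0 := Complex.ofReal_ne_zero.mpr H.r_neg.ne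

lemma herm_X_X : herm (snoc1 H.X) (snoc1 H.X) = 0 := by
  rw [herm_snoc1, pair_self, defect, H.X_bd]; simp

lemma herm_Y_Y : herm (snoc1 H.Y) (snoc1 H.Y) = 0 := by
  rw [herm_snoc1, pair_self, defect, H.Y_bd]; simp

lemma herm_X_Y : herm (snoc1 H.X) (snoc1 H.Y) = (H.r : ℂ) := by
  rw [herm_snoc1, H.pair_eq_r]

lemma herm_Y_X : herm (snoc1 H.Y) (snoc1 H.X) = (H.r : ℂ) := by
  rw [← herm_conj, H.herm_X_Y, Complex.star_def, Complex.conj_ofReal]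

lemma isGeoPair : IsGeoPair H.a H.b := by
  have h := H.r_ne_zero
  constructor <;>
  · simp only [a, b, herm_add_left, herm_add_right, herm_sub_left, herm_sub_right,
      herm_smul_left, herm_smul_right, H.herm_X_X, H.herm_Y_Y, H.herm_X_Y, H.herm_Y_X,
      H.pair_eq_r, Complex.star_def, map_inv₀, Complex.conj_ofReal, Complex.conj_ofNat]
    field_simp
    try ring

lemma geoPath_eq (t : ℝ) : geoPath H.a H.b t =
    ((Real.exp t : ℂ) * (pair H.X H.Y)⁻¹) • snoc1 H.X -
      ((Real.exp (-t) : ℂ) * (2 : ℂ)⁻¹) • snoc1 H.Y := by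
  rw [← Real.cosh_add_sinh, ← Real.cosh_sub_sinh, geoPath, a, b]
  push_cast
  module

/-- The sign of `λ`. -/
noncomputable def sgn : ℂ := (SignType.sign H.lam : ℝ)

lemma lam_eq : (H.lam : ℂ) = H.sgn * (Real.exp H.len : ℂ) := by
  rw [sgn, len, Real.exp_log (abs_pos.mpr H.lam_ne_zero), ← Complex.ofReal_mul, sign_mul_abs]

lemma sgn_mul_self : H.sgn * H.sgn = 1 := by
  rw [sgn, ← Complex.ofReal_mul]
  rcases lt_or_gt_of_ne H.lam_ne_zero with h | h <;> simp [h]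

lemma mulVec_geoPath (s : ℝ) :
    H.γ *ᵥ geoPath H.a H.b s = H.sgn • geoPath H.a H.b (s + H.len) := by
  have h1 : (H.lam : ℂ)⁻¹ = H.sgn * (Real.exp (-H.len) : ℂ) := by
    rw [H.lam_eq, mul_inv, inv_eq_of_mul_eq_one_left H.sgn_mul_self, Real.exp_neg]
    push_cast
    rfl
  rw [H.geoPath_eq, H.geoPath_eq, Matrix.mulVec_sub, Matrix.mulVec_smul, Matrix.mulVec_smul,
    H.eigX, H.eigY, h1, H.lam_eq, neg_add, Real.exp_add, Real.exp_add]
  push_cast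
  module

lemma herm_v_eq_zero (j : Fin (n - 1)) {μ : ℝ} (hμ : μ ^ 2 ≠ 1) {w : Fin (n + 1) → ℂ}
    (hw : H.γ *ᵥ w = (μ : ℂ) • w) : herm (H.v j) w = 0 := by
  have h1 := (G.isU H.mem) (H.v j) w
  rw [H.v_eig, hw, herm_smul_left, herm_smul_right, Complex.star_def, Complex.conj_ofReal,
    ← mul_assoc] at h1
  by_contra h0
  have h2 : H.alph j * (μ : ℂ) = 1 := mul_right_cancel₀ h0 (h1.trans (one_mul _).symm)
  have h3 : H.alph j ^ 2 = 1 := by rcases H.alph_pm j with h | h <;> simp [h]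
  have h4 : (μ : ℂ) ^ 2 = 1 := by
    have h5 := congrArg (· ^ 2) h2
    simpa [mul_pow, h3] using h5
  exact hμ (by exact_mod_cast h4)

lemma herm_v_X (j : Fin (n - 1)) : herm (H.v j) (snoc1 H.X) = 0 :=
  H.herm_v_eq_zero j H.lam_sq.ne' H.eigX

lemma herm_v_Y (j : Fin (n - 1)) : herm (H.v j) (snoc1 H.Y) = 0 := by
  refine H.herm_v_eq_zero (μ := H.lam⁻¹) j ?_ (by rw [H.eigY]; push_cast; rfl)
  rw [inv_pow]
  exact (inv_lt_one_of_one_lt₀ H.lam_sq).ne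

lemma herm_v_a (j : Fin (n - 1)) : herm (H.v j) H.a = 0 := by
  rw [a, herm_add_right, herm_smul_right, herm_smul_right, H.herm_v_X, H.herm_v_Y]
  simp

lemma herm_v_b (j : Fin (n - 1)) : herm (H.v j) H.b = 0 := by
  rw [b, herm_sub_right, herm_smul_right, herm_smul_right, H.herm_v_X, H.herm_v_Y]
  simp

lemma A_col_of_lt {j : Fin (n + 1)} (hj : (j : ℕ) < n - 1) : H.A.col j = H.v ⟨j, hj⟩ := by
  funext i
  simp [A, Amat, hj]

lemma A_col_of_eq {j : Fin (n + 1)} (hj : (j : ℕ) = n - 1) : H.A.col j = H.a := by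
  funext i
  simp [A, Amat, hj, a]

lemma A_col_last (hn : 0 < n) : H.A.col (Fin.last n) = H.b := by
  funext i
  simp [A, Amat, b, show ¬ n < n - 1 by omega, show ¬ n = n - 1 by omega]

lemma isU_A (hn : 0 < n) : IsU H.A := by
  have hcases : ∀ j : Fin (n + 1), (j : ℕ) < n - 1 ∨ (j : ℕ) = n - 1 ∨ j = Fin.last n := by
    intro j
    have := j.2
    rw [Fin.ext_iff, Fin.val_last]
    omega
  have hg := H.isGeoPair
  have hva : ∀ j, herm H.a (H.v j) = 0 := fun j => by rw [← herm_conj, H.herm_v_a, star_zero]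
  have hvb : ∀ j, herm H.b (H.v j) = 0 := fun j => by rw [← herm_conj, H.herm_v_b, star_zero]
  have hba : herm H.b H.a = 0 := by rw [← herm_conj, hg.orth, star_zero]
  refine isU_of_herm_col fun i j => ?_
  rw [sigmaM, Matrix.diagonal_apply]
  rcases hcases i with hi | hi | rfl <;> rcases hcases j with hj | hj | rfl
  · have h1 : i ≠ Fin.last n := by rintro rfl; rw [Fin.val_last] at hi; omega
    simp [H.A_col_of_lt hi, H.A_col_of_lt hj, H.v_on, h1, Fin.ext_iff, eq_comm]
  · rw [H.A_col_of_lt hi, H.A_col_of_eq hj, hva, if_neg (by rintro rfl; omega)]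
  · rw [H.A_col_of_lt hi, H.A_col_last hn, hvb,
      if_neg (by rintro rfl; rw [Fin.val_last] at hi; omega)]
  · rw [H.A_col_of_eq hi, H.A_col_of_lt hj, H.herm_v_a, if_neg (by rintro rfl; omega)]
  · have h1 : i ≠ Fin.last n := by rintro rfl; rw [Fin.val_last] at hi; omega
    rw [H.A_col_of_eq hi, H.A_col_of_eq hj, hg.pos, if_pos (Fin.ext (hi.trans hj.symm)), if_neg h1]
  · rw [H.A_col_of_eq hi, H.A_col_last hn, hba,
      if_neg (by rintro rfl; rw [Fin.val_last] at hi; omega)]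
  · rw [H.A_col_last hn, H.A_col_of_lt hj, H.herm_v_b,
      if_neg (by rintro rfl; rw [Fin.val_last] at hj; omega)]
  · rw [H.A_col_last hn, H.A_col_of_eq hj, hg.orth,
      if_neg (by rintro rfl; rw [Fin.val_last] at hj; omega)]
  · rw [H.A_col_last hn, hg.neg, if_pos rfl, if_pos rfl]

lemma A_mulVec_curve (hn : 0 < n) (x : ℝ) :
    H.A *ᵥ snoc1 (curve n hn x) = (x : ℂ) • H.a + H.b := by
  have h1 : snoc1 (curve n hn x) =
      (x : ℂ) • Pi.single (lastI n hn).castSucc (1 : ℂ) + Pi.single (Fin.last n) 1 := by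
    funext i
    refine Fin.lastCases ?_ (fun i => ?_) i
    · simp [(Fin.castSucc_lt_last _).ne']
    · simp [curve, Pi.single_apply, (Fin.castSucc_lt_last _).ne]
  rw [h1, Matrix.mulVec_add, Matrix.mulVec_smul, Matrix.mulVec_single_one,
    Matrix.mulVec_single_one, H.A_col_last hn, H.A_col_of_eq (by simp [lastI])]

lemma A_mulVec_curve_tanh (hn : 0 < n) (t : ℝ) :
    (Real.cosh t : ℂ) • (H.A *ᵥ snoc1 (curve n hn (Real.tanh t))) = geoPath H.a H.b t := by
  rw [H.A_mulVec_curve hn, smul_add, smul_smul, geoPath, ← Complex.ofReal_mul,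
    Real.tanh_eq_sinh_div_cosh, mul_div_cancel₀ _ (Real.cosh_pos t).ne']

lemma T_eq : H.T = Real.tanh H.len := by
  have h0 := abs_pos.mpr H.lam_ne_zero
  rw [T, ← sq_abs, Real.tanh_eq, len, Real.exp_neg, Real.exp_log h0]
  field_simp

lemma defect_curve (hn : 0 < n) (x : ℝ) : defect (curve n hn x) = 1 - x ^ 2 := by
  simp [defect, curve, apply_ite, Finset.sum_ite_eq']

lemma g0_mulVec (hn : 0 < n) : H.g0 *ᵥ snoc1 0 =
    (H.sgn * (Real.cosh H.len : ℂ)) • snoc1 (curve n hn (Real.tanh H.len)) := by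
  have h0 := H.A_mulVec_curve_tanh hn 0
  have h1 : curve n hn (Real.tanh 0) = 0 := by
    funext i
    simp [curve]
  rw [h1, Real.cosh_zero, Complex.ofReal_one, one_smul] at h0
  rw [g0, ← Matrix.mulVec_mulVec, ← Matrix.mulVec_mulVec, h0, H.mulVec_geoPath, zero_add,
    Matrix.mulVec_smul, ← H.A_mulVec_curve_tanh hn, Matrix.mulVec_smul, Matrix.mulVec_mulVec,
    (H.isU_A hn).inv_mul_cancel, Matrix.one_mulVec, smul_smul]

lemma lenC_eq (hn : 0 < n) : H.lenC = 2 * H.len := by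
  have hc := Real.cosh_pos H.len
  have h1 : act H.g0 0 = curve n hn (Real.tanh H.len) := by
    refine act_eq_of_mulVec ?_ (H.g0_mulVec hn)
    refine mul_ne_zero ?_ (Complex.ofReal_ne_zero.mpr hc.ne')
    intro h
    simpa [h] using H.sgn_mul_self
  have h2 : ∀ w : Fin n → ℂ, pair 0 w = -1 := fun w => by simp [pair]
  have h3 : ∀ w : Fin n → ℂ, pair w 0 = -1 := fun w => by simp [pair]
  rw [lenC, h1, rho, h2, h3, h2, pair_self, defect_curve]
  have h4 : (-1 * -1 : ℂ).re = 1 := by norm_num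
  have h5 : (-1 * -((1 - Real.tanh H.len ^ 2 : ℝ) : ℂ)).re = (Real.cosh H.len ^ 2)⁻¹ := by
    rw [neg_mul_neg, one_mul, Complex.ofReal_re, Real.tanh_eq_sinh_div_cosh, div_pow,
      Real.cosh_sq']
    field_simp
    ring
  rw [h4, h5, one_div, inv_inv, Real.sqrt_sq hc.le, arcosh_cosh H.len_pos.le]

end HypElt

end ClosedGeodesic

section RelativeSeries

variable {n : ℕ} {G : DiscreteGroup n}

/-- The constant `n! / πⁿ` of the Bergman kernel. -/
noncomputable def bergmanConst (n : ℕ) : ℝ := n.factorial / Real.pi ^ n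

lemma bergmanConst_pos (n : ℕ) : 0 < bergmanConst n := by
  unfold bergmanConst
  have := Real.pi_pos
  positivity

lemma Kr_eq (z : Fin n → ℂ) : Kr z = bergmanConst n * (defect z)⁻¹ ^ (n + 1) := rfl

lemma Kc_pow_mul_jac_pow {A : Matrix (Fin (n + 1)) (Fin (n + 1)) ℂ} (hA : IsU A)
    {z : Fin n → ℂ} (hz : z ∈ ball n) (w : Fin n → ℂ) (k : ℕ) :
    Kc (act A z) w ^ k * jac A z ^ k =
      (bergmanConst n : ℂ) ^ k * ker ((n + 1) * k) (A *ᵥ snoc1 z) (snoc1 w) := by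
  rw [hA.mulVec_snoc1 hz, ker_smul_left, ker, herm_snoc1, Kc, jac, mul_pow, ← pow_mul, ← pow_mul]
  simp only [bergmanConst]
  ring

lemma ThetaPt_eq {z : Fin n → ℂ} (hz : z ∈ ball n) (w : Fin n → ℂ) (k : ℕ) :
    ThetaPt G k w z = (cB n k : ℂ) * (bergmanConst n : ℂ) ^ k *
      ∑' A : ↥G.Γ, ker ((n + 1) * k) (A.1 *ᵥ snoc1 z) (snoc1 w) := by
  rw [ThetaPt, mul_assoc]
  congr 1
  rw [← tsum_mul_left]
  exact tsum_congr fun A => Kc_pow_mul_jac_pow (G.isU A.2) hz w k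

/-- A Poincaré series may be integrated along a path term by term. -/
lemma integral_tsum_ker {N : ℕ} {u : ℝ → Fin (n + 1) → ℂ}
    (hs : Summable fun A : ↥G.Γ => (height A.1)⁻¹ ^ N) (hu : Continuous u)
    (hneg : ∀ t, hq (u t) < 0) (L : ℝ) {z : Fin n → ℂ} (hz : z ∈ ball n) :
    ∫ t in Set.Ioc 0 L, ∑' A : ↥G.Γ, ker N (A.1 *ᵥ snoc1 z) (u t) =
      G.poincare (pathKer N u L) z := by
  obtain ⟨c, hc, hgap⟩ := exists_gap_path hu hneg L
  have hz' := hq_snoc1_neg hz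
  have hg := gap_pos hz'
  have hbound : ∀ A : ↥G.Γ, ∀ t ∈ Set.Ioc 0 L, ‖ker N (A.1 *ᵥ snoc1 z) (u t)‖ ≤
      (c * gap (snoc1 z))⁻¹ ^ N * (height A.1)⁻¹ ^ N := by
    intro A t ht
    have hh : 0 < height A.1 := one_pos.trans_le (G.isU A.2).one_le_last
    rw [← mul_pow, ← mul_inv]
    refine norm_ker_le_of_le N (by positivity) ?_
    refine le_trans ?_ ((G.isU A.2).norm_herm_mulVec_ge (hneg t) hz')
    exact mul_le_mul_of_nonneg_right (mul_le_mul_of_nonneg_right (hgap t ht) hg.le) hh.le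
  have hint : ∀ A : ↥G.Γ, Integrable (fun t => ker N (A.1 *ᵥ snoc1 z) (u t))
      (volume.restrict (Set.Ioc 0 L)) := fun A =>
    IntegrableOn.of_bound (by simp)
      (measurable_ker_comp N measurable_const hu.measurable).aestronglyMeasurable
      _ ((ae_restrict_iff' measurableSet_Ioc).mpr (Eventually.of_forall (hbound A)))
  rw [DiscreteGroup.poincare, ← integral_tsum_of_summable_integral_norm hint]
  · rfl
  · refine Summable.of_nonneg_of_le (fun A => integral_nonneg fun _ => norm_nonneg _)
      (fun A => ?_) ((hs.mul_left ((c * gap (snoc1 z))⁻¹ ^ N)).mul_right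
        (volume.real (Set.Ioc 0 L)))
    refine (Real.le_norm_self _).trans ?_
    refine norm_setIntegral_le_of_norm_le_const (by simp) fun t ht => ?_
    rw [norm_norm]
    exact hbound A t ht

lemma hasDerivAt_tanh (t : ℝ) : HasDerivAt Real.tanh (1 - Real.tanh t ^ 2) t := by
  have h := (Real.hasDerivAt_sinh t).div (Real.hasDerivAt_cosh t) (Real.cosh_pos t).ne'
  have hc := (Real.cosh_pos t).ne'
  have heq : Real.tanh = fun t => Real.sinh t / Real.cosh t :=
    funext Real.tanh_eq_sinh_div_cosh
  have h2 : 1 - Real.tanh t ^ 2 = (Real.cosh t * Real.cosh t - Real.sinh t * Real.sinh t) /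
      Real.cosh t ^ 2 := by
    rw [Real.tanh_eq_sinh_div_cosh]
    field_simp
  rw [h2, heq]
  exact h

lemma one_sub_tanh_sq (t : ℝ) : 1 - Real.tanh t ^ 2 = (Real.cosh t ^ 2)⁻¹ := by
  have hc := (Real.cosh_pos t).ne'
  rw [Real.tanh_eq_sinh_div_cosh]
  field_simp
  rw [Real.cosh_sq]
  ring

lemma one_sub_tanh_sq_pos (t : ℝ) : 0 < 1 - Real.tanh t ^ 2 := by
  rw [one_sub_tanh_sq]
  have := Real.cosh_pos t
  positivity

lemma strictMono_tanh : StrictMono Real.tanh :=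
  strictMono_of_hasDerivAt_pos hasDerivAt_tanh one_sub_tanh_sq_pos

lemma image_tanh_Ioc (L : ℝ) : Real.tanh '' Set.Ioc 0 L = Set.Ioc 0 (Real.tanh L) := by
  ext x
  constructor
  · rintro ⟨t, ht, rfl⟩
    exact ⟨by simpa using strictMono_tanh ht.1, strictMono_tanh.monotone ht.2⟩
  · rintro ⟨h0, h1⟩
    have hx : x ∈ Set.Ioo (-1 : ℝ) 1 := ⟨by linarith, by
      have := one_sub_tanh_sq_pos L
      nlinarith⟩
    refine ⟨Real.artanh x, ⟨?_, ?_⟩, Real.tanh_artanh hx⟩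
    · rw [← strictMono_tanh.lt_iff_lt, Real.tanh_artanh hx, Real.tanh_zero]; exact h0
    · rw [← strictMono_tanh.le_iff_le, Real.tanh_artanh hx]; exact h1

/-- Substituting `x = tanh t`. -/
lemma intervalIntegral_tanh {L : ℝ} (hL : 0 ≤ L) (f : ℝ → ℂ) :
    ∫ x in (0 : ℝ)..Real.tanh L, f x =
      ∫ t in Set.Ioc 0 L, ((1 - Real.tanh t ^ 2 : ℝ) : ℂ) * f (Real.tanh t) := by
  rw [intervalIntegral.integral_of_le (by simpa using strictMono_tanh.monotone hL),
    ← image_tanh_Ioc, integral_image_eq_integral_abs_deriv_smul measurableSet_Ioc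
      (fun t _ => (hasDerivAt_tanh t).hasDerivWithinAt) strictMono_tanh.injective.injOn]
  refine integral_congr_ae (Eventually.of_forall fun t => ?_)
  simp only [abs_of_pos (one_sub_tanh_sq_pos t), Complex.real_smul]

namespace HypElt

variable (H : HypElt n G)

/-- The point of the axis of `γ` at distance parameter `t`. -/
lemma exists_geoPath_eq (hn : 0 < n) (t : ℝ) :
    ∃ δ : ℝ, 0 < δ ∧ (defect (act H.A (curve n hn (Real.tanh t))))⁻¹ = δ ^ 2 ∧
      geoPath H.a H.b t = (-(δ : ℂ)) • snoc1 (act H.A (curve n hn (Real.tanh t))) := by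
  have hx : curve n hn (Real.tanh t) ∈ ball n := by
    rw [mem_ball_iff, defect_curve]
    exact one_sub_tanh_sq_pos t
  have h1 := H.A_mulVec_curve_tanh hn t
  rw [(H.isU_A hn).mulVec_snoc1 hx, smul_smul] at h1
  set w := act H.A (curve n hn (Real.tanh t))
  set δ : ℝ := Real.exp t * (-H.r)⁻¹ + Real.exp (-t) * 2⁻¹ with hδ
  have hr : 0 < (-H.r)⁻¹ := inv_pos.mpr (neg_pos.mpr H.r_neg)
  have hδ0 : 0 < δ := by positivity
  have h2 : (Real.cosh t : ℂ) * denom H.A (curve n hn (Real.tanh t)) = -(δ : ℂ) := by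
    have h3 := congrFun h1 (Fin.last n)
    simp only [H.geoPath_eq, Pi.smul_apply, Pi.sub_apply, snoc1_last, smul_eq_mul, mul_one,
      H.pair_eq_r] at h3
    rw [h3, hδ, inv_neg]
    push_cast
    ring
  rw [h2] at h1
  refine ⟨δ, hδ0, ?_, h1.symm⟩
  have h4 := H.isGeoPair.hq_geoPath t
  rw [← h1, hq_smul, hq_snoc1', norm_neg, Complex.norm_of_nonneg hδ0.le] at h4
  exact inv_eq_of_mul_eq_one_left (by linarith)

lemma ThetaPt_axis (hn : 0 < n) (k : ℕ) (t : ℝ) {z : Fin n → ℂ} (hz : z ∈ ball n) :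
    ThetaPt G k (act H.A (curve n hn (Real.tanh t))) z *
      ((Kr (act H.A (curve n hn (Real.tanh t))) ^ (-(k : ℝ) / 2) : ℝ) : ℂ) =
    (cB n k : ℂ) * ((bergmanConst n ^ ((k : ℝ) / 2) : ℝ) : ℂ) * (-1) ^ ((n + 1) * k) *
      ∑' A : ↥G.Γ, ker ((n + 1) * k) (A.1 *ᵥ snoc1 z) (geoPath H.a H.b t) := by
  obtain ⟨δ, hδ, hdef, hu⟩ := H.exists_geoPath_eq hn t
  have hC := bergmanConst_pos n
  have hKr : Kr (act H.A (curve n hn (Real.tanh t))) ^ (-(k : ℝ) / 2) =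
      bergmanConst n ^ (-(k : ℝ) / 2) * δ⁻¹ ^ ((n + 1) * k) := by
    rw [Kr_eq, hdef, Real.mul_rpow hC.le (by positivity), ← pow_mul, ← Real.rpow_natCast,
      ← Real.rpow_mul hδ.le, inv_pow, ← Real.rpow_natCast δ ((n + 1) * k), ← Real.rpow_neg hδ.le]
    congr 2
    push_cast
    ring
  have hCk : bergmanConst n ^ k * bergmanConst n ^ (-(k : ℝ) / 2) =
      bergmanConst n ^ ((k : ℝ) / 2) := by
    rw [← Real.rpow_natCast, ← Real.rpow_add hC]
    congr 1
    ring
  have hterm : ∀ A : ↥G.Γ, ker ((n + 1) * k) (A.1 *ᵥ snoc1 z) (geoPath H.a H.b t) =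
      (-1) ^ ((n + 1) * k) * (δ⁻¹ ^ ((n + 1) * k) : ℝ) * ker ((n + 1) * k) (A.1 *ᵥ snoc1 z)
        (snoc1 (act H.A (curve n hn (Real.tanh t)))) := by
    intro A
    rw [hu, ker_smul_right, star_neg, Complex.star_def, Complex.conj_ofReal, inv_neg, neg_pow]
    push_cast
    rfl
  simp only [hterm, tsum_mul_left]
  rw [ThetaPt_eq hz, hKr, ← hCk]
  have h1 : ((-1 : ℂ) ^ ((n + 1) * k)) * (-1) ^ ((n + 1) * k) = 1 := by
    rw [← mul_pow]; norm_num
  push_cast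
  linear_combination (-(cB n k : ℂ) * (bergmanConst n : ℂ) ^ k *
    ((bergmanConst n ^ (-(k : ℝ) / 2) : ℝ) : ℂ) * ((δ : ℂ)⁻¹ ^ ((n + 1) * k)) *
    ∑' A : ↥G.Γ, ker ((n + 1) * k) (A.1 *ᵥ snoc1 z)
      (snoc1 (act H.A (curve n hn (Real.tanh t))))) * h1

lemma Kr_curve_rpow (hn : 0 < n) (t : ℝ) :
    Kr (curve n hn (Real.tanh t)) ^ (((n : ℝ) + 1))⁻¹ =
      bergmanConst n ^ (((n : ℝ) + 1))⁻¹ * (1 - Real.tanh t ^ 2)⁻¹ := by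
  have h := one_sub_tanh_sq_pos t
  rw [Kr_eq, defect_curve, Real.mul_rpow (bergmanConst_pos n).le (by positivity)]
  congr 1
  have := Real.pow_rpow_inv_natCast (inv_nonneg.mpr h.le) (n := n + 1) (by omega)
  exact_mod_cast this

/-- The relative Poincaré series as the Poincaré series of a path in the light cone. -/
theorem ThetaC_eq (hn : 0 < n) {k : ℕ}
    (hs : Summable fun A : ↥G.Γ => (height A.1)⁻¹ ^ ((n + 1) * k))
    {z : Fin n → ℂ} (hz : z ∈ ball n) :
    ThetaC hn H k z =
      ((cB n k * bergmanConst n ^ ((k : ℝ) / 2) * bergmanConst n ^ (((n : ℝ) + 1))⁻¹ *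
        (-1) ^ ((n + 1) * k) : ℝ) : ℂ) *
      G.poincare (pathKer ((n + 1) * k) (geoPath H.a H.b) H.len) z := by
  have hg := H.isGeoPair
  rw [ThetaC, T_eq, intervalIntegral_tanh H.len_pos.le,
    ← integral_tsum_ker hs (continuous_geoPath _ _) hg.hq_geoPath_neg _ hz, ← integral_const_mul]
  refine integral_congr_ae (Eventually.of_forall fun t => ?_)
  have h := (one_sub_tanh_sq_pos t).ne'
  simp only
  rw [H.ThetaPt_axis hn k t hz, Kr_curve_rpow]
  have h1 : ((1 - Real.tanh t ^ 2 : ℝ) : ℂ) * (((1 - Real.tanh t ^ 2)⁻¹ : ℝ) : ℂ) = 1 := by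
    rw [← Complex.ofReal_mul, mul_inv_cancel₀ h, Complex.ofReal_one]
  simp only [Complex.ofReal_mul, Complex.ofReal_natCast, Complex.ofReal_pow, Complex.ofReal_neg,
    Complex.ofReal_one]
  linear_combination ((cB n k : ℂ) * ((bergmanConst n ^ ((k : ℝ) / 2) : ℝ) : ℂ) *
    (-1) ^ ((n + 1) * k) *
      (∑' A : ↥G.Γ, ker ((n + 1) * k) (A.1 *ᵥ snoc1 z) (geoPath H.a H.b t)) *
      ((bergmanConst n ^ (((n : ℝ) + 1))⁻¹ : ℝ) : ℂ)) * h1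

end HypElt

end RelativeSeries

section Asymptotics

variable {n : ℕ} {G : DiscreteGroup n}

lemma setIntegral_hypMeasure {F : Set (Fin n → ℂ)} (hFb : F ⊆ ball n) (hF : MeasurableSet F)
    (f : (Fin n → ℂ) → ℂ) :
    ∫ z in F, f z ∂hypMeasure n = ∫ z in F, ((defect z)⁻¹ ^ (n + 1)) • f z := by
  rw [← integral_indicator hF, integral_hypMeasure]
  have h : ∀ z, ((defect z)⁻¹ ^ (n + 1)) • F.indicator f z =
      F.indicator (fun z => ((defect z)⁻¹ ^ (n + 1)) • f z) z := by
    intro z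
    by_cases hz : z ∈ F <;> simp [hz]
  simp only [h]
  rw [setIntegral_indicator hF, Set.inter_eq_right.mpr hFb]

lemma Kr_zpow {z : Fin n → ℂ} (hz : z ∈ ball n) {k : ℕ} (hk : 1 ≤ k) :
    Kr z ^ ((1 : ℤ) - (k : ℤ)) =
      bergmanConst n ^ ((1 : ℤ) - (k : ℤ)) *
        (defect z ^ ((n + 1) * k) * (defect z)⁻¹ ^ (n + 1)) := by
  have hd := (mem_ball_iff.mp hz).ne'
  rw [Kr_eq, mul_zpow]
  congr 1
  obtain ⟨j, rfl⟩ := Nat.exists_eq_add_of_le hk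
  rw [show (1 : ℤ) - ((1 + j : ℕ) : ℤ) = -(j : ℤ) by push_cast; ring, _root_.zpow_neg, zpow_natCast,
    inv_pow, inv_pow, inv_inv, mul_add, mul_one, pow_add _ (n + 1), pow_mul]
  field_simp

namespace HypElt

variable (H : HypElt n G)

/-- The Petersson norm of the relative Poincaré series as a sum of double integrals over the
closed geodesic. -/
theorem iprod_ThetaC (hn : 0 < n) {k : ℕ} (hk : 2 ≤ k)
    (hs : Summable fun A : ↥G.Γ => (height A.1)⁻¹ ^ ((n + 1) * k))
    {F : Set (Fin n → ℂ)} (hF : IsFundDom G F) :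
    iprod F k (ThetaC hn H k) (ThetaC hn H k) =
      ((cB n k * bergmanConst n ^ (2 / ((n : ℝ) + 1)) : ℝ) : ℂ) *
        ∑' A : ↥G.Γ, pathEnergy ((n + 1) * k) (geoPath H.a H.b) H.len A.1 := by
  have hC := bergmanConst_pos n
  set N := (n + 1) * k with hN
  set P := G.poincare (pathKer N (geoPath H.a H.b) H.len) with hP
  set D : ℝ := cB n k * bergmanConst n ^ ((k : ℝ) / 2) * bergmanConst n ^ (((n : ℝ) + 1))⁻¹ *
    (-1) ^ N with hD
  have hDstar : star (D : ℂ) = (D : ℂ) := Complex.conj_ofReal D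
  have hT : ∀ z ∈ ball n, ThetaC hn H k z = (D : ℂ) * P z := fun z hz => H.ThetaC_eq hn hs hz
  have h1 : iprod F k (ThetaC hn H k) (ThetaC hn H k) =
      ((D ^ 2 * bergmanConst n ^ ((1 : ℤ) - (k : ℤ)) : ℝ) : ℂ) *
        ∫ z in F, P z * star (P z) * ((defect z ^ N : ℝ) : ℂ) ∂hypMeasure n := by
    rw [setIntegral_hypMeasure hF.1 hF.2.1, ← integral_const_mul, iprod]
    refine setIntegral_congr_fun hF.2.1 fun z hz => ?_
    have hzb := hF.1 hz
    rw [hT z hzb, Kr_zpow hzb (by omega), star_mul', hDstar, Complex.real_smul]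
    push_cast
    ring
  have h2 : mass n N * cB n k * bergmanConst n = 1 := mass_mul_cB hn hk
  have hD2 : D ^ 2 * bergmanConst n ^ ((1 : ℤ) - (k : ℤ)) =
      (cB n k) ^ 2 * bergmanConst n ^ (2 / ((n : ℝ) + 1)) * bergmanConst n := by
    have e1 : ((-1 : ℝ) ^ N) ^ 2 = 1 := by rw [← pow_mul, mul_comm, pow_mul]; norm_num
    have e2 : (bergmanConst n ^ ((k : ℝ) / 2)) ^ 2 = bergmanConst n ^ k := by
      rw [← Real.rpow_natCast, ← Real.rpow_mul hC.le, ← Real.rpow_natCast]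
      congr 1
      push_cast
      ring
    have e3 : (bergmanConst n ^ (((n : ℝ) + 1))⁻¹) ^ 2 = bergmanConst n ^ (2 / ((n : ℝ) + 1)) := by
      rw [← Real.rpow_natCast, ← Real.rpow_mul hC.le]
      congr 1
      push_cast
      ring
    have e4 : bergmanConst n ^ k * bergmanConst n ^ ((1 : ℤ) - (k : ℤ)) = bergmanConst n := by
      rw [← zpow_natCast, ← zpow_add₀ hC.ne', add_sub_cancel, zpow_one]
    rw [hD, mul_pow, mul_pow, mul_pow, e1, e2, e3]
    linear_combination (cB n k : ℝ) ^ 2 * bergmanConst n ^ (2 / ((n : ℝ) + 1)) * e4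
  rw [h1, petersson_pathKer (by rw [hN]; nlinarith) hs (continuous_geoPath _ _)
    H.isGeoPair.hq_geoPath_neg hF, hD2, ← mul_assoc, ← Complex.ofReal_mul]
  congr 2
  linear_combination (cB n k : ℝ) * bergmanConst n ^ (2 / ((n : ℝ) + 1)) * h2

end HypElt

lemma tendsto_cB_div_pow (n : ℕ) :
    Tendsto (fun k : ℕ => (cB n k : ℝ) / (k : ℝ) ^ n) atTop
      (𝓝 (((n : ℝ) + 1) ^ n / n.factorial)) := by
  have hm : Tendsto (fun k : ℕ => (n + 1) * (k - 1) + n) atTop atTop := by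
    refine tendsto_atTop_mono (fun k => ?_) (tendsto_sub_atTop_nat 1)
    nlinarith [Nat.zero_le (n * (k - 1))]
  have h1 := ((isEquivalent_choose n).comp_tendsto hm)
  have hne : ∀ᶠ k : ℕ in atTop, ((fun m : ℕ => ((m : ℝ) ^ n / n.factorial)) ∘
      fun k : ℕ => (n + 1) * (k - 1) + n) k ≠ 0 := by
    filter_upwards [hm.eventually_gt_atTop 0] with k hk
    have : (0 : ℝ) < (((n + 1) * (k - 1) + n : ℕ) : ℝ) := by exact_mod_cast hk
    simp only [Function.comp]
    positivity
  have h2 := (Asymptotics.isEquivalent_iff_tendsto_one hne).mp h1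
  have h3 : Tendsto (fun k : ℕ => (((n + 1) * (k - 1) + n : ℕ) : ℝ) / k) atTop
      (𝓝 ((n : ℝ) + 1)) := by
    have h4 : Tendsto (fun k : ℕ => ((n : ℝ) + 1) - 1 / (k : ℝ)) atTop (𝓝 ((n : ℝ) + 1)) := by
      simpa using tendsto_one_div_atTop_nhds_zero_nat.const_sub ((n : ℝ) + 1)
    refine h4.congr' ?_
    filter_upwards [eventually_ge_atTop 1] with k hk
    have hk0 : (k : ℝ) ≠ 0 := by positivity
    push_cast [Nat.cast_sub hk]
    field_simp
    ring
  have h5 := h2.mul ((h3.pow n).div_const (n.factorial : ℝ))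
  rw [one_mul] at h5
  refine h5.congr' ?_
  filter_upwards [hne, eventually_ge_atTop 1] with k hk hk1
  have hk0 : (k : ℝ) ≠ 0 := by positivity
  simp only [Function.comp, Pi.div_apply] at hk ⊢
  have hf : (n.factorial : ℝ) ≠ 0 := by positivity
  rw [div_pow, cB]
  have hk' : (((n + 1) * (k - 1) + n : ℕ) : ℝ) ^ n ≠ 0 := fun h => hk (by rw [h, zero_div])
  field_simp

/-- The constant in the asymptotic formula. -/
lemma leading_constant {l : ℝ} (hl : 0 < l) {k : ℕ} (hk : 1 ≤ k) :
    ((n : ℝ) + 1) ^ n / n.factorial * bergmanConst n ^ (2 / ((n : ℝ) + 1)) *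
        (l * √(2 * Real.pi)) * (k : ℝ) ^ n / √(((n + 1) * k : ℕ) : ℝ) =
      (k : ℝ) ^ ((n : ℝ) - 1 / 2) * ((n : ℝ) + 1) ^ ((n : ℝ) - 1 / 2) /
          (Real.pi ^ ((3 * (n : ℝ) - 1) / (2 * (n : ℝ) + 2)) *
            (n.factorial : ℝ) ^ (((n : ℝ) - 1) / ((n : ℝ) + 1))) *
        (2 * l / √2) := by
  have hk0 : (0 : ℝ) < k := by exact_mod_cast hk
  have hn1 : (0 : ℝ) < (n : ℝ) + 1 := by positivity
  have hf : (0 : ℝ) < n.factorial := by positivity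
  have hpi := Real.pi_pos
  have s2 : √2 * √2 = (2 : ℝ) := Real.mul_self_sqrt (by norm_num)
  have e1 : (k : ℝ) ^ ((n : ℝ) - 1 / 2) = (k : ℝ) ^ n / √k := by
    rw [Real.rpow_sub hk0, Real.rpow_natCast, Real.sqrt_eq_rpow]
  have e2 : ((n : ℝ) + 1) ^ ((n : ℝ) - 1 / 2) = ((n : ℝ) + 1) ^ n / √((n : ℝ) + 1) := by
    rw [Real.rpow_sub hn1, Real.rpow_natCast, Real.sqrt_eq_rpow]
  have e3 : √(((n + 1) * k : ℕ) : ℝ) = √((n : ℝ) + 1) * √k := by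
    push_cast
    exact Real.sqrt_mul hn1.le _
  have e4 : bergmanConst n ^ (2 / ((n : ℝ) + 1)) =
      (n.factorial : ℝ) ^ (2 / ((n : ℝ) + 1)) / Real.pi ^ ((n : ℝ) * (2 / ((n : ℝ) + 1))) := by
    rw [bergmanConst, Real.div_rpow hf.le (by positivity), ← Real.rpow_natCast Real.pi,
      ← Real.rpow_mul hpi.le]
  have e5 : (n.factorial : ℝ) ^ (2 / ((n : ℝ) + 1)) *
      (n.factorial : ℝ) ^ (((n : ℝ) - 1) / ((n : ℝ) + 1)) = n.factorial := by
    rw [← Real.rpow_add hf, ← add_div, show (2 : ℝ) + (n - 1) = n + 1 by ring, div_self hn1.ne',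
      Real.rpow_one]
  have e6 : √Real.pi * Real.pi ^ ((3 * (n : ℝ) - 1) / (2 * (n : ℝ) + 2)) =
      Real.pi ^ ((n : ℝ) * (2 / ((n : ℝ) + 1))) := by
    rw [Real.sqrt_eq_rpow, ← Real.rpow_add hpi]
    congr 1
    field_simp
    ring
  rw [e1, e2, e3, e4, Real.sqrt_mul zero_le_two, ← e6]
  have p1 : 0 < Real.pi ^ ((3 * (n : ℝ) - 1) / (2 * (n : ℝ) + 2)) := by positivity
  have p2 : 0 < (n.factorial : ℝ) ^ (((n : ℝ) - 1) / ((n : ℝ) + 1)) := by positivity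
  have p3 : 0 < √(k : ℝ) := by positivity
  have p4 : 0 < √((n : ℝ) + 1) := by positivity
  have p5 : 0 < √Real.pi := by positivity
  have p6 : 0 < √(2 : ℝ) := by positivity
  rw [eq_div_of_mul_eq p2.ne' e5]
  generalize Real.pi ^ ((3 * (n : ℝ) - 1) / (2 * (n : ℝ) + 2)) = x at *
  generalize (n.factorial : ℝ) ^ (((n : ℝ) - 1) / ((n : ℝ) + 1)) = y at *
  generalize √(2 : ℝ) = w at *
  rw [← s2]
  field_simp

end Asymptotics

end BallPaper

open BallPaper Filter Topology in
/-- Theorem, main result: as k → ∞,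
(Θ_C^{(k)}, Θ_C^{(k)}) ~ k^{n−1/2} (n+1)^{n−1/2} / (π^{(3n−1)/(2n+2)} (n!)^{(n−1)/(n+1)})
· l(C)/√2, i.e. the ratio of the two sides tends to 1. -/
theorem main_asymptotics (n : ℕ) (hn : 0 < n) (G : BallPaper.DiscreteGroup n)
    (H : BallPaper.HypElt n G) (F : Set (Fin n → ℂ)) (hF : IsFundDom G F) :
    Tendsto (fun k : ℕ =>
      iprod F k (ThetaC hn H k) (ThetaC hn H k) /
        (((k : ℝ) ^ ((n : ℝ) - 1 / 2) * ((n : ℝ) + 1) ^ ((n : ℝ) - 1 / 2) /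
            (Real.pi ^ ((3 * (n : ℝ) - 1) / (2 * (n : ℝ) + 2)) *
              (Nat.factorial n : ℝ) ^ (((n : ℝ) - 1) / ((n : ℝ) + 1))) *
            (H.lenC / Real.sqrt 2) : ℝ) : ℂ))
      atTop (𝓝 1) := by
  obtain ⟨M, hM⟩ := G.exists_summable
  have hC := bergmanConst_pos n
  have hl := H.len_pos
  have hN : Tendsto (fun k : ℕ => (n + 1) * k) atTop atTop :=
    tendsto_id.const_mul_atTop' n.succ_pos
  have hE := (H.isGeoPair.tendsto_tsum_energy G hl.le fun A hA hA1 =>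
    H.isGeoPair.subsingleton_matches H.mem H.mulVec_geoPath H.primitive hA hA1).comp hN
  have hc := (Complex.continuous_ofReal.tendsto _).comp (tendsto_cB_div_pow n)
  set c : ℝ := ((n : ℝ) + 1) ^ n / n.factorial with hcdef
  set l : ℝ := H.len * √(2 * Real.pi) with hldef
  have hc0 : (c : ℂ) ≠ 0 := Complex.ofReal_ne_zero.mpr (by positivity)
  have hl0 : (l : ℂ) ≠ 0 := Complex.ofReal_ne_zero.mpr (by positivity)
  have hlim := (hc.mul hE).div_const ((c : ℂ) * (l : ℂ))
  rw [div_self (mul_ne_zero hc0 hl0)] at hlim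
  refine hlim.congr' ?_
  filter_upwards [eventually_ge_atTop 2, hN.eventually_ge_atTop M] with k hk hkM
  have hs : Summable fun A : ↥G.Γ => (height A.1)⁻¹ ^ ((n + 1) * k) := by
    refine Summable.of_nonneg_of_le (fun A => ?_) (fun A => ?_) hM
    · have : 0 < height A.1 := one_pos.trans_le (G.isU A.2).one_le_last
      positivity
    · have : 1 ≤ height A.1 := (G.isU A.2).one_le_last
      exact pow_le_pow_of_le_one (by positivity) (inv_le_one_of_one_le₀ this) hkM
  have hk0 : (0 : ℝ) < k := by positivity
  have hNpos : 0 < √(((n + 1) * k : ℕ) : ℝ) := by positivity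
  rw [H.iprod_ThetaC hn hk hs hF, H.lenC_eq hn, ← leading_constant hl (by omega : 1 ≤ k),
    ← hcdef, ← hldef]
  have q1 : (k : ℂ) ≠ 0 := by exact_mod_cast hk0.ne'
  have q2 : ((√(((n + 1) * k : ℕ) : ℝ) : ℝ) : ℂ) ≠ 0 := Complex.ofReal_ne_zero.mpr hNpos.ne'
  have q3 : ((bergmanConst n ^ (2 / ((n : ℝ) + 1)) : ℝ) : ℂ) ≠ 0 :=
    Complex.ofReal_ne_zero.mpr (by positivity)
  simp only [Function.comp, Complex.ofReal_mul, Complex.ofReal_div, Complex.ofReal_pow,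
    Complex.ofReal_natCast]
  field_simp
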